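/- arXiv:2407.08373 — 3 statements merged into one kernel-verified Lean document; each statement's English description precedes it below -/
import Mathlib

section
/- Let N ≥ 1 and s ∈ (0,1). Then 𝔥_{s,1}(ℝ^N∖{0}) = (4/s)·π^{N/2}·Γ(1−s) / (Γ((N−s)/2)·Γ(1−s/2)), and moreover for every smooth compactly supported function u on ℝ^N one has [u]_{W^{s,1}(ℝ^N)} ≥ (4/s)·π^{N/2}·Γ(1−s)/(Γ((N−s)/2)·Γ(1−s/2)) · ∫_{ℝ^N} |u(x)|/|x|^s dx. -/
open MeasureTheory Metric Set Filter
open scoped ENNReal NNReal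

/-- The `p`-th power of the Gagliardo `(s,p)`-seminorm of `u` on `A ⊆ ℝ^N`,
valued in `[0,∞]`. -/
noncomputable def gagliardo (N : ℕ) (s p : ℝ) (A : Set (EuclideanSpace ℝ (Fin N)))
    (u : EuclideanSpace ℝ (Fin N) → ℝ) : ℝ≥0∞ :=
  ∫⁻ x in A, ∫⁻ y in A, ENNReal.ofReal (|u x - u y| ^ p / dist x y ^ ((N : ℝ) + s * p))

/-- The sharp fractional Hardy constant `𝔥_{s,p}(Ω)`, an element of `[0,∞]`. -/
noncomputable def hardyConst (N : ℕ) (s p : ℝ) (Ω : Set (EuclideanSpace ℝ (Fin N))) : ℝ≥0∞ :=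
  sInf { c : ℝ≥0∞ | ∃ u : EuclideanSpace ℝ (Fin N) → ℝ,
    ContDiff ℝ (⊤ : ℕ∞) u ∧ HasCompactSupport u ∧ tsupport u ⊆ Ω ∧
    (∫ x in Ω, |u x| ^ p / Metric.infDist x (frontier Ω) ^ (s * p)) = 1 ∧
    c = gagliardo N s p Set.univ u }

/-- The half-space `ℍ^N₊ = (0,∞) × ℝ^{N-1}`. -/
noncomputable def halfSpace (N : ℕ) (hN : 0 < N) : Set (EuclideanSpace ℝ (Fin N)) :=
  {x | 0 < x ⟨0, hN⟩}



lemma lint_polar (N : ℕ) (hN : 0 < N) : ∃ S : ℝ≥0∞, S ≠ 0 ∧ S ≠ ∞ ∧ ∀ f : ℝ → ℝ≥0∞, Measurable f →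
    ∫⁻ x : EuclideanSpace ℝ (Fin N), f ‖x‖ = S * ∫⁻ r in Ioi (0:ℝ), ENNReal.ofReal (r ^ (N-1)) * f r := by
  have : Nonempty (Fin N) := ⟨⟨0, hN⟩⟩
  have hd : Module.finrank ℝ (EuclideanSpace ℝ (Fin N)) = N := by simp
  refine ⟨(volume : Measure (EuclideanSpace ℝ (Fin N))).toSphere univ, ?_, measure_ne_top _ _, ?_⟩
  · rw [Measure.toSphere_apply_univ, hd]
    refine mul_ne_zero (by exact_mod_cast hN.ne') (measure_ball_pos _ _ one_pos).ne'
  intro f hf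
  have h := (volume : Measure (EuclideanSpace ℝ (Fin N))).measurePreserving_homeomorphUnitSphereProd
  have h1 := h.lintegral_comp_emb (Homeomorph.measurableEmbedding _) (fun p => f p.2)
  simp only [homeomorphUnitSphereProd_apply_snd_coe] at h1
  rw [← restrict_compl_singleton (μ := volume) (0 : EuclideanSpace ℝ (Fin N)),
    ← lintegral_subtype_comap (measurableSet_singleton _).compl, h1, hd]
  have hm : Measurable fun r : Ioi (0:ℝ) => f r := hf.comp measurable_subtype_coe
  have key : ∫⁻ r, f r.1 ∂(Measure.volumeIoiPow (N-1)) =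
      ∫⁻ r in Ioi (0:ℝ), ENNReal.ofReal (r ^ (N-1)) * f r := by
    rw [Measure.volumeIoiPow, lintegral_withDensity_eq_lintegral_mul _ (by fun_prop) hm,
      ← lintegral_subtype_comap measurableSet_Ioi]
    rfl
  rw [lintegral_prod _ (by fun_prop)]
  simp only [lintegral_const]
  rw [key, mul_comm, restrict_compl_singleton]

/-- moving one vector to another by an isometry -/
lemma exists_rot {N : ℕ} (v w : EuclideanSpace ℝ (Fin N)) (h : ‖v‖ = ‖w‖) :
    ∃ L : EuclideanSpace ℝ (Fin N) ≃ₗᵢ[ℝ] EuclideanSpace ℝ (Fin N), L v = w :=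
  ⟨_, Submodule.reflection_sub h⟩

lemma lint_rot {N : ℕ} (L : EuclideanSpace ℝ (Fin N) ≃ₗᵢ[ℝ] EuclideanSpace ℝ (Fin N))
    (f : EuclideanSpace ℝ (Fin N) → ℝ≥0∞) : ∫⁻ x, f (L x) = ∫⁻ x, f x :=
  L.measurePreserving.lintegral_comp_emb L.toMeasurableEquiv.measurableEmbedding f

lemma lint_smul {N : ℕ} {r : ℝ} (hr : 0 < r) 
    (f : EuclideanSpace ℝ (Fin N) → ℝ≥0∞) :
    ∫⁻ x, f x = ENNReal.ofReal (r ^ N) * ∫⁻ x, f (r • x) := by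
  have := lintegral_map_equiv (μ := volume) f (Homeomorph.smulOfNeZero r hr.ne').toMeasurableEquiv
  have h2 : (Measure.map (Homeomorph.smulOfNeZero r hr.ne').toMeasurableEquiv
    (volume : Measure (EuclideanSpace ℝ (Fin N)))) = _ := Measure.map_addHaar_smul volume hr.ne'
  rw [h2, lintegral_smul_measure] at this
  simp only [finrank_euclideanSpace, Fintype.card_fin, smul_eq_mul] at this
  have h3 : (fun x => f (r • x)) = fun x => f ((Homeomorph.smulOfNeZero r hr.ne').toMeasurableEquiv x) := rfl
  rw [h3, ← this, ← mul_assoc, ← ENNReal.ofReal_mul (by positivity), abs_of_pos (by positivity),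
    Units.val_mk0, mul_inv_cancel₀ (by positivity), ENNReal.ofReal_one, one_mul]

lemma lint_homog {N : ℕ} {s : ℝ} (F : EuclideanSpace ℝ (Fin N) → EuclideanSpace ℝ (Fin N) → ℝ≥0∞)
    (hr : ∀ r : ℝ, 0 < r → ∀ x y, F (r • x) (r • y) = ENNReal.ofReal (r ^ (-((N:ℝ)+s))) * F x y)
    (hL : ∀ L : EuclideanSpace ℝ (Fin N) ≃ₗᵢ[ℝ] EuclideanSpace ℝ (Fin N), ∀ x y, F (L x) (L y) = F x y)
    (hm : ∀ x, Measurable (F x)) (e x : EuclideanSpace ℝ (Fin N)) (he : ‖e‖ = 1) (hx : x ≠ 0) :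
    ∫⁻ y, F x y = ENNReal.ofReal (‖x‖ ^ (-s)) * ∫⁻ y, F e y := by
  have hx' : 0 < ‖x‖ := norm_pos_iff.2 hx
  obtain ⟨L, hLe⟩ := exists_rot e (‖x‖⁻¹ • x) (by rw [norm_smul, he]; simp [hx'.ne'])
  have hx2 : x = ‖x‖ • L e := by rw [hLe, smul_smul, mul_inv_cancel₀ hx'.ne', one_smul]
  rw [lint_smul hx', ← lint_rot L]
  conv_lhs => rw [hx2]
  have hnn : ‖‖x‖ • L e‖ = ‖x‖ := by rw [← hx2]
  simp only [hnn, hr _ hx', hL]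
  rw [lintegral_const_mul _ (hm e), ← mul_assoc, ← ENNReal.ofReal_mul (by positivity)]
  congr 2
  rw [← Real.rpow_natCast, ← Real.rpow_add hx']
  ring_nf

noncomputable def Ker (N : ℕ) (s : ℝ) (x y : EuclideanSpace ℝ (Fin N)) : ℝ≥0∞ :=
  ENNReal.ofReal (dist x y ^ (-((N:ℝ)+s)))

open Classical in
noncomputable def FK (N : ℕ) (s t : ℝ) (x y : EuclideanSpace ℝ (Fin N)) : ℝ≥0∞ :=
  if t * ‖x‖ < ‖y‖ then Ker N s x y else 0

noncomputable def gag1 (N : ℕ) (s : ℝ) (f : EuclideanSpace ℝ (Fin N) → ℝ) : ℝ≥0∞ :=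
  ∫⁻ x, ∫⁻ y, ENNReal.ofReal |f x - f y| * Ker N s x y

noncomputable def DD (N : ℕ) (s t : ℝ) (f : EuclideanSpace ℝ (Fin N) → ℝ) : ℝ≥0∞ :=
  ∫⁻ x, ∫⁻ y, ENNReal.ofReal |f x - f y| * FK N s t x y

noncomputable def HH (N : ℕ) (s : ℝ) (f : EuclideanSpace ℝ (Fin N) → ℝ) : ℝ≥0∞ :=
  ∫⁻ x, ENNReal.ofReal (f x) * ENNReal.ofReal (‖x‖ ^ (-s))

lemma Ker_comm (N : ℕ) (s : ℝ) (x y : EuclideanSpace ℝ (Fin N)) : Ker N s x y = Ker N s y x := by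
  rw [Ker, Ker, dist_comm]

@[fun_prop]
lemma Ker_meas (N : ℕ) (s : ℝ) :
    Measurable (fun p : EuclideanSpace ℝ (Fin N) × EuclideanSpace ℝ (Fin N) => Ker N s p.1 p.2) := by
  unfold Ker; fun_prop

@[fun_prop]
lemma FK_meas (N : ℕ) (s t : ℝ) :
    Measurable (fun p : EuclideanSpace ℝ (Fin N) × EuclideanSpace ℝ (Fin N) => FK N s t p.1 p.2) := by
  unfold FK
  exact Measurable.ite (measurableSet_lt (by fun_prop) (by fun_prop)) (by fun_prop) measurable_const

lemma FK_meas_right (N : ℕ) (s t : ℝ) (x : EuclideanSpace ℝ (Fin N)) :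
    Measurable (fun y => FK N s t x y) :=
  Measurable.of_uncurry_left (f := (FK N s t)) (by simpa only [Function.uncurry_def] using FK_meas N s t)

lemma FK_meas_left (N : ℕ) (s t : ℝ) (x : EuclideanSpace ℝ (Fin N)) :
    Measurable (fun y => FK N s t y x) :=
  Measurable.of_uncurry_right (f := (FK N s t)) (by simpa only [Function.uncurry_def] using FK_meas N s t)

lemma Ker_meas_right (N : ℕ) (s : ℝ) (x : EuclideanSpace ℝ (Fin N)) :
    Measurable (fun y => Ker N s x y) :=
  Measurable.of_uncurry_left (f := (Ker N s)) (by simpa only [Function.uncurry_def] using Ker_meas N s)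

lemma Ker_smul (N : ℕ) (s r : ℝ) (hr : 0 < r) (x y : EuclideanSpace ℝ (Fin N)) :
    Ker N s (r • x) (r • y) = ENNReal.ofReal (r ^ (-((N:ℝ)+s))) * Ker N s x y := by
  rw [Ker, Ker, dist_smul₀, Real.norm_of_nonneg hr.le, Real.mul_rpow hr.le dist_nonneg,
    ENNReal.ofReal_mul (by positivity)]

lemma FK_smul (N : ℕ) (s t r : ℝ) (hr : 0 < r) (x y : EuclideanSpace ℝ (Fin N)) :
    FK N s t (r • x) (r • y) = ENNReal.ofReal (r ^ (-((N:ℝ)+s))) * FK N s t x y := by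
  have : t * ‖r • x‖ < ‖r • y‖ ↔ t * ‖x‖ < ‖y‖ := by
    rw [norm_smul, norm_smul, Real.norm_of_nonneg hr.le, mul_left_comm, mul_lt_mul_iff_right₀ hr]
  simp only [FK, this, Ker_smul N s r hr]
  split_ifs <;> simp

lemma FK_rot (N : ℕ) (s t : ℝ) (L : EuclideanSpace ℝ (Fin N) ≃ₗᵢ[ℝ] EuclideanSpace ℝ (Fin N))
    (x y : EuclideanSpace ℝ (Fin N)) : FK N s t (L x) (L y) = FK N s t x y := by
  simp [FK, Ker]

lemma D_swap (N : ℕ) (s t : ℝ) (f : EuclideanSpace ℝ (Fin N) → ℝ) (hf : Measurable f) :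
    DD N s t f = ∫⁻ x, ∫⁻ y, ENNReal.ofReal |f x - f y| * FK N s t y x := by
  rw [DD, lintegral_lintegral_swap]
  · simp only [abs_sub_comm]
  · refine Measurable.aemeasurable ?_
    simp only [Function.uncurry_def]
    fun_prop

lemma two_D (N : ℕ) (s t : ℝ) (f : EuclideanSpace ℝ (Fin N) → ℝ) (hf : Measurable f) :
    2 * DD N s t f = ∫⁻ x, ∫⁻ y, ENNReal.ofReal |f x - f y| * (FK N s t x y + FK N s t y x) := by
  rw [two_mul]
  conv_lhs => arg 2; rw [D_swap N s t f hf]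
  rw [DD, ← lintegral_add_left]
  · refine lintegral_congr fun x => ?_
    rw [← lintegral_add_left]
    · simp only [mul_add]
    · have := FK_meas_right N s t x
      fun_prop
  · refine Measurable.lintegral_prod_right' (f := fun p : EuclideanSpace ℝ (Fin N) × EuclideanSpace ℝ (Fin N) => ENNReal.ofReal |f p.1 - f p.2| * FK N s t p.1 p.2) ?_
    fun_prop

lemma gag_ge (N : ℕ) (s t : ℝ) (ht : 1 ≤ t) (f : EuclideanSpace ℝ (Fin N) → ℝ) (hf : Measurable f) :
    2 * DD N s t f ≤ gag1 N s f := by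
  rw [two_D _ _ _ _ hf, gag1]
  gcongr with x y
  unfold FK
  rw [Ker_comm N s y x]
  have hx := norm_nonneg x
  have hy := norm_nonneg y
  split_ifs with h1 h2 h2
  · nlinarith
  · simp
  · simp
  · simp

lemma gag_eq (N : ℕ) (s : ℝ) (f : EuclideanSpace ℝ (Fin N) → ℝ) (hf : Measurable f)
    (hr : ∀ x y, ‖x‖ = ‖y‖ → f x = f y) :
    gag1 N s f = 2 * DD N s 1 f := by
  rw [two_D _ _ _ _ hf, gag1]
  refine lintegral_congr fun x => lintegral_congr fun y => ?_
  unfold FK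
  rw [Ker_comm N s y x, one_mul, one_mul]
  rcases lt_trichotomy ‖x‖ ‖y‖ with h | h | h
  · simp [h, h.not_gt]
  · simp [hr x y h]
  · simp [h, h.not_gt]

noncomputable def tn (n : ℕ) : ℝ := 1 + 1 / ((n:ℝ) + 1)

lemma tn_gt (n : ℕ) : 1 < tn n := by unfold tn; linarith [show 0 < 1 / ((n:ℝ) + 1) by positivity]

lemma FK_mono (N : ℕ) (s : ℝ) {t t' : ℝ} (h : t ≤ t') (x y : EuclideanSpace ℝ (Fin N)) :
    FK N s t' x y ≤ FK N s t x y := by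
  unfold FK
  have : t * ‖x‖ ≤ t' * ‖x‖ := by gcongr
  split_ifs with h1 h2
  · rfl
  · linarith
  · simp
  · simp

lemma tn_anti : Antitone tn := by
  intro a b h
  unfold tn
  have : (a:ℝ) ≤ b := by exact_mod_cast h
  gcongr

lemma FK_sup (N : ℕ) (s : ℝ) (x y : EuclideanSpace ℝ (Fin N)) :
    FK N s 1 x y = ⨆ n, FK N s (tn n) x y := by
  apply le_antisymm
  · by_cases h : ‖x‖ < ‖y‖
    · have hl : Tendsto (fun n => tn n * ‖x‖) atTop (nhds ((1 + 0) * ‖x‖)) := by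
        unfold tn
        exact (tendsto_const_nhds.add tendsto_one_div_add_atTop_nhds_zero_nat).mul_const _
      obtain ⟨n, hn⟩ := (hl.eventually (gt_mem_nhds (by simpa using h))).exists
      refine le_trans ?_ (le_iSup _ n)
      simp [FK, hn, h]
    · simp [FK, h]
  · exact iSup_le fun n => FK_mono N s (tn_gt n).le x y

lemma D_sup (N : ℕ) (s : ℝ) (f : EuclideanSpace ℝ (Fin N) → ℝ) (hf : Measurable f) :
    DD N s 1 f = ⨆ n, DD N s (tn n) f := by
  simp only [DD, FK_sup N s, ENNReal.mul_iSup]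
  rw [← lintegral_iSup]
  · refine lintegral_congr fun x => ?_
    rw [lintegral_iSup]
    · intro n
      have := FK_meas_right N s (tn n) x
      fun_prop
    · intro m n h y
      dsimp only
      gcongr
      exact FK_mono N s (tn_anti h) x y
  · intro n
    refine Measurable.lintegral_prod_right' (f := fun p : EuclideanSpace ℝ (Fin N) × EuclideanSpace ℝ (Fin N) => ENNReal.ofReal |f p.1 - f p.2| * FK N s (tn n) p.1 p.2) ?_
    fun_prop
  · intro m n h x
    dsimp only
    gcongr
    exact FK_mono N s (tn_anti h) x _

lemma FK_le (N : ℕ) {s t : ℝ} (hs : 0 < s) (ht : 1 < t) (x y : EuclideanSpace ℝ (Fin N))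
    (h1 : ‖x‖ = 1 ∨ ‖y‖ = 1) :
    FK N s t x y ≤ ENNReal.ofReal (((t-1)/(t+1)) ^ (-((N:ℝ)+s))) *
      ENNReal.ofReal ((‖x‖ + ‖y‖) ^ (-((N:ℝ)+s))) := by
  unfold FK
  split_ifs with h
  · rw [← ENNReal.ofReal_mul (Real.rpow_nonneg (div_nonneg (by linarith) (by linarith)) _),
      ← Real.mul_rpow (div_nonneg (by linarith) (by linarith)) (by positivity), Ker]
    apply ENNReal.ofReal_le_ofReal
    have hpos : 0 < ‖x‖ + ‖y‖ := by
      have hx := norm_nonneg x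
      have hy := norm_nonneg y
      rcases h1 with h1 | h1 <;> linarith
    refine Real.rpow_le_rpow_of_nonpos (mul_pos (div_pos (by linarith) (by linarith)) hpos) ?_
      (by have : (0:ℝ) ≤ N := by positivity
          linarith)
    have h2 : ‖y‖ - ‖x‖ ≤ dist x y := by
      rw [dist_comm, dist_eq_norm]; exact norm_sub_norm_le y x
    refine le_trans ?_ h2
    rw [div_mul_eq_mul_div, div_le_iff₀ (by linarith)]
    nlinarith
  · simp

lemma bound_fin (N : ℕ) {s t : ℝ} (hs : 0 < s) :
    ∫⁻ y : EuclideanSpace ℝ (Fin N), ENNReal.ofReal (((t-1)/(t+1)) ^ (-((N:ℝ)+s))) *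
      ENNReal.ofReal ((1 + ‖y‖) ^ (-((N:ℝ)+s))) ≠ ∞ := by
  rw [lintegral_const_mul _ (by fun_prop)]
  refine ENNReal.mul_ne_top ENNReal.ofReal_ne_top (finite_integral_one_add_norm ?_).ne
  simp [hs]

lemma a_fin (N : ℕ) {s t : ℝ} (hs : 0 < s) (ht : 1 < t) (e : EuclideanSpace ℝ (Fin N)) (he : ‖e‖ = 1) :
    ∫⁻ y, FK N s t e y ≠ ∞ := by
  refine ne_top_of_le_ne_top (bound_fin N (t := t) hs) (lintegral_mono fun y => ?_)
  have := FK_le N hs ht e y (Or.inl he)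
  rwa [he] at this

lemma b_fin (N : ℕ) {s t : ℝ} (hs : 0 < s) (ht : 1 < t) (e : EuclideanSpace ℝ (Fin N)) (he : ‖e‖ = 1) :
    ∫⁻ y, FK N s t y e ≠ ∞ := by
  refine ne_top_of_le_ne_top (bound_fin N (t := t) hs) (lintegral_mono fun y => ?_)
  have := FK_le N hs ht y e (Or.inr he)
  rwa [he, add_comm ‖y‖ 1] at this

lemma ae_ne_zero (N : ℕ) (hN : 0 < N) : ∀ᵐ x : EuclideanSpace ℝ (Fin N), x ≠ 0 := by
  have : Nonempty (Fin N) := ⟨⟨0, hN⟩⟩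
  exact Measure.ae_ne volume 0

lemma P_eq (N : ℕ) (hN : 0 < N) {s t : ℝ} (e : EuclideanSpace ℝ (Fin N))
    (he : ‖e‖ = 1) (f : EuclideanSpace ℝ (Fin N) → ℝ) (hf : Measurable f) :
    ∫⁻ x, ∫⁻ y, ENNReal.ofReal (f x) * FK N s t x y = (∫⁻ y, FK N s t e y) * HH N s f := by
  rw [HH, ← lintegral_const_mul _ (by fun_prop)]
  refine lintegral_congr_ae ?_
  filter_upwards [ae_ne_zero N hN] with x hx
  rw [lintegral_const_mul _ (FK_meas_right N s t x),
    lint_homog (FK N s t) (FK_smul N s t) (FK_rot N s t) (FK_meas_right N s t) e x he hx]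
  ring

lemma Q_eq (N : ℕ) (hN : 0 < N) {s t : ℝ} (e : EuclideanSpace ℝ (Fin N))
    (he : ‖e‖ = 1) (f : EuclideanSpace ℝ (Fin N) → ℝ) (hf : Measurable f) :
    ∫⁻ x, ∫⁻ y, ENNReal.ofReal (f y) * FK N s t x y = (∫⁻ y, FK N s t y e) * HH N s f := by
  rw [lintegral_lintegral_swap, HH, ← lintegral_const_mul _ (by fun_prop)]
  · refine lintegral_congr_ae ?_
    filter_upwards [ae_ne_zero N hN] with x hx
    rw [lintegral_const_mul _ (FK_meas_left N s t x),
      lint_homog (fun x y => FK N s t y x) (fun r hr x y => FK_smul N s t r hr y x)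
        (fun L x y => FK_rot N s t L y x) (FK_meas_left N s t) e x he hx]
    ring
  · refine Measurable.aemeasurable ?_
    simp only [Function.uncurry_def]
    fun_prop

noncomputable def cst (N : ℕ) (s : ℝ) (e : EuclideanSpace ℝ (Fin N)) : ℝ≥0∞ :=
  2 * ⨆ n, ((∫⁻ y, FK N s (tn n) e y) - ∫⁻ y, FK N s (tn n) y e)

lemma DQ_add (N : ℕ) (s t : ℝ) (f : EuclideanSpace ℝ (Fin N) → ℝ) (hf : Measurable f) :
    DD N s t f + ∫⁻ x, ∫⁻ y, ENNReal.ofReal (f y) * FK N s t x y =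
    ∫⁻ x, ∫⁻ y, (ENNReal.ofReal |f x - f y| + ENNReal.ofReal (f y)) * FK N s t x y := by
  rw [DD, ← lintegral_add_left]
  · refine lintegral_congr fun x => ?_
    rw [← lintegral_add_left]
    · simp only [add_mul]
    · have := FK_meas_right N s t x
      fun_prop
  · refine Measurable.lintegral_prod_right' (f := fun p : EuclideanSpace ℝ (Fin N) × EuclideanSpace ℝ (Fin N) => ENNReal.ofReal |f p.1 - f p.2| * FK N s t p.1 p.2) ?_
    fun_prop

lemma lower (N : ℕ) (hN : 0 < N) {s : ℝ} (hs : 0 < s) (e : EuclideanSpace ℝ (Fin N))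
    (he : ‖e‖ = 1) (f : EuclideanSpace ℝ (Fin N) → ℝ) (hf : Measurable f) (hH : HH N s f ≠ ∞) :
    cst N s e * HH N s f ≤ gag1 N s f := by
  rw [cst, mul_assoc, ENNReal.iSup_mul, ENNReal.mul_iSup]
  refine iSup_le fun n => le_trans ?_ (gag_ge N s (tn n) (tn_gt n).le f hf)
  gcongr
  rw [ENNReal.sub_mul (fun _ _ => hH), tsub_le_iff_right, ← P_eq N hN e he f hf, ← Q_eq N hN e he f hf,
    DQ_add _ _ _ _ hf]
  gcongr with x y
  refine le_trans (ENNReal.ofReal_le_ofReal ?_) ENNReal.ofReal_add_le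
  linarith [le_abs_self (f x - f y)]

lemma radial_eq (N : ℕ) (hN : 0 < N) {s : ℝ} (hs : 0 < s) (e : EuclideanSpace ℝ (Fin N))
    (he : ‖e‖ = 1) (f : EuclideanSpace ℝ (Fin N) → ℝ) (hf : Measurable f) (hH : HH N s f ≠ ∞)
    (hdec : ∀ x y, ‖x‖ ≤ ‖y‖ → f y ≤ f x) (h0 : ∀ x, 0 ≤ f x) :
    gag1 N s f = cst N s e * HH N s f := by
  rw [gag_eq N s f hf (fun x y h => le_antisymm (hdec _ _ h.ge) (hdec _ _ h.le)), D_sup N s f hf,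
    cst, mul_assoc, ENNReal.iSup_mul]
  congr 2
  funext n
  rw [ENNReal.sub_mul (fun _ _ => hH), ← P_eq N hN e he f hf]
  have hfin : (∫⁻ y, FK N s (tn n) y e) * HH N s f ≠ ∞ :=
    ENNReal.mul_ne_top (b_fin N hs (tn_gt n) e he) hH
  refine ENNReal.eq_sub_of_add_eq hfin ?_
  rw [← Q_eq N hN e he f hf, DQ_add _ _ _ _ hf]
  refine lintegral_congr fun x => lintegral_congr fun y => ?_
  by_cases h : tn n * ‖x‖ < ‖y‖
  · have h1 : ‖x‖ ≤ ‖y‖ := by nlinarith [tn_gt n, norm_nonneg x]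
    have h2 := hdec x y h1
    rw [abs_of_nonneg (by linarith), ← ENNReal.ofReal_add (by linarith) (h0 y)]
    simp
  · simp [FK, h]

lemma lint_gam {q : ℝ} (hq : -1 < q) :
    ∫⁻ r in Ioi (0:ℝ), ENNReal.ofReal (r ^ q * Real.exp (-r ^ 2)) =
      ENNReal.ofReal (Real.Gamma ((q + 1) / 2) / 2) := by
  have h := integral_rpow_mul_exp_neg_rpow (p := 2) (q := q) (by norm_num) hq
  have hi := integrableOn_rpow_mul_exp_neg_rpow (p := 2) (s := q) hq (by norm_num)
  simp only [Real.rpow_two] at h hi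
  rw [← ofReal_integral_eq_lintegral_ofReal hi, h]
  · congr 1; ring
  · filter_upwards [ae_restrict_mem measurableSet_Ioi] with r hr
    have : (0:ℝ) < r := hr
    simp only [Pi.zero_apply]
    positivity

noncomputable def GG (N : ℕ) (x : EuclideanSpace ℝ (Fin N)) : ℝ := Real.exp (-‖x‖ ^ 2)

lemma GG_meas (N : ℕ) : Measurable (GG N) := by unfold GG; fun_prop

lemma HH_GG (N : ℕ) (hN : 0 < N) {s : ℝ} (hs1 : s < 1) (S : ℝ≥0∞)
    (hS : ∀ f : ℝ → ℝ≥0∞, Measurable f →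
      ∫⁻ x : EuclideanSpace ℝ (Fin N), f ‖x‖ = S * ∫⁻ r in Ioi (0:ℝ), ENNReal.ofReal (r ^ (N-1)) * f r) :
    HH N s (GG N) = S * ENNReal.ofReal (Real.Gamma (((N:ℝ) - s) / 2) / 2) := by
  have h1 : (1:ℝ) ≤ N := by exact_mod_cast hN
  unfold HH GG
  rw [hS (fun r => ENNReal.ofReal (Real.exp (-r ^ 2)) * ENNReal.ofReal (r ^ (-s))) (by fun_prop)]
  rw [show (((N:ℝ) - s) / 2) = ((((N:ℝ) - 1 - s) + 1) / 2) by ring, ← lint_gam (by linarith)]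
  congr 1
  refine setLIntegral_congr_fun measurableSet_Ioi fun r hr => ?_
  have hr : (0:ℝ) < r := hr
  rw [← ENNReal.ofReal_mul (by positivity), ← ENNReal.ofReal_mul (by positivity)]
  congr 1
  rw [← Real.rpow_natCast, Nat.cast_sub hN, mul_left_comm, mul_comm, ← Real.rpow_add hr]
  ring_nf

noncomputable def gg (t : ℝ) : ℝ := Real.exp (-t ^ 2)

lemma gg_int : Integrable gg := by
  have := integrable_exp_neg_mul_sq (b := 1) one_pos
  unfold gg
  simpa using this

lemma gg_cont : Continuous gg := by unfold gg; fun_prop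

lemma gg_integral : ∫ t, gg t = √Real.pi := by
  have := integral_gaussian 1
  unfold gg
  simpa using this

lemma j_eq {r : ℝ} (hr : 0 ≤ r) : ∫ t, |gg t - gg (t + r)| = 4 * ∫ t in (0:ℝ)..(r/2), gg t := by
  set h := r / 2 with hh
  have hh0 : 0 ≤ h := by positivity
  have e1 : ∫ t, |gg t - gg (t + r)| = ∫ t, |gg (t - h) - gg (t + h)| := by
    rw [← integral_sub_right_eq_self (fun t => |gg t - gg (t + r)|) h]
    congr 1; funext t; rw [show t - h + r = t + h by rw [hh]; ring]
  have e2 : ∀ t, |gg (t - h) - gg (t + h)| = (fun t => gg (t - h) - gg (t + h)) |t| := by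
    intro t
    have key : ∀ t, 0 ≤ t → |gg (t - h) - gg (t + h)| = gg (t - h) - gg (t + h) := by
      intro t ht
      apply abs_of_nonneg
      unfold gg
      rw [sub_nonneg]
      apply Real.exp_le_exp.2
      nlinarith
    rcases le_total 0 t with ht | ht
    · rw [abs_of_nonneg ht]; exact key t ht
    · rw [abs_of_nonpos ht]
      have := key (-t) (by linarith)
      dsimp only
      rw [← this, abs_sub_comm]
      have ev : ∀ x, gg (-x) = gg x := by intro x; unfold gg; simp
      rw [← ev (-t - h), ← ev (-t + h)]
      congr 3 <;> ring
  have i1 : Integrable (fun t => gg (t - h)) := gg_int.comp_sub_right h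
  have i2 : Integrable (fun t => gg (t + h)) := gg_int.comp_add_right h
  rw [e1]
  simp_rw [e2]
  rw [integral_comp_abs (f := fun t => gg (t - h) - gg (t + h)),
    integral_sub i1.integrableOn i2.integrableOn]
  have s1 : ∫ t in Ioi 0, gg (t - h) = ∫ t in Ioi (-h), gg t := by
    have := (measurePreserving_add_right volume (-h)).setIntegral_preimage_emb (measurableEmbedding_addRight (-h)) gg (Ioi (-h))
    simpa [sub_eq_add_neg] using this
  have s2 : ∫ t in Ioi 0, gg (t + h) = ∫ t in Ioi h, gg t := by
    have := (measurePreserving_add_right volume h).setIntegral_preimage_emb (measurableEmbedding_addRight h) gg (Ioi h)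
    simpa using this
  rw [s1, s2, intervalIntegral.integral_Ioi_sub_Ioi' gg_int.integrableOn gg_int.integrableOn]
  rw [← intervalIntegral.integral_add_adjacent_intervals (a := -h) (b := 0) (c := h)
    (gg_cont.intervalIntegrable _ _) (gg_cont.intervalIntegrable _ _)]
  have : ∫ t in (-h)..0, gg t = ∫ t in 0..h, gg t := by
    have := intervalIntegral.integral_comp_neg (a := 0) (b := h) gg
    simp only [neg_zero] at this
    rw [← this]
    congr 1; funext x; unfold gg; simp
  rw [this]; ring

lemma j_radial {s : ℝ} (hs : 0 < s) (hs1 : s < 1) :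
    ∫⁻ r in Ioi (0:ℝ), ENNReal.ofReal (r ^ (-1 - s)) * ENNReal.ofReal (∫ t, |gg t - gg (t + r)|) =
      ENNReal.ofReal (4 * (2 ^ (-s) / s * (Real.Gamma ((1 - s) / 2) / 2))) := by
  have st1 : ∀ r ∈ Ioi (0:ℝ), ENNReal.ofReal (r ^ (-1 - s)) * ENNReal.ofReal (∫ t, |gg t - gg (t + r)|) =
      4 * ∫⁻ t in Ioi (0:ℝ), ENNReal.ofReal (gg t) * (Ioi (2 * t)).indicator (fun r => ENNReal.ofReal (r ^ (-1 - s))) r := by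
    intro r hr
    have hr : (0:ℝ) < r := hr
    rw [j_eq hr.le, ENNReal.ofReal_mul (by norm_num), mul_left_comm,
      intervalIntegral.integral_of_le (by positivity),
      ofReal_integral_eq_lintegral_ofReal gg_int.integrableOn (ae_of_all _ fun t => (Real.exp_pos _).le),
      ← lintegral_const_mul _ (by unfold gg; fun_prop)]
    congr 1
    · norm_num
    rw [← restrict_Ioo_eq_restrict_Ioc, ← lintegral_indicator measurableSet_Ioo,
      ← lintegral_indicator measurableSet_Ioi]
    refine lintegral_congr fun t => ?_
    simp only [indicator, mem_Ioo, mem_Ioi]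
    by_cases h1 : 0 < t
    · by_cases h2 : t < r / 2
      · have h3 : 2 * t < r := by linarith
        rw [if_pos ⟨h1, h2⟩, if_pos h1, if_pos h3, mul_comm]
      · have h3 : ¬ 2 * t < r := by linarith
        simp [h1, h2, h3]
    · simp [h1]
  rw [setLIntegral_congr_fun measurableSet_Ioi st1]
  have hind : Measurable (fun p : ℝ × ℝ => (Ioi (2 * p.2)).indicator (fun r => ENNReal.ofReal (r ^ (-1 - s))) p.1) := by
    have : (fun p : ℝ × ℝ => (Ioi (2 * p.2)).indicator (fun r => ENNReal.ofReal (r ^ (-1 - s))) p.1) =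
        {p : ℝ × ℝ | 2 * p.2 < p.1}.indicator (fun p => ENNReal.ofReal (p.1 ^ (-1 - s))) := by
      funext p; simp [indicator]
    rw [this]
    exact Measurable.indicator (by fun_prop) (measurableSet_lt (by fun_prop) (by fun_prop))
  have hgm : Measurable gg := gg_cont.measurable
  rw [lintegral_const_mul' _ _ (by norm_num), lintegral_lintegral_swap (by
    refine Measurable.aemeasurable ?_
    simp only [Function.uncurry_def]
    exact (by fun_prop : Measurable fun p : ℝ × ℝ => ENNReal.ofReal (gg p.2)).mul hind)]
  have st2 : ∀ t ∈ Ioi (0:ℝ), ∫⁻ r in Ioi (0:ℝ), ENNReal.ofReal (gg t) * (Ioi (2 * t)).indicator (fun r => ENNReal.ofReal (r ^ (-1 - s))) r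
      = ENNReal.ofReal (2 ^ (-s) / s) * ENNReal.ofReal (t ^ (-s) * Real.exp (-t ^ 2)) := by
    intro t ht
    have ht : (0:ℝ) < t := ht
    rw [lintegral_const_mul' _ _ ENNReal.ofReal_ne_top, lintegral_indicator measurableSet_Ioi,
      Measure.restrict_restrict measurableSet_Ioi]
    have : Ioi (2 * t) ∩ Ioi 0 = Ioi (2 * t) := by
      rw [inter_eq_left]; exact Ioi_subset_Ioi (by positivity)
    rw [this, ← ofReal_integral_eq_lintegral_ofReal (integrableOn_Ioi_rpow_of_lt (by linarith) (by positivity)),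
      integral_Ioi_rpow_of_lt (by linarith) (by positivity), ← ENNReal.ofReal_mul (by unfold gg; positivity),
      ← ENNReal.ofReal_mul (by positivity)]
    · congr 1
      rw [show -1 - s + 1 = -s by ring, Real.mul_rpow (by norm_num) ht.le]
      unfold gg
      field_simp
    · filter_upwards [ae_restrict_mem measurableSet_Ioi] with r hr
      have : (0:ℝ) < r := lt_trans (by positivity) hr
      simp only [Pi.zero_apply]
      positivity
  rw [setLIntegral_congr_fun measurableSet_Ioi st2, lintegral_const_mul' _ _ ENNReal.ofReal_ne_top,
    lint_gam (by linarith), ENNReal.ofReal_mul (by norm_num), ENNReal.ofReal_mul (by positivity),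
    show -s + 1 = 1 - s by ring]
  norm_num

lemma J_eq (N : ℕ) (hN : 0 < N) (z : EuclideanSpace ℝ (Fin N)) :
    ∫⁻ x, ENNReal.ofReal |GG N x - GG N (x + z)| =
      ENNReal.ofReal (√Real.pi ^ (N - 1)) * ENNReal.ofReal (∫ t, |gg t - gg (t + ‖z‖)|) := by
  set i0 : Fin N := ⟨0, hN⟩
  obtain ⟨L, hL⟩ := exists_rot (EuclideanSpace.single i0 ‖z‖) z (by simp)
  rw [← lint_rot L]
  have hG : ∀ x, GG N (L x) = GG N x := by intro x; simp [GG]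
  have h1 : ∀ x, |GG N (L x) - GG N (L x + z)| =
      ∏ i, (fun (i : Fin N) (t : ℝ) => if i = i0 then |gg t - gg (t + ‖z‖)| else gg t) i (x i) := by
    intro x
    have hz : L x + z = L (x + EuclideanSpace.single i0 ‖z‖) := by rw [map_add, hL]
    rw [hz, hG, hG]
    have hp : ∀ y, GG N y = gg (y i0) * ∏ i ∈ Finset.univ.erase i0, gg (y i) := by
      intro y
      rw [Finset.mul_prod_erase Finset.univ (fun i => gg (y i)) (Finset.mem_univ i0), GG,
        EuclideanSpace.real_norm_sq_eq]
      simp only [gg, ← Real.exp_sum, Finset.sum_neg_distrib]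
    rw [hp, hp, ← Finset.mul_prod_erase _ _ (Finset.mem_univ i0)]
    have e1 : ∏ i ∈ Finset.univ.erase i0, gg ((x + EuclideanSpace.single i0 ‖z‖) i) =
        ∏ i ∈ Finset.univ.erase i0, gg (x i) := by
      refine Finset.prod_congr rfl fun i hi => ?_
      simp [(Finset.mem_erase.1 hi).1]
    have e2 : ∏ i ∈ Finset.univ.erase i0, (fun (i : Fin N) (t : ℝ) => if i = i0 then |gg t - gg (t + ‖z‖)| else gg t) i (x i) =
        ∏ i ∈ Finset.univ.erase i0, gg (x i) := by
      refine Finset.prod_congr rfl fun i hi => ?_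
      simp [(Finset.mem_erase.1 hi).1]
    rw [e1, e2, ← sub_mul, abs_mul, abs_of_nonneg (a := ∏ i ∈ Finset.univ.erase i0, gg (x i))
      (Finset.prod_nonneg fun i _ => (Real.exp_pos _).le)]
    simp
  simp only [h1]
  have hi : Integrable (fun t => |gg t - gg (t + ‖z‖)|) :=
    (gg_int.sub (gg_int.comp_add_right _)).abs
  set F : Fin N → ℝ → ℝ := fun (i : Fin N) (t : ℝ) => if i = i0 then |gg t - gg (t + ‖z‖)| else gg t with hF
  have hFi : ∀ i, Integrable (F i) := by
    intro i
    by_cases h : i = i0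
    · simpa [hF, h] using hi
    · simpa [hF, h] using gg_int
  have hF0 : ∀ i t, 0 ≤ F i t := by
    intro i t
    simp only [hF]
    split_ifs
    · exact abs_nonneg _
    · exact (Real.exp_pos _).le
  have hvp := (EuclideanSpace.volume_preserving_symm_measurableEquiv_toLp (Fin N)).symm
  have hch : ∫⁻ x : EuclideanSpace ℝ (Fin N), ENNReal.ofReal (∏ i, F i (x i)) =
      ∫⁻ x : Fin N → ℝ, ENNReal.ofReal (∏ i, F i (x i)) := by
    rw [← hvp.lintegral_comp_emb (MeasurableEquiv.measurableEmbedding _)]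
    rfl
  have hFp : Integrable (fun x : Fin N → ℝ => ∏ i, F i (x i)) := Integrable.fintype_prod hFi
  rw [hch, ← ofReal_integral_eq_lintegral_ofReal hFp
    (ae_of_all _ fun x => Finset.prod_nonneg fun i _ => hF0 i _),
    integral_fintype_prod_volume_eq_prod, ← Finset.prod_erase_mul _ _ (Finset.mem_univ i0),
    ENNReal.ofReal_mul (Finset.prod_nonneg fun i _ => integral_nonneg (hF0 i))]
  congr 2
  · rw [Finset.prod_congr rfl (g := fun _ => √Real.pi)]
    · simp
    · intro i hi
      simp only [hF, (Finset.mem_erase.1 hi).1, if_false, gg_integral]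

lemma gag_GG (N : ℕ) (hN : 0 < N) {s : ℝ} (hs : 0 < s) (hs1 : s < 1) (S : ℝ≥0∞)
    (hS : ∀ f : ℝ → ℝ≥0∞, Measurable f →
      ∫⁻ x : EuclideanSpace ℝ (Fin N), f ‖x‖ = S * ∫⁻ r in Ioi (0:ℝ), ENNReal.ofReal (r ^ (N-1)) * f r) :
    gag1 N s (GG N) = S * ENNReal.ofReal (√Real.pi ^ (N - 1) *
      (4 * (2 ^ (-s) / s * (Real.Gamma ((1 - s) / 2) / 2)))) := by
  have hGm := GG_meas N
  have hjm : Measurable (fun r : ℝ => ∫ t, |gg t - gg (t + r)|) := by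
    have : StronglyMeasurable (fun p : ℝ × ℝ => |gg p.2 - gg (p.2 + p.1)|) := by
      refine Continuous.stronglyMeasurable ?_
      have := gg_cont
      fun_prop
    exact this.integral_prod_right'.measurable
  have h1 : gag1 N s (GG N) = ∫⁻ z : EuclideanSpace ℝ (Fin N), ENNReal.ofReal (‖z‖ ^ (-((N:ℝ)+s))) *
      ∫⁻ x, ENNReal.ofReal |GG N x - GG N (x + z)| := by
    unfold gag1
    have : ∀ x, ∫⁻ y, ENNReal.ofReal |GG N x - GG N y| * Ker N s x y =
        ∫⁻ z, ENNReal.ofReal |GG N x - GG N (x + z)| * ENNReal.ofReal (‖z‖ ^ (-((N:ℝ)+s))) := by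
      intro x
      rw [← lintegral_add_left_eq_self _ x]
      simp [Ker]
    simp only [this]
    rw [lintegral_lintegral_swap]
    · refine lintegral_congr fun z => ?_
      rw [lintegral_mul_const _ (by fun_prop), mul_comm]
    · refine Measurable.aemeasurable ?_
      simp only [Function.uncurry_def]
      fun_prop
  rw [h1]
  simp only [J_eq N hN]
  rw [hS (fun r => ENNReal.ofReal (r ^ (-((N:ℝ)+s))) * (ENNReal.ofReal (√Real.pi ^ (N - 1)) *
    ENNReal.ofReal (∫ t, |gg t - gg (t + r)|))) (by fun_prop)]
  congr 1
  rw [ENNReal.ofReal_mul (by positivity), ← j_radial hs hs1, ← lintegral_const_mul' _ _ ENNReal.ofReal_ne_top]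
  refine setLIntegral_congr_fun measurableSet_Ioi fun r hr => ?_
  have hr : (0:ℝ) < r := hr
  rw [← mul_assoc, ← ENNReal.ofReal_mul (by positivity), ← Real.rpow_natCast, Nat.cast_sub hN,
    ← Real.rpow_add hr, show ((N:ℝ) - ((1:ℕ):ℝ)) + -((N:ℝ)+s) = -1 - s by push_cast; ring]
  ring

noncomputable def CC (N : ℕ) (s : ℝ) : ℝ := 4 / s * (Real.pi ^ ((N : ℝ) / 2) * Real.Gamma (1 - s) /
        (Real.Gamma (((N : ℝ) - s) / 2) * Real.Gamma (1 - s / 2)))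

lemma cst_eq (N : ℕ) (hN : 0 < N) {s : ℝ} (hs : 0 < s) (hs1 : s < 1)
    (e : EuclideanSpace ℝ (Fin N)) (he : ‖e‖ = 1) :
    HH N s (GG N) ≠ ∞ ∧ cst N s e = ENNReal.ofReal (CC N s) := by
  obtain ⟨S, hS0, hST, hS⟩ := lint_polar N hN
  have hH := HH_GG N hN hs1 S hS
  have hg := gag_GG N hN hs hs1 S hS
  have h1 : (1:ℝ) ≤ N := by exact_mod_cast hN
  have hfin : HH N s (GG N) ≠ ∞ := by rw [hH]; exact ENNReal.mul_ne_top hST ENNReal.ofReal_ne_top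
  refine ⟨hfin, ?_⟩
  have hGp : 0 < Real.Gamma (((N:ℝ) - s) / 2) := Real.Gamma_pos_of_pos (by linarith)
  have hr := radial_eq N hN hs e he (GG N) (GG_meas N) hfin (by
    intro x y hxy
    unfold GG
    apply Real.exp_le_exp.2
    have := norm_nonneg x
    gcongr) (fun x => (Real.exp_pos _).le)
  have hH0 : HH N s (GG N) ≠ 0 := by
    rw [hH]
    refine mul_ne_zero hS0 ?_
    rw [ne_eq, ENNReal.ofReal_eq_zero]
    linarith
  refine (ENNReal.mul_left_inj hH0 hfin).1 ?_
  rw [← hr, hg, hH, mul_left_comm (ENNReal.ofReal (CC N s)) S]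
  congr 1
  have hd := Real.Gamma_mul_Gamma_add_half ((1 - s) / 2)
  rw [show (1 - s) / 2 + 1 / 2 = 1 - s / 2 by ring, show 2 * ((1 - s)/2) = 1 - s by ring,
    show 1 - (1 - s) = s by ring] at hd
  have hG2 : 0 < Real.Gamma (1 - s / 2) := Real.Gamma_pos_of_pos (by linarith)
  rw [← ENNReal.ofReal_mul' (by positivity)]
  congr 1
  unfold CC
  have hpi : Real.pi ^ ((N:ℝ)/2) = √Real.pi ^ (N - 1) * √Real.pi := by
    rw [← pow_succ, Nat.sub_add_cancel hN, Real.sqrt_eq_rpow, ← Real.rpow_natCast, ← Real.rpow_mul Real.pi_pos.le]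
    ring_nf
  have h2 : (2:ℝ) ^ (-s) * 2 ^ s = 1 := by
    rw [← Real.rpow_add (by norm_num)]; simp
  rw [hpi]
  have h3 : Real.Gamma ((1 - s) / 2) = Real.Gamma (1 - s) * 2 ^ s * √Real.pi / Real.Gamma (1 - s / 2) := by
    rw [eq_div_iff hG2.ne', hd]
  rw [h3]
  have hp2 : (0:ℝ) < 2 ^ s := by positivity
  have h4 : (2:ℝ) ^ (-s) = 1 / 2 ^ s := by rw [eq_div_iff hp2.ne', h2]
  rw [h4]
  field_simp

lemma gagliardo_eq (N : ℕ) (s : ℝ) (u : EuclideanSpace ℝ (Fin N) → ℝ) :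
    gagliardo N s 1 Set.univ u = gag1 N s u := by
  unfold gagliardo gag1 Ker
  simp only [Measure.restrict_univ, Real.rpow_one, mul_one]
  refine lintegral_congr fun x => lintegral_congr fun y => ?_
  rw [← ENNReal.ofReal_mul (abs_nonneg _), Real.rpow_neg dist_nonneg, div_eq_mul_inv]

lemma int_eq (N : ℕ) (s : ℝ) (u : EuclideanSpace ℝ (Fin N) → ℝ) (hu : Measurable u) :
    ∫ x, |u x| / ‖x‖ ^ s = (HH N s (fun x => |u x|)).toReal := by
  rw [integral_eq_lintegral_of_nonneg_ae (ae_of_all _ fun x => by positivity)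
    (by apply Measurable.aestronglyMeasurable; fun_prop), HH]
  congr 1
  refine lintegral_congr fun x => ?_
  rw [← ENNReal.ofReal_mul (abs_nonneg _), Real.rpow_neg (norm_nonneg _), div_eq_mul_inv]

lemma int_eq' (N : ℕ) (hN : 0 < N) (s : ℝ) (u : EuclideanSpace ℝ (Fin N) → ℝ) :
    ∫ x in ({(0 : EuclideanSpace ℝ (Fin N))}ᶜ), |u x| ^ (1:ℝ) / Metric.infDist x
      (frontier ({(0 : EuclideanSpace ℝ (Fin N))}ᶜ)) ^ (s * 1) = ∫ x, |u x| / ‖x‖ ^ s := by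
  have : Nonempty (Fin N) := ⟨⟨0, hN⟩⟩
  have hf : frontier ({(0 : EuclideanSpace ℝ (Fin N))}ᶜ) = {0} := by
    rw [frontier_compl, isClosed_singleton.frontier_eq, interior_singleton, sdiff_empty]
  simp [hf, restrict_compl_singleton, Metric.infDist_singleton]

lemma gag_abs (N : ℕ) (s : ℝ) (u : EuclideanSpace ℝ (Fin N) → ℝ) :
    gag1 N s (fun x => |u x|) ≤ gag1 N s u := by
  unfold gag1
  refine lintegral_mono fun x => lintegral_mono fun y => ?_
  exact mul_le_mul' (ENNReal.ofReal_le_ofReal (abs_abs_sub_abs_le (u x) (u y))) le_rfl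

lemma main_lower (N : ℕ) (hN : 0 < N) {s : ℝ} (hs : 0 < s) (hs1 : s < 1)
    (u : EuclideanSpace ℝ (Fin N) → ℝ) (hu : Measurable u) (hH : HH N s (fun x => |u x|) ≠ ∞) :
    ENNReal.ofReal (CC N s) * HH N s (fun x => |u x|) ≤ gag1 N s u := by
  set e : EuclideanSpace ℝ (Fin N) := EuclideanSpace.single ⟨0, hN⟩ 1
  have he : ‖e‖ = 1 := by simp [e]
  rw [← (cst_eq N hN hs hs1 e he).2]
  exact (lower N hN hs e he _ (by fun_prop) hH).trans (gag_abs N s u)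

noncomputable def phi (N : ℕ) (x : EuclideanSpace ℝ (Fin N)) : ℝ := Real.smoothTransition (2 - ‖x‖ ^ 2)

lemma phi_smooth (N : ℕ) : ContDiff ℝ (⊤ : ℕ∞) (phi N) := by
  unfold phi
  exact Real.smoothTransition.contDiff.comp (contDiff_const.sub (contDiff_norm_sq ℝ))

lemma phi_dec (N : ℕ) (x y : EuclideanSpace ℝ (Fin N)) (h : ‖x‖ ≤ ‖y‖) : phi N y ≤ phi N x := by
  unfold phi
  apply Real.smoothTransition.monotone
  have := norm_nonneg x
  gcongr

lemma phi_nonneg (N : ℕ) (x : EuclideanSpace ℝ (Fin N)) : 0 ≤ phi N x := Real.smoothTransition.nonneg _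

lemma phi_one (N : ℕ) (x : EuclideanSpace ℝ (Fin N)) (h : ‖x‖ ≤ 1) : phi N x = 1 := by
  apply Real.smoothTransition.one_of_one_le
  nlinarith [norm_nonneg x]

lemma phi_zero (N : ℕ) (x : EuclideanSpace ℝ (Fin N)) (h : 2 ≤ ‖x‖) : phi N x = 0 := by
  apply Real.smoothTransition.zero_of_nonpos
  nlinarith [norm_nonneg x]

lemma phi_le_one (N : ℕ) (x : EuclideanSpace ℝ (Fin N)) : phi N x ≤ 1 :=
  Real.smoothTransition.le_one _

lemma HH_phi_fin (N : ℕ) {s : ℝ} (hG : HH N s (GG N) ≠ ∞) : HH N s (phi N) ≠ ∞ := by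
  have : HH N s (phi N) ≤ ENNReal.ofReal (Real.exp 4) * HH N s (GG N) := by
    unfold HH
    rw [← lintegral_const_mul' _ _ ENNReal.ofReal_ne_top]
    refine lintegral_mono fun x => ?_
    rw [← mul_assoc, ← ENNReal.ofReal_mul (Real.exp_pos _).le]
    gcongr
    rcases le_total 2 ‖x‖ with h | h
    · rw [phi_zero N x h]; unfold GG; positivity
    · refine (phi_le_one N x).trans ?_
      unfold GG
      rw [← Real.exp_add]
      apply Real.one_le_exp
      nlinarith [norm_nonneg x]
  exact ne_top_of_le_ne_top (ENNReal.mul_ne_top ENNReal.ofReal_ne_top hG) this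

lemma HH_phi_pos (N : ℕ) (hN : 0 < N) {s : ℝ} (hs : 0 < s) : HH N s (phi N) ≠ 0 := by
  have h1 : volume (ball (0 : EuclideanSpace ℝ (Fin N)) 1) ≤ HH N s (phi N) := by
    rw [← setLIntegral_one]
    refine le_trans ?_ (setLIntegral_le_lintegral (ball 0 1) _)
    refine lintegral_mono_ae ?_
    filter_upwards [ae_restrict_of_ae (ae_ne_zero N hN), ae_restrict_mem measurableSet_ball] with x hx hb
    have hb : ‖x‖ < 1 := by simpa using hb
    rw [phi_one N x hb.le, ENNReal.ofReal_one, one_mul, ENNReal.one_le_ofReal]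
    exact Real.one_le_rpow_of_pos_of_le_one_of_nonpos (norm_pos_iff.2 hx) hb.le (by linarith)
  exact ne_of_gt (lt_of_lt_of_le (measure_ball_pos _ _ one_pos) h1)

lemma HH_scale (N : ℕ) {s ε : ℝ} (hε : 0 < ε) (f : EuclideanSpace ℝ (Fin N) → ℝ) :
    HH N s (fun x => f (ε⁻¹ • x)) = ENNReal.ofReal (ε ^ ((N:ℝ) - s)) * HH N s f := by
  unfold HH
  rw [lint_smul hε, ← lintegral_const_mul' _ _ ENNReal.ofReal_ne_top,
    ← lintegral_const_mul' _ _ ENNReal.ofReal_ne_top]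
  refine lintegral_congr fun x => ?_
  dsimp only
  rw [smul_smul, inv_mul_cancel₀ hε.ne', one_smul, norm_smul, Real.norm_of_nonneg hε.le,
    Real.mul_rpow hε.le (norm_nonneg _), ENNReal.ofReal_mul (by positivity), sub_eq_add_neg,
    Real.rpow_add hε, ENNReal.ofReal_mul (by positivity), Real.rpow_natCast]
  ring

lemma upper (N : ℕ) (hN : 0 < N) {s : ℝ} (hs : 0 < s) (hs1 : s < 1) (q : ℝ) (hq : 0 < q) (hq1 : q < 1) :
    hardyConst N s 1 ({(0 : EuclideanSpace ℝ (Fin N))}ᶜ) ≤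
      ENNReal.ofReal (CC N s) * ENNReal.ofReal ((1 + q) / (1 - q)) := by
  set e : EuclideanSpace ℝ (Fin N) := EuclideanSpace.single ⟨0, hN⟩ 1
  have he : ‖e‖ = 1 := by simp [e]
  obtain ⟨hGf, hC⟩ := cst_eq N hN hs hs1 e he
  have hHf := HH_phi_fin N hGf
  have hH0 := HH_phi_pos N hN hs
  have h1N : (1:ℝ) ≤ N := by exact_mod_cast hN
  have hNs : 0 < (N:ℝ) - s := by linarith
  set ε : ℝ := q ^ (((N:ℝ) - s)⁻¹) with hεd
  have hε : 0 < ε := by positivity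
  have hεq : ε ^ ((N:ℝ) - s) = q := by
    rw [hεd, ← Real.rpow_mul hq.le, inv_mul_cancel₀ hNs.ne', Real.rpow_one]
  have hε1 : ε < 1 := Real.rpow_lt_one hq.le hq1 (by positivity)
  have hiε : 1 ≤ ε⁻¹ := (one_le_inv₀ hε).2 hε1.le
  have hpm : Measurable (phi N) := (phi_smooth N).continuous.measurable
  set psi : EuclideanSpace ℝ (Fin N) → ℝ := fun x => phi N (ε⁻¹ • x) with hpsi
  have hpsm : Measurable psi := by rw [hpsi]; fun_prop
  have hHpsi : HH N s psi = ENNReal.ofReal q * HH N s (phi N) := by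
    rw [hpsi, HH_scale N hε, hεq]
  have hnε : ∀ x : EuclideanSpace ℝ (Fin N), ‖ε⁻¹ • x‖ = ε⁻¹ * ‖x‖ := by
    intro x; rw [norm_smul, Real.norm_of_nonneg (by positivity)]
  have hg1 := radial_eq N hN hs e he (phi N) hpm hHf (phi_dec N) (phi_nonneg N)
  have hg2 := radial_eq N hN hs e he psi hpsm
    (by rw [hHpsi]; exact ENNReal.mul_ne_top ENNReal.ofReal_ne_top hHf)
    (fun x y h => phi_dec N _ _ (by rw [hnε, hnε]; gcongr)) (fun x => phi_nonneg N _)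
  rw [hC] at hg1 hg2
  have hle : ∀ x, psi x ≤ phi N x := fun x => phi_dec N _ _ (by
    rw [hnε]; nlinarith [norm_nonneg x])
  set h := (HH N s (phi N)).toReal with hh
  have hhp : 0 < h := ENNReal.toReal_pos hH0 hHf
  have hhE : HH N s (phi N) = ENNReal.ofReal h := (ENNReal.ofReal_toReal hHf).symm
  have hsum : HH N s (fun x => phi N x - psi x) + HH N s psi = HH N s (phi N) := by
    unfold HH
    rw [← lintegral_add_right _ (by fun_prop)]
    refine lintegral_congr fun x => ?_
    have hps0 : 0 ≤ psi x := phi_nonneg N _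
    rw [← add_mul, ← ENNReal.ofReal_add (by linarith [hle x]) hps0, sub_add_cancel]
  have hHu : HH N s (fun x => phi N x - psi x) = ENNReal.ofReal ((1 - q) * h) := by
    have hf : HH N s psi ≠ ∞ := by rw [hHpsi]; exact ENNReal.mul_ne_top ENNReal.ofReal_ne_top hHf
    rw [ENNReal.eq_sub_of_add_eq hf hsum, hHpsi, hhE, ← ENNReal.ofReal_mul hq.le,
      ← ENNReal.ofReal_sub _ (by positivity)]
    congr 1; ring
  have hgu : gag1 N s (fun x => phi N x - psi x) ≤ gag1 N s (phi N) + gag1 N s psi := by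
    unfold gag1
    rw [← lintegral_add_left]
    · refine lintegral_mono fun x => ?_
      dsimp only
      have hk := Ker_meas_right N s x
      rw [← lintegral_add_left (by fun_prop)]
      refine lintegral_mono fun y => ?_
      rw [← add_mul, ← ENNReal.ofReal_add (abs_nonneg _) (abs_nonneg _)]
      gcongr
      rw [show phi N x - psi x - (phi N y - psi y) = (phi N x - phi N y) - (psi x - psi y) by ring]
      exact abs_sub _ _
    · refine Measurable.lintegral_prod_right' (f := fun p : EuclideanSpace ℝ (Fin N) × EuclideanSpace ℝ (Fin N) => ENNReal.ofReal |phi N p.1 - phi N p.2| * Ker N s p.1 p.2) ?_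
      fun_prop
  set k : ℝ := ((1 - q) * h)⁻¹ with hk
  have hq' : 0 < 1 - q := by linarith
  have hkp : 0 < k := by positivity
  set v : EuclideanSpace ℝ (Fin N) → ℝ := fun x => k * (phi N x - psi x) with hv
  have hvs : ContDiff ℝ (⊤ : ℕ∞) v := by
    have := phi_smooth N
    have h2 : ContDiff ℝ (⊤ : ℕ∞) psi := this.comp (contDiff_const_smul _)
    exact contDiff_const.mul (this.sub h2)
  have hv0 : ∀ x, 0 ≤ v x := fun x => mul_nonneg hkp.le (by linarith [hle x])
  have hgv : gag1 N s v = ENNReal.ofReal k * gag1 N s (fun x => phi N x - psi x) := by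
    unfold gag1
    rw [← lintegral_const_mul' _ _ ENNReal.ofReal_ne_top]
    refine lintegral_congr fun x => ?_
    rw [← lintegral_const_mul' _ _ ENNReal.ofReal_ne_top]
    refine lintegral_congr fun y => ?_
    rw [← mul_assoc, ← ENNReal.ofReal_mul hkp.le, hv]
    dsimp only
    rw [← mul_sub, abs_mul, abs_of_pos hkp]
  have hHv : HH N s (fun x => |v x|) = 1 := by
    have : HH N s (fun x => |v x|) = ENNReal.ofReal k * HH N s (fun x => phi N x - psi x) := by
      unfold HH
      rw [← lintegral_const_mul' _ _ ENNReal.ofReal_ne_top]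
      refine lintegral_congr fun x => ?_
      dsimp only
      rw [abs_of_nonneg (hv0 x), ← mul_assoc, ← ENNReal.ofReal_mul hkp.le]
    rw [this, hHu, ← ENNReal.ofReal_mul hkp.le, hk, inv_mul_cancel₀ (by positivity), ENNReal.ofReal_one]
  have hmem : hardyConst N s 1 ({(0 : EuclideanSpace ℝ (Fin N))}ᶜ) ≤ gag1 N s v := by
    refine sInf_le ⟨v, hvs, ?_, ?_, ?_, (gagliardo_eq N s v).symm⟩
    · refine HasCompactSupport.of_support_subset_isCompact (isCompact_closedBall 0 2) ?_
      intro x hx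
      by_contra hc
      have hc : 2 < ‖x‖ := by simpa using hc
      apply hx
      have := hle x
      rw [phi_zero N x hc.le] at this
      have h3 : psi x = 0 := le_antisymm this (phi_nonneg N _)
      simp [hv, phi_zero N x hc.le, h3]
    · rw [subset_compl_singleton_iff, notMem_tsupport_iff_eventuallyEq]
      filter_upwards [ball_mem_nhds (0 : EuclideanSpace ℝ (Fin N)) hε] with x hx
      have hx : ‖x‖ < ε := by simpa using hx
      have h3 : psi x = 1 := phi_one N _ (by
        rw [hnε, inv_mul_le_iff₀ hε]; linarith)
      simp [hv, h3, phi_one N x (by linarith)]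
    · rw [int_eq' N hN, int_eq N s v hvs.continuous.measurable, hHv]; simp
  refine hmem.trans ?_
  rw [hgv]
  calc _ ≤ ENNReal.ofReal k * (gag1 N s (phi N) + gag1 N s psi) := by gcongr
    _ = ENNReal.ofReal (CC N s) * (ENNReal.ofReal k * (ENNReal.ofReal h + ENNReal.ofReal q * ENNReal.ofReal h)) := by
      rw [hg1, hg2, hHpsi, hhE]; ring
    _ = _ := by
      rw [← ENNReal.ofReal_mul hq.le, ← ENNReal.ofReal_add hhp.le (by positivity), ← ENNReal.ofReal_mul hkp.le]
      congr 2
      rw [hk]; field_simp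

/-- the sharp fractional Hardy constant of `ℝ^N ∖ {0}` for `p = 1`,
together with the corresponding Hardy inequality for all smooth compactly supported `u`. -/
theorem hardy_punctured (N : ℕ) (hN : 0 < N) (s : ℝ) (hs : s ∈ Set.Ioo (0 : ℝ) 1) :
    hardyConst N s 1 ({(0 : EuclideanSpace ℝ (Fin N))}ᶜ) =
      ENNReal.ofReal (4 / s * (Real.pi ^ ((N : ℝ) / 2) * Real.Gamma (1 - s) /
        (Real.Gamma (((N : ℝ) - s) / 2) * Real.Gamma (1 - s / 2)))) ∧
    ∀ u : EuclideanSpace ℝ (Fin N) → ℝ, ContDiff ℝ (⊤ : ℕ∞) u → HasCompactSupport u →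
      ENNReal.ofReal (4 / s * (Real.pi ^ ((N : ℝ) / 2) * Real.Gamma (1 - s) /
          (Real.Gamma (((N : ℝ) - s) / 2) * Real.Gamma (1 - s / 2))) *
        ∫ x, |u x| / ‖x‖ ^ s) ≤ gagliardo N s 1 Set.univ u := by
  obtain ⟨hs0, hs1⟩ := hs
  refine ⟨le_antisymm ?_ ?_, ?_⟩
  · have hlim : Tendsto (fun q : ℝ => ENNReal.ofReal (CC N s) * ENNReal.ofReal ((1 + q) / (1 - q)))
        (nhdsWithin 0 (Ioi 0)) (nhds (ENNReal.ofReal (CC N s) * ENNReal.ofReal ((1 + 0) / (1 - 0)))) := by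
      refine ENNReal.Tendsto.const_mul (ENNReal.tendsto_ofReal ?_) (Or.inr ENNReal.ofReal_ne_top)
      have : ContinuousAt (fun q : ℝ => (1 + q) / (1 - q)) 0 :=
        ContinuousAt.div (by fun_prop) (by fun_prop) (by norm_num)
      exact this.tendsto.mono_left nhdsWithin_le_nhds
    simp only [add_zero, sub_zero, div_one, ENNReal.ofReal_one, mul_one] at hlim
    refine ge_of_tendsto hlim ?_
    filter_upwards [Ioo_mem_nhdsGT (zero_lt_one' ℝ)] with q hq
    exact upper N hN hs0 hs1 q hq.1 hq.2
  · refine le_sInf ?_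
    rintro c ⟨u, hu, _, _, hint, rfl⟩
    rw [int_eq' N hN, int_eq N s u hu.continuous.measurable, ENNReal.toReal_eq_one_iff] at hint
    have := main_lower N hN hs0 hs1 u hu.continuous.measurable (by rw [hint]; simp)
    rw [hint, mul_one] at this
    rw [gagliardo_eq]
    exact this
  · intro u hu _
    rw [int_eq N s u hu.continuous.measurable, gagliardo_eq]
    by_cases hH : HH N s (fun x => |u x|) = ∞
    · simp [hH]
    · rw [ENNReal.ofReal_mul' ENNReal.toReal_nonneg, ENNReal.ofReal_toReal hH]
      exact main_lower N hN hs0 hs1 u hu.continuous.measurable hH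
end

section
/- Let Ω ⊊ ℝ be the union of n ∈ ℕ nonempty pairwise disjoint bounded open intervals all having the same length. Then for every s ∈ (0,1) and p ∈ [1,∞) with sp < 1, one has 𝔥_{s,p}(Ω) ≥ 𝔥_{s,p}(ℝ∖{0}) / n^{sp}. -/
open MeasureTheory Metric Set Filter
open scoped ENNReal NNReal

/-- The `p`-th power of the Gagliardo `(s,p)`-seminorm of `u : ℝ → ℝ` on `A ⊆ ℝ`,
valued in `[0,∞]`. -/
noncomputable def gagliardo1 (s p : ℝ) (A : Set ℝ) (u : ℝ → ℝ) : ℝ≥0∞ :=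
  ∫⁻ x in A, ∫⁻ y in A, ENNReal.ofReal (|u x - u y| ^ p / |x - y| ^ (1 + s * p))

/-- The sharp fractional Hardy constant `𝔥_{s,p}(Ω)` for `Ω ⊆ ℝ`, an element of `[0,∞]`. -/
noncomputable def hardyConst1 (s p : ℝ) (Ω : Set ℝ) : ℝ≥0∞ :=
  sInf { c : ℝ≥0∞ | ∃ u : ℝ → ℝ,
    ContDiff ℝ (⊤ : ℕ∞) u ∧ HasCompactSupport u ∧ tsupport u ⊆ Ω ∧
    (∫ x in Ω, |u x| ^ p / Metric.infDist x (frontier Ω) ^ (s * p)) = 1 ∧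
    c = gagliardo1 s p Set.univ u }

open scoped Topology

lemma aux_half (f : ℝ → ℝ) (K : ℝ≥0) (hf : LipschitzWith K f) {x0 x1 τ τ' : ℝ}
    (h0 : τ' < f x0) (h1 : f x1 ≤ τ) (S : Set ℝ)
    (hS : ∀ x ∈ uIcc x1 x0, τ < f x → f x ≤ τ' → x ∈ S) :
    ENNReal.ofReal (τ' - τ) ≤ K * volume S := by
  have him : Ioc τ τ' ⊆ f '' S := by
    intro t ht
    have := intermediate_value_uIcc (a := x1) (b := x0) (f := f) hf.continuous.continuousOn
    have ht' : t ∈ uIcc (f x1) (f x0) := by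
      rw [mem_uIcc]; left; exact ⟨h1.trans ht.1.le, ht.2.trans h0.le⟩
    obtain ⟨x, hx, rfl⟩ := this ht'
    exact ⟨x, hS x hx ht.1 ht.2, rfl⟩
  calc ENNReal.ofReal (τ' - τ) = volume (Ioc τ τ') := by rw [Real.volume_Ioc]
    _ ≤ volume (f '' S) := measure_mono him
    _ ≤ K * volume S := by
      have := (hf.lipschitzOnWith (s := S)).hausdorffMeasure_image_le (d := 1) zero_le_one
      rw [hausdorffMeasure_real] at this
      simpa using this

lemma lip_level (f : ℝ → ℝ) (K : ℝ≥0) (hf : LipschitzWith K f) (N : ℝ)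
    (hN : ∀ x, N ≤ |x| → f x = 0) {τ τ' : ℝ} (hτ : 0 ≤ τ) (hττ : τ ≤ τ')
    (hne : ∃ x0, τ' < f x0) :
    ENNReal.ofReal (2 * (τ' - τ)) + K * volume {x | τ' < f x} ≤ K * volume {x | τ < f x} := by
  obtain ⟨x0, hx0⟩ := hne
  have hx0N : |x0| < N := by
    by_contra h
    have := hN x0 (not_lt.1 h)
    linarith
  have hfm := hf.continuous.measurable
  set S : Set ℝ := {x | τ < f x ∧ f x ≤ τ'} with hS
  have hSm : MeasurableSet S := (measurableSet_lt measurable_const hfm).inter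
    (measurableSet_le hfm measurable_const)
  have e1 : ENNReal.ofReal (τ' - τ) ≤ K * volume (S ∩ Iio x0) := by
    refine aux_half f K hf (x0 := x0) (x1 := -N) hx0 ?_ _ ?_
    · rw [hN]; exact hτ; rw [abs_neg]; exact le_abs_self N
    · intro x hx h1 h2
      refine ⟨⟨h1, h2⟩, ?_⟩
      rw [uIcc_of_le (by linarith [(abs_lt.1 hx0N).1])] at hx
      refine lt_of_le_of_ne hx.2 ?_
      rintro rfl; linarith
  have e2 : ENNReal.ofReal (τ' - τ) ≤ K * volume (S \ Iio x0) := by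
    refine aux_half f K hf (x0 := x0) (x1 := N) hx0 ?_ _ ?_
    · rw [hN]; exact hτ; exact le_abs_self N
    · intro x hx h1 h2
      refine ⟨⟨h1, h2⟩, ?_⟩
      rw [uIcc_of_ge (by linarith [(abs_lt.1 hx0N).2])] at hx
      simp [hx.1]
  have e3 : ENNReal.ofReal (2 * (τ' - τ)) ≤ K * volume S := by
    rw [← measure_inter_add_sdiff S (measurableSet_Iio (a := x0)), mul_add, two_mul,
      ENNReal.ofReal_add (by linarith) (by linarith)]
    exact add_le_add e1 e2
  have e4 : volume S + volume {x | τ' < f x} = volume {x | τ < f x} := by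
    rw [← measure_union]
    · congr 1; ext x; simp only [hS, mem_union, mem_ofPred_eq]
      constructor
      · rintro (h | h)
        · exact h.1
        · linarith
      · intro h
        rcases le_or_gt (f x) τ' with h' | h'
        · exact Or.inl ⟨h, h'⟩
        · exact Or.inr h'
    · rw [Set.disjoint_left]; rintro x ⟨_, h⟩ h'; simp only [mem_ofPred_eq] at h'; linarith
    · exact measurableSet_lt measurable_const hfm
  rw [← e4, mul_add]
  gcongr

lemma major (m ms : ℝ → ℝ≥0∞) (M : ℝ)
    (h1 : ∀ τ τ', 0 ≤ τ → τ ≤ τ' → m τ' ≠ 0 → ENNReal.ofReal (2 * (τ' - τ)) + m τ' ≤ m τ)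
    (h2 : ∀ τ τ', 0 ≤ τ → τ ≤ τ' → τ' < M → ms τ ≤ ENNReal.ofReal (2 * (τ' - τ)) + ms τ')
    (h3 : ∀ τ, M ≤ τ → m τ = 0)
    (htot : ∫⁻ t in Ioi 0, m t = ∫⁻ t in Ioi 0, ms t) (hfin : ∫⁻ t in Ioi 0, m t ≠ ∞)
    (τ : ℝ) (hτ : 0 ≤ τ) :
    ∫⁻ t in Ioi 0 \ Iio τ, m t ≤ ∫⁻ t in Ioi 0 \ Iio τ, ms t := by
  have hmeas : MeasurableSet (Ioi (0:ℝ) \ Iio τ) := measurableSet_Ioi.diff measurableSet_Iio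
  rcases le_or_gt M τ with hM | hM
  · refine (setLIntegral_mono' hmeas ?_)
    intro t ht
    rw [h3 t (hM.trans (not_lt.1 ht.2))]; exact zero_le
  rcases le_or_gt (m τ) (ms τ) with hc | hc
  · refine setLIntegral_mono' hmeas ?_
    intro t ht
    have htτ : τ ≤ t := not_lt.1 ht.2
    rcases le_or_gt M t with h | h
    · rw [h3 t h]; exact zero_le
    by_cases h0 : m t = 0
    · rw [h0]; exact zero_le
    have := (h1 τ t hτ htτ h0).trans (hc.trans (h2 τ t hτ htτ h))
    exact (ENNReal.add_le_add_iff_left ENNReal.ofReal_ne_top).1 this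
  · have hle : ∫⁻ t in Ioi 0 ∩ Iio τ, ms t ≤ ∫⁻ t in Ioi 0 ∩ Iio τ, m t := by
      refine setLIntegral_mono' (measurableSet_Ioi.inter measurableSet_Iio) ?_
      intro t ht
      have a1 := h2 t τ ht.1.le ht.2.le hM
      have a2 := h1 t τ ht.1.le ht.2.le (ne_bot_of_gt hc)
      refine a1.trans (le_trans ?_ a2)
      gcongr
    rw [← lintegral_inter_add_sdiff m (Ioi 0) (measurableSet_Iio (a := τ)),
      ← lintegral_inter_add_sdiff ms (Ioi 0) (measurableSet_Iio (a := τ))] at htot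
    have hfin2 : ∫⁻ t in Ioi 0 ∩ Iio τ, m t ≠ ∞ := by
      refine ne_top_of_le_ne_top hfin ?_
      exact lintegral_mono_set inter_subset_left
    refine (ENNReal.add_le_add_iff_left hfin2).1 ?_
    rw [htot]
    gcongr

lemma riesz_star (β r x : ℝ) :
    volume (Ioo (-β) β ∩ Ioo (x - r) (x + r)) =
      ENNReal.ofReal (max 0 (min (min (2 * β) (2 * r)) (β + r - |x|))) := by
  rw [Ioo_inter_Ioo, Real.volume_Ioo]
  have : β ⊓ (x + r) - (-β) ⊔ (x - r) = min (min (2 * β) (2 * r)) (β + r - |x|) := by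
    have e : (-β) ⊔ (x - r) = - (β ⊓ (r - x)) := by rw [← max_neg_neg]; congr 1; ring
    rw [e]
    rcases abs_cases x with ⟨h, h'⟩ | ⟨h, h'⟩ <;> rw [h] <;> 
    rcases min_cases β (x + r) with ⟨h1, h1'⟩ | ⟨h1, h1'⟩ <;>
    rcases min_cases β (r - x) with ⟨h2, h2'⟩ | ⟨h2, h2'⟩ <;> rw [h1, h2] <;>
    symm <;> grind
  rw [this]
  rcases le_total 0 (min (min (2 * β) (2 * r)) (β + r - |x|)) with h | h
  · rw [max_eq_right h]
  · rw [max_eq_left h, ENNReal.ofReal_of_nonpos h, ENNReal.ofReal_zero]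

lemma conv_total (B : Set ℝ) (hB : MeasurableSet B) (r : ℝ) :
    ∫⁻ x, volume (B ∩ Ioo (x - r) (x + r)) = ENNReal.ofReal (2 * r) * volume B := by
  have h1 : ∀ x, volume (B ∩ Ioo (x - r) (x + r)) =
      ∫⁻ y in B, (Ioo (x - r) (x + r)).indicator 1 y := by
    intro x
    rw [lintegral_indicator_one measurableSet_Ioo, Measure.restrict_apply measurableSet_Ioo,
      inter_comm]
  simp_rw [h1]
  rw [lintegral_lintegral_swap]
  · have h2 : ∀ y, ∫⁻ x, (Ioo (x - r) (x + r)).indicator (1 : ℝ → ℝ≥0∞) y = ENNReal.ofReal (2 * r) := by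
      intro y
      have : ∀ x, (Ioo (x - r) (x + r)).indicator (1 : ℝ → ℝ≥0∞) y =
          (Ioo (y - r) (y + r)).indicator 1 x := by
        intro x
        simp only [indicator, mem_Ioo, Pi.one_apply]
        congr 1
        apply propext; constructor <;> rintro ⟨h, h'⟩ <;> constructor <;> linarith
      simp_rw [this]
      rw [lintegral_indicator_one measurableSet_Ioo, Real.volume_Ioo]
      congr 1; ring
    simp_rw [h2]
    simp
  · apply Measurable.aemeasurable
    have : (Function.uncurry fun x y => (Ioo (x - r) (x + r)).indicator (1 : ℝ → ℝ≥0∞) y) =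
      {q : ℝ × ℝ | q.1 - r < q.2 ∧ q.2 < q.1 + r}.indicator 1 := by
      ext q; simp [Function.uncurry, indicator]
    rw [this]
    refine measurable_one.indicator ?_
    refine MeasurableSet.inter (s₁ := {q : ℝ × ℝ | q.1 - r < q.2})
      (s₂ := {q : ℝ × ℝ | q.2 < q.1 + r}) ?_ ?_
    · exact measurableSet_lt (by fun_prop) (by fun_prop)
    · exact measurableSet_lt (by fun_prop) (by fun_prop)

lemma conv_lip (B : Set ℝ) (hfin : volume B ≠ ∞) (r : ℝ) :
    LipschitzWith 1 (fun x => (volume (B ∩ Ioo (x - r) (x + r))).toReal) := by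
  have hf : ∀ x, volume (B ∩ Ioo (x - r) (x + r)) ≠ ∞ := fun x =>
    ne_top_of_le_ne_top hfin (measure_mono inter_subset_left)
  refine LipschitzWith.of_le_add_mul 1 ?_
  intro x y
  have key : volume (B ∩ Ioo (x - r) (x + r)) ≤
      volume (B ∩ Ioo (y - r) (y + r)) + ENNReal.ofReal |x - y| := by
    rcases le_total x y with h | h
    · calc _ ≤ volume ((B ∩ Ioo (y - r) (y + r)) ∪ Ioc (x - r) (y - r)) := by
            refine measure_mono ?_
            rintro z ⟨hz, h1, h2⟩
            rcases le_or_gt z (y - r) with h3 | h3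
            · right; exact ⟨h1, h3⟩
            · left; exact ⟨hz, h3, by linarith⟩
        _ ≤ _ := measure_union_le _ _
        _ = _ := by
          rw [Real.volume_Ioc, abs_of_nonpos (by linarith)]; congr 2; ring
    · calc _ ≤ volume ((B ∩ Ioo (y - r) (y + r)) ∪ Ico (y + r) (x + r)) := by
            refine measure_mono ?_
            rintro z ⟨hz, h1, h2⟩
            rcases lt_or_ge z (y + r) with h3 | h3
            · left; exact ⟨hz, by linarith, h3⟩
            · right; exact ⟨h3, h2⟩
        _ ≤ _ := measure_union_le _ _
        _ = _ := by
          rw [Real.volume_Ico, abs_of_nonneg (by linarith)]; congr 2; ring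
  have := ENNReal.toReal_mono (by finiteness [hf y]) key
  rw [ENNReal.toReal_add (hf y) ENNReal.ofReal_ne_top, ENNReal.toReal_ofReal (abs_nonneg _)] at this
  simpa [Real.dist_eq] using this

lemma riesz (A B : Set ℝ) (hB : MeasurableSet B) (N : ℝ)
    (hBN : ∀ x ∈ B, |x| < N) (α β r : ℝ) (hα : 0 ≤ α) (hβ : 0 ≤ β) (hr : 0 < r)
    (hAα : volume A = ENNReal.ofReal (2 * α)) (hBβ : volume B = ENNReal.ofReal (2 * β)) :
    ∫⁻ x in A, volume (B ∩ Ioo (x - r) (x + r)) ≤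
      ∫⁻ x in Ioo (-α) α, volume (Ioo (-β) β ∩ Ioo (x - r) (x + r)) := by
  have hBfin : volume B ≠ ∞ := by rw [hBβ]; exact ENNReal.ofReal_ne_top
  set f : ℝ → ℝ := fun x => (volume (B ∩ Ioo (x - r) (x + r))).toReal with hfdef
  have hlip : LipschitzWith 1 f := conv_lip B hBfin r
  have hfm : Measurable f := hlip.continuous.measurable
  have hff : ∀ x, volume (B ∩ Ioo (x - r) (x + r)) = ENNReal.ofReal (f x) := fun x =>
    (ENNReal.ofReal_toReal (ne_top_of_le_ne_top hBfin (measure_mono inter_subset_left))).symm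
  set M : ℝ := min (2 * β) (2 * r) with hM
  have hM0 : 0 ≤ M := le_min (by linarith) (by linarith)
  set fs : ℝ → ℝ := fun x => max 0 (min M (β + r - |x|)) with hfsdef
  have hfsm : Measurable fs := by fun_prop
  have hfs : ∀ x, volume (Ioo (-β) β ∩ Ioo (x - r) (x + r)) = ENNReal.ofReal (fs x) :=
    fun x => riesz_star β r x
  have hfM : ∀ x, f x ≤ M := by
    intro x
    refine le_min ?_ ?_
    · have : volume (B ∩ Ioo (x - r) (x + r)) ≤ ENNReal.ofReal (2 * β) :=
        hBβ ▸ measure_mono inter_subset_left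
      exact ENNReal.toReal_le_of_le_ofReal (by linarith) this
    · have : volume (B ∩ Ioo (x - r) (x + r)) ≤ ENNReal.ofReal (2 * r) := by
        refine (measure_mono inter_subset_right).trans ?_
        rw [Real.volume_Ioo]; apply le_of_eq; congr 1; ring
      exact ENNReal.toReal_le_of_le_ofReal (by linarith) this
  have htot : ∫⁻ x, ENNReal.ofReal (f x) = ∫⁻ x, ENNReal.ofReal (fs x) := by
    simp_rw [← hff, ← hfs]
    rw [conv_total _ hB, conv_total _ measurableSet_Ioo, hBβ, Real.volume_Ioo]
    congr 2; ring
  have htotfin : ∫⁻ x, ENNReal.ofReal (f x) ≠ ∞ := by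
    simp_rw [← hff]; rw [conv_total _ hB]; finiteness
  have hf0 : ∀ x, 0 ≤ f x := fun x => ENNReal.toReal_nonneg
  have hfs0 : ∀ x, 0 ≤ fs x := fun x => le_max_left _ _
  have hmaj := major (fun t => volume {x | t < f x}) (fun t => volume {x | t < fs x}) M ?_ ?_ ?_ ?_ ?_
    (fs α) (hfs0 α)
  · simp_rw [hff, hfs]
    rw [lintegral_eq_lintegral_meas_lt _ (ae_of_all _ hf0) hfm.aemeasurable,
      lintegral_eq_lintegral_meas_lt _ (ae_of_all _ hfs0) hfsm.aemeasurable]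
    rw [← lintegral_inter_add_sdiff _ (Ioi 0) (measurableSet_Iio (a := fs α)),
      ← lintegral_inter_add_sdiff _ (Ioi 0) (measurableSet_Iio (a := fs α))]
    refine add_le_add ?_ ?_
    · refine setLIntegral_mono' (measurableSet_Ioi.inter measurableSet_Iio) ?_
      intro t ht
      rw [Measure.restrict_apply (measurableSet_lt measurable_const hfm),
        Measure.restrict_apply (measurableSet_lt measurable_const hfsm)]
      have : {x | t < fs x} ∩ Ioo (-α) α = Ioo (-α) α := by
        rw [inter_eq_right]
        intro x hx
        have hx' : |x| < α := abs_lt.2 hx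
        have ht2 : t < fs α := ht.2
        have : fs α ≤ fs x := by
          simp only [hfsdef]
          rw [abs_of_nonneg hα]
          gcongr
        exact lt_of_lt_of_le ht2 this
      rw [this, Real.volume_Ioo]
      refine (measure_mono inter_subset_right).trans ?_
      rw [hAα]; apply le_of_eq; congr 1; ring
    · refine le_trans ?_ (hmaj.trans ?_)
      · refine lintegral_mono fun t => ?_
        exact Measure.restrict_apply_le _ _
      · refine setLIntegral_mono' (measurableSet_Ioi.diff measurableSet_Iio) ?_
        intro t ht
        rw [Measure.restrict_apply (measurableSet_lt measurable_const hfsm)]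
        refine measure_mono ?_
        intro x hx
        refine ⟨hx, ?_⟩
        have ht2 : fs α ≤ t := not_lt.1 ht.2
        have hx2 : fs α < fs x := lt_of_le_of_lt ht2 hx
        by_contra hcon
        have : α ≤ |x| := not_lt.1 fun h => hcon (abs_lt.1 h)
        have : fs x ≤ fs α := by
          simp only [hfsdef]
          rw [abs_of_nonneg hα]
          gcongr
        linarith
  · intro τ τ' h0 h1 hne
    have : ∃ x0, τ' < f x0 := by
      by_contra hcon
      push Not at hcon
      apply hne
      have : {x | τ' < f x} = ∅ := by
        ext x; simp [hcon x]
      simp [this]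
    have := lip_level f 1 hlip (N + r) ?_ h0 h1 this
    · simpa using this
    · intro x hx
      have : B ∩ Ioo (x - r) (x + r) = ∅ := by
        ext z
        simp only [mem_inter_iff, mem_Ioo, mem_empty_iff_false, iff_false]
        rintro ⟨hz, h2, h3⟩
        have h4 := abs_lt.1 (hBN z hz)
        rcases le_abs.1 hx with h | h <;> linarith
      simp [hfdef, this]
  · intro τ τ' h0 h1 h2
    have hset : ∀ t, 0 ≤ t → t < M → volume {x | t < fs x} = ENNReal.ofReal (2 * (β + r - t)) := by
      intro t ht htM
      have : {x | t < fs x} = Ioo (-(β + r - t)) (β + r - t) := by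
        ext x
        simp only [hfsdef, mem_ofPred_eq, mem_Ioo, lt_max_iff, lt_min_iff, ← abs_lt]
        constructor
        · rintro (h | h) <;> linarith
        · intro h; right; exact ⟨htM, by linarith⟩
      rw [this, Real.volume_Ioo]; congr 1; ring
    rw [hset τ h0 (by linarith), hset τ' (by linarith) h2, ← ENNReal.ofReal_add]
    · apply le_of_eq; congr 1; ring
    · linarith
    · have : M ≤ 2 * β := min_le_left _ _
      have : M ≤ 2 * r := min_le_right _ _
      linarith
  · intro τ hτ
    have : {x | τ < f x} = ∅ := by
      ext x; simp [(hfM x).trans hτ]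
    simp [this]
  · rw [← lintegral_eq_lintegral_meas_lt _ (ae_of_all _ hf0) hfm.aemeasurable,
      ← lintegral_eq_lintegral_meas_lt _ (ae_of_all _ hfs0) hfsm.aemeasurable, htot]
  · rwa [← lintegral_eq_lintegral_meas_lt _ (ae_of_all _ hf0) hfm.aemeasurable]

lemma riesz_compl (A B : Set ℝ) (hB : MeasurableSet B) (N : ℝ)
    (hBN : ∀ x ∈ B, |x| < N) (α β r : ℝ) (hα : 0 ≤ α) (hβ : 0 ≤ β) (hr : 0 < r)
    (hAα : volume A = ENNReal.ofReal (2 * α)) (hBβ : volume B = ENNReal.ofReal (2 * β)) :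
    ∫⁻ x in Ioo (-α) α, volume ((Ioo (-β) β)ᶜ ∩ Ioo (x - r) (x + r)) ≤
      ∫⁻ x in A, volume (Bᶜ ∩ Ioo (x - r) (x + r)) := by
  have key : ∀ (A B : Set ℝ), MeasurableSet B → volume B ≠ ∞ →
      (∫⁻ x in A, volume (B ∩ Ioo (x - r) (x + r))) +
        ∫⁻ x in A, volume (Bᶜ ∩ Ioo (x - r) (x + r)) = ENNReal.ofReal (2 * r) * volume A := by
    intro A B hB hfin
    rw [← lintegral_add_left]
    · have : ∀ x, volume (B ∩ Ioo (x - r) (x + r)) + volume (Bᶜ ∩ Ioo (x - r) (x + r)) =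
          ENNReal.ofReal (2 * r) := by
        intro x
        rw [inter_comm B, inter_comm Bᶜ, ← sdiff_eq, measure_inter_add_sdiff _ hB, Real.volume_Ioo]
        congr 1; ring
      simp_rw [this]; simp
    · have h1 := (conv_lip B hfin r).continuous.measurable.ennreal_ofReal
      refine (congrArg Measurable (funext fun x => ?_)).mpr h1
      exact (ENNReal.ofReal_toReal (ne_top_of_le_ne_top hfin (measure_mono inter_subset_left))).symm
  have hBfin : volume B ≠ ∞ := by rw [hBβ]; exact ENNReal.ofReal_ne_top
  have k1 := key A B hB hBfin
  have k2 := key (Ioo (-α) α) (Ioo (-β) β) measurableSet_Ioo (by simp)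
  have hle := riesz A B hB N hBN α β r hα hβ hr hAα hBβ
  have hv : volume (Ioo (-α) α) = volume A := by
    rw [hAα, Real.volume_Ioo]; congr 1; ring
  rw [hv, ← k1] at k2
  have hfin : ∫⁻ x in Ioo (-α) α, volume (Ioo (-β) β ∩ Ioo (x - r) (x + r)) ≠ ∞ := by
    intro h
    rw [h, top_add, k1, hAα] at k2
    exact (ENNReal.mul_ne_top ENNReal.ofReal_ne_top ENNReal.ofReal_ne_top) k2.symm
  refine (ENNReal.add_le_add_iff_left hfin).1 ?_
  rw [k2]
  gcongr

lemma swap3 (h : ℝ → ℝ → ℝ → ℝ≥0∞)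
    (hm : Measurable fun q : ℝ × ℝ × ℝ => h q.1 q.2.1 q.2.2) (S : Set ℝ) :
    ∫⁻ x, ∫⁻ y, ∫⁻ t in S, h x y t = ∫⁻ t in S, ∫⁻ x, ∫⁻ y, h x y t := by
  have h1 : ∀ x, ∫⁻ y, ∫⁻ t in S, h x y t = ∫⁻ t in S, ∫⁻ y, h x y t := by
    intro x
    refine lintegral_lintegral_swap ?_
    refine Measurable.aemeasurable ?_
    exact hm.comp (measurable_const.prodMk measurable_id)
  simp_rw [h1]
  refine lintegral_lintegral_swap ?_
  refine Measurable.aemeasurable ?_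
  refine Measurable.lintegral_prod_right' (f := fun q : (ℝ × ℝ) × ℝ => h q.1.1 q.2 q.1.2) ?_
  exact hm.comp (f := fun q : (ℝ × ℝ) × ℝ => (q.1.1, q.2, q.1.2)) (by fun_prop)

lemma cmp3 (F Fs : ℝ → ℝ → ℝ≥0∞) (h hs : ℝ → ℝ → ℝ → ℝ≥0∞)
    (hm : Measurable fun q : ℝ × ℝ × ℝ => h q.1 q.2.1 q.2.2)
    (hms : Measurable fun q : ℝ × ℝ × ℝ => hs q.1 q.2.1 q.2.2)
    (hF : ∀ x y, F x y = ∫⁻ t in Ioi 0, h x y t) (hFs : ∀ x y, Fs x y = ∫⁻ t in Ioi 0, hs x y t)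
    (hle : ∀ t, 0 < t → ∫⁻ x, ∫⁻ y, hs x y t ≤ ∫⁻ x, ∫⁻ y, h x y t) :
    ∫⁻ x, ∫⁻ y, Fs x y ≤ ∫⁻ x, ∫⁻ y, F x y := by
  simp_rw [hF, hFs]
  rw [swap3 h hm, swap3 hs hms]
  exact setLIntegral_mono' measurableSet_Ioi fun t ht => hle t ht

lemma layer (c : ℝ) : ENNReal.ofReal c = ∫⁻ t in Ioi 0, if t < c then 1 else 0 := by
  have : ∀ t : ℝ, (if t < c then (1 : ℝ≥0∞) else 0) = (Iio c).indicator 1 t := by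
    intro t; simp [indicator]
  simp_rw [this]
  rw [lintegral_indicator_one measurableSet_Iio, Measure.restrict_apply measurableSet_Iio,
    inter_comm, Ioi_inter_Iio, Real.volume_Ioo, sub_zero]

lemma meas_ind (A : Set ℝ) (hA : MeasurableSet A) : Measurable (A.indicator (1 : ℝ → ℝ≥0∞)) :=
  measurable_one.indicator hA

lemma stage2_slice (A B : Set ℝ) (hA : MeasurableSet A) (hB : MeasurableSet B) (q ρ : ℝ)
    (hq : 0 < q) (hρ : 0 < ρ) :
    ∫⁻ x, ∫⁻ y, A.indicator 1 x * Bᶜ.indicator 1 y *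
      (if ρ < 1 / |x - y| ^ q then (1 : ℝ≥0∞) else 0) =
    ∫⁻ x in A, volume (Bᶜ ∩ Ioo (x - ρ ^ (-1 / q)) (x + ρ ^ (-1 / q))) := by
  rw [← lintegral_indicator hA]
  refine lintegral_congr fun x => ?_
  by_cases hx : x ∈ A
  · simp only [indicator_of_mem hx, Pi.one_apply, one_mul]
    rw [← lintegral_indicator_one (hB.compl.inter measurableSet_Ioo)]
    refine lintegral_congr_ae ?_
    have : ∀ᵐ y : ℝ, y ≠ x := by
      simp [ae_iff]
    filter_upwards [this] with y hy
    have hz : 0 < |x - y| := abs_pos.2 (sub_ne_zero.2 hy.symm)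
    have hiff : ρ < 1 / |x - y| ^ q ↔ y ∈ Ioo (x - ρ ^ (-1 / q)) (x + ρ ^ (-1 / q)) := by
      have h1 : y ∈ Ioo (x - ρ ^ (-1 / q)) (x + ρ ^ (-1 / q)) ↔ |x - y| < ρ ^ (-1 / q) := by
        rw [abs_lt, mem_Ioo]; constructor <;> rintro ⟨h, h'⟩ <;> constructor <;> linarith
      rw [h1, one_div, ← Real.rpow_neg hz.le, neg_div, one_div]
      have e : |x - y| = (|x - y| ^ (-q)) ^ (-q⁻¹) := by
        rw [← Real.rpow_mul hz.le]; 
        have : -q * -q⁻¹ = 1 := by field_simp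
        rw [this, Real.rpow_one]
      conv_rhs => rw [e]
      rw [Real.rpow_lt_rpow_iff_of_neg (by positivity) hρ (by simpa using hq)]
    by_cases hyB : y ∈ Bᶜ
    · by_cases hyI : y ∈ Ioo (x - ρ ^ (-1 / q)) (x + ρ ^ (-1 / q))
      · rw [indicator_of_mem hyB, if_pos (hiff.2 hyI),
          indicator_of_mem (show y ∈ Bᶜ ∩ Ioo _ _ from ⟨hyB, hyI⟩)]; simp
      · rw [if_neg (fun h => hyI (hiff.1 h)),
          indicator_of_notMem (fun h : y ∈ Bᶜ ∩ Ioo _ _ => hyI h.2)]; simp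
    · rw [indicator_of_notMem hyB,
        indicator_of_notMem (fun h : y ∈ Bᶜ ∩ Ioo _ _ => hyB h.1)]; simp
  · simp [indicator_of_notMem hx]

lemma stage2 (A B As Bs : Set ℝ) (hA : MeasurableSet A) (hB : MeasurableSet B) (N : ℝ)
    (hBN : ∀ x ∈ B, |x| < N) (α β q : ℝ) (hα : 0 ≤ α) (hβ : 0 ≤ β) (hq : 0 < q)
    (hAα : volume A = ENNReal.ofReal (2 * α)) (hBβ : volume B = ENNReal.ofReal (2 * β))
    (hAs : As = Ioo (-α) α) (hBs : Bs = Ioo (-β) β) :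
    ∫⁻ x, ∫⁻ y, As.indicator 1 x * Bsᶜ.indicator 1 y * ENNReal.ofReal (1 / |x - y| ^ q) ≤
    ∫⁻ x, ∫⁻ y, A.indicator 1 x * Bᶜ.indicator 1 y * ENNReal.ofReal (1 / |x - y| ^ q) := by
  subst hAs hBs
  have hmeas : ∀ (A B : Set ℝ), MeasurableSet A → MeasurableSet B →
      Measurable fun z : ℝ × ℝ × ℝ => A.indicator 1 z.1 * Bᶜ.indicator 1 z.2.1 *
        (if z.2.2 < 1 / |z.1 - z.2.1| ^ q then (1 : ℝ≥0∞) else 0) := by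
    intro A B hA hB
    refine (((meas_ind A hA).comp measurable_fst).mul ((meas_ind _ hB.compl).comp
      (measurable_fst.comp measurable_snd))).mul ?_
    refine Measurable.ite ?_ measurable_const measurable_const
    exact measurableSet_lt (by fun_prop) (by fun_prop)
  have hrep : ∀ (A B : Set ℝ) (x y : ℝ),
      A.indicator 1 x * Bᶜ.indicator 1 y * ENNReal.ofReal (1 / |x - y| ^ q) =
      ∫⁻ t in Ioi 0, A.indicator 1 x * Bᶜ.indicator 1 y *
        (if t < 1 / |x - y| ^ q then (1 : ℝ≥0∞) else 0) := by
    intro A B x y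
    rw [lintegral_const_mul, ← layer]
    refine Measurable.ite ?_ measurable_const measurable_const
    exact measurableSet_lt (by fun_prop) (by fun_prop)
  refine cmp3 _ _ _ _ (hmeas A B hA hB) (hmeas _ _ measurableSet_Ioo measurableSet_Ioo)
    (hrep A B) (hrep _ _) ?_
  intro t ht
  rw [stage2_slice _ _ hA hB q t hq ht,
    stage2_slice _ _ measurableSet_Ioo measurableSet_Ioo q t hq ht]
  exact riesz_compl A B hB N hBN α β _ hα hβ (by positivity) hAα hBβ

/-- `ws` is the rearrangement of `w`. -/
structure Rearr (w ws : ℝ → ℝ) : Prop where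
  mw : Measurable w
  mws : Measurable ws
  w0 : ∀ x, 0 ≤ w x
  ws0 : ∀ x, 0 ≤ ws x
  bdd : ∃ N, ∀ x, 0 < w x → |x| < N
  lev : ∀ t, 0 ≤ t → ∃ α, 0 ≤ α ∧ volume {x | t < w x} = ENNReal.ofReal (2 * α) ∧
    {x | t < ws x} = Ioo (-α) α

noncomputable def gfun (p t a : ℝ) : ℝ := if t < a then p * (a - t) ^ (p - 1) else 0

lemma gfun_lev (p t σ : ℝ) (hp : 1 ≤ p) (ht : 0 ≤ t) (hσ : 0 < σ) :
    (∀ a, ¬ σ < gfun p t a) ∨ ∃ t', 0 ≤ t' ∧ ∀ a, σ < gfun p t a ↔ t' < a := by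
  rcases hp.eq_or_lt with rfl | hp
  · rcases lt_or_ge σ 1 with h | h
    · right; refine ⟨t, ht, fun a => ?_⟩
      unfold gfun; split_ifs with h1
      · simp [h, h1]
      · simp [h1, hσ.le]
    · left; intro a; unfold gfun; split_ifs <;> simp [h, hσ.le]
  · right
    refine ⟨t + (σ / p) ^ (1 / (p - 1)), by positivity, fun a => ?_⟩
    have hpos : 0 < (σ / p) ^ (1 / (p - 1)) := by positivity
    unfold gfun; split_ifs with h1
    · rw [← lt_sub_iff_add_lt', ← Real.rpow_lt_rpow_iff hpos.le (by linarith) (by linarith : 0 < p - 1),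
        ← Real.rpow_mul (by positivity), one_div, inv_mul_cancel₀ (by linarith), Real.rpow_one,
        div_lt_iff₀' (by linarith)]
    · constructor
      · intro h; linarith
      · intro h; linarith

lemma gfun_meas (p : ℝ) : Measurable fun z : ℝ × ℝ => gfun p z.1 z.2 := by
  unfold gfun
  refine Measurable.ite ?_ (by fun_prop) measurable_const
  exact measurableSet_lt (by fun_prop) (by fun_prop)

lemma stage3 (w ws : ℝ → ℝ) (H : Rearr w ws) (p q t : ℝ) (hp : 1 ≤ p) (hq : 0 < q) (ht : 0 ≤ t) :
    ∫⁻ x, ∫⁻ y, ENNReal.ofReal (gfun p t (ws x)) *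
        ({z | t < ws z}ᶜ.indicator 1 y * ENNReal.ofReal (1 / |x - y| ^ q)) ≤
    ∫⁻ x, ∫⁻ y, ENNReal.ofReal (gfun p t (w x)) *
        ({z | t < w z}ᶜ.indicator 1 y * ENNReal.ofReal (1 / |x - y| ^ q)) := by
  have hmeas : ∀ w : ℝ → ℝ, Measurable w → Measurable fun z : ℝ × ℝ × ℝ =>
      (if z.2.2 < gfun p t (w z.1) then (1 : ℝ≥0∞) else 0) *
        ({z | t < w z}ᶜ.indicator 1 z.2.1 * ENNReal.ofReal (1 / |z.1 - z.2.1| ^ q)) := by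
    intro w hw
    refine Measurable.mul ?_ (Measurable.mul ?_ (by fun_prop))
    · refine Measurable.ite ?_ measurable_const measurable_const
      refine measurableSet_lt (by fun_prop) ?_
      exact (gfun_meas p).comp (f := fun z : ℝ × ℝ × ℝ => (t, w z.1)) (by fun_prop)
    · exact (meas_ind _ (measurableSet_lt measurable_const hw).compl).comp
        (measurable_fst.comp measurable_snd)
  have hrep : ∀ (w : ℝ → ℝ) (x y : ℝ), ENNReal.ofReal (gfun p t (w x)) *
        ({z | t < w z}ᶜ.indicator 1 y * ENNReal.ofReal (1 / |x - y| ^ q)) =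
      ∫⁻ σ in Ioi 0, (if σ < gfun p t (w x) then (1 : ℝ≥0∞) else 0) *
        ({z | t < w z}ᶜ.indicator 1 y * ENNReal.ofReal (1 / |x - y| ^ q)) := by
    intro w x y
    rw [lintegral_mul_const, ← layer]
    refine Measurable.ite ?_ measurable_const measurable_const
    exact measurableSet_lt (by fun_prop) (by fun_prop)
  refine cmp3 _ _ _ _ (hmeas w H.mw) (hmeas ws H.mws) (hrep w) (hrep ws) ?_
  intro σ hσ
  rcases gfun_lev p t σ hp ht hσ with h | ⟨t', ht', h⟩
  · simp [h]
  · obtain ⟨α, hα, h1, h2⟩ := H.lev t' ht'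
    obtain ⟨β, hβ, h3, h4⟩ := H.lev t ht
    obtain ⟨N, hN⟩ := H.bdd
    have hh : ∀ (w : ℝ → ℝ) x, (if σ < gfun p t (w x) then (1 : ℝ≥0∞) else 0) =
        {z | t' < w z}.indicator 1 x := by
      intro w x; simp [h, indicator]
    simp_rw [hh, ← mul_assoc]
    exact stage2 _ _ _ _ (measurableSet_lt measurable_const H.mw)
      (measurableSet_lt measurable_const H.mw) N (fun x hx => hN x (lt_of_le_of_lt ht hx))
      α β q hα hβ hq h1 h3 h2 h4

lemma gfun_int (p a b : ℝ) (hp : 1 ≤ p) (hb : 0 ≤ b) :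
    ENNReal.ofReal ((max (a - b) 0) ^ p) =
      ∫⁻ t in Ioi 0, ENNReal.ofReal (gfun p t a) * (if t < b then 0 else 1) := by
  have h1 : ∀ t, ENNReal.ofReal (gfun p t a) * (if t < b then 0 else 1) =
      (Ico b a).indicator (fun t => ENNReal.ofReal (p * (a - t) ^ (p - 1))) t := by
    intro t
    unfold gfun
    by_cases h1 : t < b <;> by_cases h2 : t < a <;> simp [h1, h2, indicator]
  simp_rw [h1]
  rw [setLIntegral_indicator measurableSet_Ico]
  have h2 : (Ico b a ∩ Ioi 0 : Set ℝ) =ᵐ[volume] Ioc b a := by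
    refine ae_eq_trans (g := (Ioo b a : Set ℝ)) ?_ Ioo_ae_eq_Ioc
    have : ∀ᵐ y : ℝ, y ≠ b := by simp [ae_iff]
    filter_upwards [this] with y hy
    apply propext
    change (y ∈ Ico b a ∩ Ioi 0) ↔ y ∈ Ioo b a
    simp only [mem_inter_iff, mem_Ico, mem_Ioi, mem_Ioo]
    constructor
    · rintro ⟨⟨h, h'⟩, _⟩; exact ⟨lt_of_le_of_ne h (Ne.symm hy), h'⟩
    · rintro ⟨h, h'⟩; exact ⟨⟨h.le, h'⟩, by linarith⟩
  rw [setLIntegral_congr h2]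
  rcases le_or_gt a b with hab | hab
  · rw [Ioc_eq_empty (by linarith), max_eq_right (by linarith), Real.zero_rpow (by linarith)]
    simp
  · have hi : IntervalIntegrable (fun t => p * (a - t) ^ (p - 1)) volume b a := by
      apply Continuous.intervalIntegrable
      refine continuous_const.mul ?_
      exact Continuous.rpow_const (by fun_prop) (fun x => Or.inr (by linarith))
    rw [← ofReal_integral_eq_lintegral_ofReal]
    · rw [← intervalIntegral.integral_of_le hab.le, intervalIntegral.integral_const_mul,
        intervalIntegral.integral_comp_sub_left (fun x => x ^ (p - 1)) a,
        integral_rpow (Or.inl (by linarith)), max_eq_left (by linarith)]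
      congr 1
      rw [sub_self, sub_add_cancel, Real.zero_rpow (by linarith)]
      field_simp; ring
    · exact (intervalIntegrable_iff_integrableOn_Ioc_of_le hab.le).1 hi
    · filter_upwards [ae_restrict_mem measurableSet_Ioc] with t ht
      have : 0 ≤ a - t := by linarith [ht.2]
      simp only [Pi.zero_apply]
      positivity

lemma stage4 (w ws : ℝ → ℝ) (H : Rearr w ws) (p q : ℝ) (hp : 1 ≤ p) (hq : 0 < q) :
    ∫⁻ x, ∫⁻ y, ENNReal.ofReal ((max (ws x - ws y) 0) ^ p) * ENNReal.ofReal (1 / |x - y| ^ q) ≤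
    ∫⁻ x, ∫⁻ y, ENNReal.ofReal ((max (w x - w y) 0) ^ p) * ENNReal.ofReal (1 / |x - y| ^ q) := by
  have hmeas : ∀ w : ℝ → ℝ, Measurable w → Measurable fun z : ℝ × ℝ × ℝ =>
      ENNReal.ofReal (gfun p z.2.2 (w z.1)) * ((if z.2.2 < w z.2.1 then 0 else 1)
        * ENNReal.ofReal (1 / |z.1 - z.2.1| ^ q)) := by
    intro w hw
    refine Measurable.mul ?_ (Measurable.mul ?_ (by fun_prop))
    · refine Measurable.ennreal_ofReal ?_
      exact (gfun_meas p).comp (f := fun z : ℝ × ℝ × ℝ => (z.2.2, w z.1)) (by fun_prop)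
    · refine Measurable.ite ?_ measurable_const measurable_const
      exact measurableSet_lt (by fun_prop) (by fun_prop)
  have hrep : ∀ (w : ℝ → ℝ), (∀ x, 0 ≤ w x) → ∀ x y : ℝ,
      ENNReal.ofReal ((max (w x - w y) 0) ^ p) * ENNReal.ofReal (1 / |x - y| ^ q) =
      ∫⁻ t in Ioi 0, ENNReal.ofReal (gfun p t (w x)) * ((if t < w y then 0 else 1)
        * ENNReal.ofReal (1 / |x - y| ^ q)) := by
    intro w hw x y
    simp_rw [← mul_assoc]
    rw [lintegral_mul_const, ← gfun_int p _ _ hp (hw y)]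
    refine Measurable.mul ?_ (Measurable.ite ?_ measurable_const measurable_const)
    · refine Measurable.ennreal_ofReal ?_
      exact (gfun_meas p).comp (f := fun z : ℝ => (z, w x)) (by fun_prop)
    · exact measurableSet_lt (by fun_prop) (by fun_prop)
  refine cmp3 _ _ _ _ (hmeas w H.mw) (hmeas ws H.mws) (hrep w H.w0) (hrep ws H.ws0) ?_
  intro t ht
  have := stage3 w ws H p q t hp hq ht.le
  simpa [indicator, ← not_lt] using this

lemma polya (w ws : ℝ → ℝ) (H : Rearr w ws) (p q : ℝ) (hp : 1 ≤ p) (hq : 0 < q) :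
    ∫⁻ x, ∫⁻ y, ENNReal.ofReal (|ws x - ws y| ^ p / |x - y| ^ q) ≤
    ∫⁻ x, ∫⁻ y, ENNReal.ofReal (|w x - w y| ^ p / |x - y| ^ q) := by
  have key : ∀ w : ℝ → ℝ, Measurable w →
      ∫⁻ x, ∫⁻ y, ENNReal.ofReal (|w x - w y| ^ p / |x - y| ^ q) =
      2 * ∫⁻ x, ∫⁻ y, ENNReal.ofReal ((max (w x - w y) 0) ^ p) *
        ENNReal.ofReal (1 / |x - y| ^ q) := by
    intro w hw
    have h1 : ∀ x y, ENNReal.ofReal (|w x - w y| ^ p / |x - y| ^ q) =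
        ENNReal.ofReal ((max (w x - w y) 0) ^ p) * ENNReal.ofReal (1 / |x - y| ^ q) +
        ENNReal.ofReal ((max (w y - w x) 0) ^ p) * ENNReal.ofReal (1 / |y - x| ^ q) := by
      intro x y
      rw [abs_sub_comm y x, ← add_mul, ← ENNReal.ofReal_add (by positivity) (by positivity),
        ← ENNReal.ofReal_mul (by positivity), ← mul_div_assoc, mul_one]
      congr 2
      have hp0 : p ≠ 0 := by linarith
      rcases le_total (w x) (w y) with h | h
      · rw [max_eq_right (by linarith), max_eq_left (by linarith), abs_of_nonpos (by linarith),
          Real.zero_rpow hp0, zero_add, neg_sub]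
      · rw [max_eq_left (by linarith), max_eq_right (by linarith), abs_of_nonneg (by linarith),
          Real.zero_rpow hp0, add_zero]
    have hm : Measurable fun z : ℝ × ℝ => ENNReal.ofReal ((max (w z.1 - w z.2) 0) ^ p) *
        ENNReal.ofReal (1 / |z.1 - z.2| ^ q) := by fun_prop
    simp_rw [h1]
    have h2 : ∀ x, ∫⁻ y, (ENNReal.ofReal ((max (w x - w y) 0) ^ p) * ENNReal.ofReal (1 / |x - y| ^ q) +
        ENNReal.ofReal ((max (w y - w x) 0) ^ p) * ENNReal.ofReal (1 / |y - x| ^ q)) =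
        (∫⁻ y, ENNReal.ofReal ((max (w x - w y) 0) ^ p) * ENNReal.ofReal (1 / |x - y| ^ q)) +
        ∫⁻ y, ENNReal.ofReal ((max (w y - w x) 0) ^ p) * ENNReal.ofReal (1 / |y - x| ^ q) := by
      intro x
      rw [lintegral_add_left]
      fun_prop
    simp_rw [h2]
    rw [lintegral_add_left, two_mul]
    · congr 1
      rw [lintegral_lintegral_swap]
      exact (hm.comp measurable_swap).aemeasurable
    · exact hm.lintegral_prod_right'
  rw [key w H.mw, key ws H.mws]
  exact mul_le_mul_right (stage4 w ws H p q hp hq) 2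

lemma rearr_exists (w : ℝ → ℝ) (K : ℝ≥0) (hK : 0 < K) (hw : LipschitzWith K w) (w0 : ∀ x, 0 ≤ w x)
    (N : ℝ) (hN : ∀ x, N ≤ |x| → w x = 0) :
    ∃ ws, Rearr w ws ∧ LipschitzWith K ws ∧ HasCompactSupport ws := by
  have hmw := hw.continuous.measurable
  have hN' : ∀ x, 0 < w x → |x| < N := by
    intro x hx; by_contra h; rw [hN x (not_lt.1 h)] at hx; exact lt_irrefl _ hx
  set m : ℝ → ℝ≥0∞ := fun t => volume {x | t < w x} with hm
  have hmle : ∀ t, 0 ≤ t → m t ≤ ENNReal.ofReal (2 * N) := by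
    intro t ht
    calc m t ≤ volume (Ioo (-N) N) := measure_mono fun x hx => abs_lt.1 (hN' x (lt_of_le_of_lt ht hx))
      _ = _ := by rw [Real.volume_Ioo]; congr 1; ring
  have hmanti : ∀ t t', t ≤ t' → m t' ≤ m t := fun t t' h =>
    measure_mono fun x (hx : t' < w x) => lt_of_le_of_lt h hx
  have hex : ∀ t, m t ≠ 0 → ∃ x, t < w x := by
    intro t h; by_contra hcon
    push Not at hcon
    apply h
    have : {x | t < w x} = ∅ := by ext x; simp [hcon x]
    simp [hm, this]
  set S : ℝ → Set ℝ := fun x => {t | 0 ≤ t ∧ ENNReal.ofReal (2 * |x|) < m t} with hS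
  have hSb : ∀ x, BddAbove (S x) := by
    intro x
    refine ⟨K * (2 * |N|), ?_⟩
    rintro t ⟨ht, h⟩
    obtain ⟨z, hz⟩ := hex t (ne_bot_of_gt h)
    have h1 := hN' z (lt_of_le_of_lt ht hz)
    have h2 := hw.dist_le_mul z N
    rw [hN N (le_abs_self N), Real.dist_eq, Real.dist_eq, sub_zero, abs_of_nonneg (w0 z)] at h2
    have h3 : |z - N| ≤ 2 * |N| := by
      have := abs_sub z N
      have := le_abs_self N
      linarith
    have : (K : ℝ) * |z - N| ≤ K * (2 * |N|) := by gcongr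
    linarith
  set ws : ℝ → ℝ := fun x => sSup (S x) with hws
  have ws0 : ∀ x, 0 ≤ ws x := fun x => Real.sSup_nonneg fun t ht => ht.1
  have hlev : ∀ t, 0 ≤ t → ∀ x, t < ws x ↔ ENNReal.ofReal (2 * |x|) < m t := by
    intro t ht x
    constructor
    · intro h
      have hne : (S x).Nonempty := by
        by_contra hcon
        rw [not_nonempty_iff_eq_empty] at hcon
        simp only [hws, hcon, Real.sSup_empty] at h
        linarith
      obtain ⟨t', ht', h'⟩ := exists_lt_of_lt_csSup hne h
      exact lt_of_lt_of_le ht'.2 (hmanti _ _ h'.le)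
    · intro h
      have hU : {x | t < w x} = ⋃ n : ℕ, {x | t + 1 / ((n : ℝ) + 1) < w x} := by
        ext z
        simp only [mem_ofPred_eq, mem_iUnion]
        constructor
        · intro hz
          obtain ⟨n, hn⟩ := exists_nat_one_div_lt (sub_pos.2 hz)
          exact ⟨n, by linarith⟩
        · rintro ⟨n, hn⟩
          have : 0 < 1 / ((n : ℝ) + 1) := by positivity
          linarith
      have hmono : Monotone fun n : ℕ => {x | t + 1 / ((n : ℝ) + 1) < w x} := by
        intro n n' hnn z hz
        have : 1 / ((n' : ℝ) + 1) ≤ 1 / ((n : ℝ) + 1) := by gcongr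
        simp only [mem_ofPred_eq] at hz ⊢
        linarith
      have h' := h
      simp only [hm] at h'
      rw [hU, hmono.measure_iUnion, lt_iSup_iff] at h'
      obtain ⟨n, hn⟩ := h'
      have hp : 0 < 1 / ((n : ℝ) + 1) := by positivity
      have : t + 1 / ((n : ℝ) + 1) ≤ ws x := le_csSup (hSb x) ⟨by linarith, hn⟩
      linarith
  have hsets : ∀ t, 0 ≤ t → {x | t < ws x} = Ioo (-((m t).toReal / 2)) ((m t).toReal / 2) := by
    intro t ht
    ext x
    rw [mem_Ioo, ← abs_lt]
    change t < ws x ↔ _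
    rw [hlev t ht, ENNReal.ofReal_lt_iff_lt_toReal (by positivity)
      (ne_top_of_le_ne_top ENNReal.ofReal_ne_top (hmle t ht)), lt_div_iff₀' (by norm_num)]
  have hlip : LipschitzWith K ws := by
    refine LipschitzWith.of_le_add_mul K ?_
    intro x y
    by_contra hcon
    push Not at hcon
    rw [Real.dist_eq] at hcon
    set t' := ws y + K * |x - y| with ht'
    have hK' : (0 : ℝ) < K := hK
    have hxy : 0 ≤ (K : ℝ) * |x - y| := by positivity
    have h1 := (hlev t' (by linarith [ws0 y]) x).1 hcon
    have h2 := not_lt.1 (mt (hlev (ws y) (ws0 y) y).2 (lt_irrefl _))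
    have h3 := lip_level w K hw N hN (ws0 y) (show ws y ≤ t' by linarith) (hex t' (ne_bot_of_gt h1))
    have h4 : ENNReal.ofReal (2 * (t' - ws y)) + K * ENNReal.ofReal (2 * |x|) <
        K * ENNReal.ofReal (2 * |y|) := by
      refine lt_of_lt_of_le ?_ (h3.trans ?_)
      · refine ENNReal.add_lt_add_left ENNReal.ofReal_ne_top ?_
        exact (ENNReal.mul_lt_mul_iff_right (by exact_mod_cast hK.ne') ENNReal.coe_ne_top).2 h1
      · gcongr
    have hKe : (K : ℝ≥0∞) = ENNReal.ofReal K := by simp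
    rw [hKe, ← ENNReal.ofReal_mul hK'.le, ← ENNReal.ofReal_mul hK'.le,
      ← ENNReal.ofReal_add (by linarith) (by positivity)] at h4
    have h5 := (ENNReal.ofReal_lt_ofReal_iff_of_nonneg (by
      have : 0 ≤ 2 * (t' - ws y) := by linarith
      positivity)).1 h4
    have h6 : |y| ≤ |x| + |x - y| := by
      have := abs_sub_abs_le_abs_sub y x
      rw [abs_sub_comm] at this; linarith
    have : (K : ℝ) * |y| ≤ K * (|x| + |x - y|) := by gcongr
    nlinarith
  refine ⟨ws, ⟨hmw, hlip.continuous.measurable, w0, ws0, ⟨N, hN'⟩, ?_⟩, hlip, ?_⟩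
  · intro t ht
    refine ⟨(m t).toReal / 2, by positivity, ?_, hsets t ht⟩
    rw [mul_div_cancel₀ _ (by norm_num), ENNReal.ofReal_toReal]
    exact ne_top_of_le_ne_top ENNReal.ofReal_ne_top (hmle t ht)
  · refine HasCompactSupport.intro (isCompact_Icc (a := -((m 0).toReal / 2)) (b := (m 0).toReal / 2)) ?_
    intro x hx
    by_contra hne
    have : x ∈ {x | 0 < ws x} := lt_of_le_of_ne (ws0 x) (Ne.symm hne)
    rw [hsets 0 le_rfl] at this
    exact hx (Ioo_subset_Icc_self this)

lemma rpow_lev (z σ a : ℝ) (hz : 0 < z) (hσ : 0 < σ) (ha : 0 < a) :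
    σ < 1 / z ^ a ↔ z < σ ^ (-1 / a) := by
  rw [one_div, ← Real.rpow_neg hz.le, neg_div, one_div]
  have e : z = (z ^ (-a)) ^ (-a⁻¹) := by
    rw [← Real.rpow_mul hz.le]
    have : -a * -a⁻¹ = 1 := by field_simp
    rw [this, Real.rpow_one]
  conv_rhs => rw [e]
  rw [Real.rpow_lt_rpow_iff_of_neg (by positivity) hσ (by simpa using ha)]

lemma layer_mul (F G : ℝ → ℝ) (hF : Measurable F) (hG : Measurable G) :
    ∫⁻ x, ENNReal.ofReal (F x) * ENNReal.ofReal (G x) =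
      ∫⁻ t in Ioi 0, ∫⁻ x in {x | t < F x}, ENNReal.ofReal (G x) := by
  have h1 : ∀ x, ENNReal.ofReal (F x) * ENNReal.ofReal (G x) =
      ∫⁻ t in Ioi 0, (if t < F x then 1 else 0) * ENNReal.ofReal (G x) := by
    intro x
    rw [lintegral_mul_const, ← layer]
    refine Measurable.ite ?_ measurable_const measurable_const
    exact measurableSet_lt (by fun_prop) (by fun_prop)
  simp_rw [h1]
  rw [lintegral_lintegral_swap]
  · refine lintegral_congr fun t => ?_
    rw [← lintegral_indicator (measurableSet_lt measurable_const hF)]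
    refine lintegral_congr fun x => ?_
    by_cases h : t < F x <;> simp [h, indicator]
  · apply Measurable.aemeasurable
    refine Measurable.mul (Measurable.ite ?_ measurable_const measurable_const) (by fun_prop)
    exact measurableSet_lt (by fun_prop) (by fun_prop)

lemma weight (w ws : ℝ → ℝ) (H : Rearr w ws) (p a n : ℝ) (hp : 1 ≤ p) (ha : 0 < a) (hn : 0 < n)
    (Ω : Set ℝ) (hΩ : MeasurableSet Ω) (d : ℝ → ℝ) (hd : Measurable d) (hd0 : ∀ x ∈ Ω, 0 < d x)
    (hvol : ∀ ρ, 0 < ρ → volume (Ω ∩ {x | d x < ρ}) ≤ ENNReal.ofReal (2 * (n * ρ))) :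
    ∫⁻ x in Ω, ENNReal.ofReal (w x ^ p / d x ^ a) ≤
      ENNReal.ofReal (n ^ a) * ∫⁻ x, ENNReal.ofReal (ws x ^ p / |x| ^ a) := by
  set G : ℝ → ℝ := Ω.indicator fun x => 1 / d x ^ a with hG
  have hGm : Measurable G := Measurable.indicator (by fun_prop) hΩ
  have hG0 : ∀ x, 0 ≤ G x := by
    intro x; simp only [hG, indicator]; split_ifs with h
    · have := hd0 x h; positivity
    · exact le_rfl
  set Gs : ℝ → ℝ := fun x => n ^ a / |x| ^ a with hGs
  have hGsm : Measurable Gs := by fun_prop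
  have hGs0 : ∀ x, 0 ≤ Gs x := fun x => by positivity
  have hmw := H.mw
  have hmws := H.mws
  have e1 : ∫⁻ x in Ω, ENNReal.ofReal (w x ^ p / d x ^ a) =
      ∫⁻ x, ENNReal.ofReal (w x ^ p) * ENNReal.ofReal (G x) := by
    rw [← lintegral_indicator hΩ]
    refine lintegral_congr fun x => ?_
    by_cases hx : x ∈ Ω
    · rw [indicator_of_mem hx, hG, indicator_of_mem hx,
        ← ENNReal.ofReal_mul (Real.rpow_nonneg (H.w0 x) p), mul_one_div]
    · rw [indicator_of_notMem hx, hG, indicator_of_notMem hx]; simp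
  have e2 : ENNReal.ofReal (n ^ a) * ∫⁻ x, ENNReal.ofReal (ws x ^ p / |x| ^ a) =
      ∫⁻ x, ENNReal.ofReal (ws x ^ p) * ENNReal.ofReal (Gs x) := by
    rw [← lintegral_const_mul _ (by fun_prop)]
    refine lintegral_congr fun x => ?_
    rw [← ENNReal.ofReal_mul (by positivity), ← ENNReal.ofReal_mul (Real.rpow_nonneg (H.ws0 x) p)]
    congr 1; simp only [hGs]; ring
  rw [e1, e2, layer_mul _ _ (by fun_prop) hGm, layer_mul _ _ (by fun_prop) hGsm]
  refine setLIntegral_mono' measurableSet_Ioi fun t (ht : 0 < t) => ?_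
  have hlv : ∀ w : ℝ → ℝ, (∀ x, 0 ≤ w x) → {x | t < w x ^ p} = {x | t ^ (1 / p) < w x} := by
    intro w hw; ext x
    simp only [mem_ofPred_eq]
    rw [← Real.rpow_lt_rpow_iff (by positivity) (hw x) (by linarith : 0 < p),
      ← Real.rpow_mul ht.le, one_div, inv_mul_cancel₀ (by linarith), Real.rpow_one]
  rw [hlv w H.w0, hlv ws H.ws0]
  obtain ⟨α, hα, h1, h2⟩ := H.lev (t ^ (1 / p)) (by positivity)
  rw [h2, lintegral_eq_lintegral_meas_lt _ (ae_of_all _ hG0) hGm.aemeasurable,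
      lintegral_eq_lintegral_meas_lt _ (ae_of_all _ hGs0) hGsm.aemeasurable]
  refine setLIntegral_mono' measurableSet_Ioi fun σ (hσ : 0 < σ) => ?_
  rw [Measure.restrict_apply (measurableSet_lt measurable_const hGm),
    Measure.restrict_apply (measurableSet_lt measurable_const hGsm)]
  set ρ := σ ^ (-1 / a) with hρ
  have hρ0 : 0 < ρ := by positivity
  have u1 : volume ({x | σ < G x} ∩ {x | t ^ (1 / p) < w x}) ≤ ENNReal.ofReal (2 * min α (n * ρ)) := by
    rcases min_cases α (n * ρ) with ⟨h, _⟩ | ⟨h, _⟩ <;> rw [h]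
    · rw [← h1]; exact measure_mono inter_subset_right
    · refine le_trans (measure_mono ?_) (hvol ρ hρ0)
      rintro x ⟨hx, -⟩
      simp only [mem_ofPred_eq, hG, indicator] at hx
      split_ifs at hx with hxΩ
      · exact ⟨hxΩ, (rpow_lev _ _ _ (hd0 x hxΩ) hσ ha).1 hx⟩
      · linarith
  refine u1.trans ?_
  have u2 : volume (Ioo (-min α (n * ρ)) (min α (n * ρ)) \ {0}) = ENNReal.ofReal (2 * min α (n * ρ)) := by
    rw [measure_sdiff_null (by simp), Real.volume_Ioo]; congr 1; ring
  rw [← u2]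
  refine measure_mono ?_
  rintro x ⟨hx, hx0⟩
  have hx' : |x| < min α (n * ρ) := abs_lt.2 hx
  have hxp : 0 < |x| := abs_pos.2 hx0
  refine ⟨?_, abs_lt.1 (lt_of_lt_of_le hx' (min_le_left _ _))⟩
  have h3 : |x| / n < ρ := by
    rw [div_lt_iff₀' hn]; exact lt_of_lt_of_le hx' (min_le_right _ _)
  have h4 := (rpow_lev _ _ _ (by positivity) hσ ha).2 h3
  simp only [mem_ofPred_eq, hGs]
  rw [Real.div_rpow hxp.le hn.le, one_div_div] at h4
  exact h4

noncomputable def gag (p q : ℝ) (u : ℝ → ℝ) : ℝ≥0∞ :=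
  ∫⁻ x, ∫⁻ y, ENNReal.ofReal (|u x - u y| ^ p / |x - y| ^ q)

noncomputable def wgt (p a : ℝ) (u : ℝ → ℝ) : ℝ≥0∞ :=
  ∫⁻ x, ENNReal.ofReal (|u x| ^ p / |x| ^ a)

lemma gag_mink (p q : ℝ) (hp : 1 ≤ p) (u v w : ℝ → ℝ) (hu : Measurable u) (hv : Measurable v)
    (hw : Measurable w)
    (h : ∀ x y, |u x - u y| ≤ |v x - v y| + |w x - w y|) :
    gag p q u ≤ (gag p q v ^ (1 / p) + gag p q w ^ (1 / p)) ^ p := by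
  have hp0 : 0 < p := by linarith
  set F : (ℝ → ℝ) → ℝ × ℝ → ℝ≥0∞ := fun u z =>
    ENNReal.ofReal (|u z.1 - u z.2| / |z.1 - z.2| ^ (q / p)) with hF
  have hFm : ∀ u, Measurable u → Measurable (F u) := by
    intro u hu; simp only [hF]; fun_prop
  have key : ∀ u, Measurable u → gag p q u = ∫⁻ z, F u z ^ p ∂(volume.prod volume) := by
    intro u hu
    rw [lintegral_prod _ ((hFm u hu).pow_const p).aemeasurable]
    unfold gag
    refine lintegral_congr fun x => lintegral_congr fun y => ?_
    simp only [hF]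
    rw [ENNReal.ofReal_rpow_of_nonneg (by positivity) hp0.le, Real.div_rpow (by positivity) (by positivity),
      ← Real.rpow_mul (by positivity), div_mul_cancel₀ _ hp0.ne']
  rw [key u hu, key v hv, key w hw]
  calc _ ≤ ∫⁻ z, (F v + F w) z ^ p ∂(volume.prod volume) := by
        refine lintegral_mono fun z => ?_
        refine ENNReal.rpow_le_rpow ?_ hp0.le
        simp only [hF, Pi.add_apply]
        rw [← ENNReal.ofReal_add (by positivity) (by positivity), ← add_div]
        refine ENNReal.ofReal_le_ofReal ?_
        gcongr
        exact h _ _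
    _ = ((∫⁻ z, (F v + F w) z ^ p ∂(volume.prod volume)) ^ (1 / p)) ^ p := by
        rw [← ENNReal.rpow_mul, one_div, inv_mul_cancel₀ hp0.ne', ENNReal.rpow_one]
    _ ≤ _ := by
        refine ENNReal.rpow_le_rpow ?_ hp0.le
        exact ENNReal.lintegral_Lp_add_le (hFm v hv).aemeasurable (hFm w hw).aemeasurable hp

lemma lint_scale (f : ℝ → ℝ≥0∞) (hf : Measurable f) (c : ℝ) (hc : 0 < c) :
    ∫⁻ x, f (c * x) = ENNReal.ofReal c⁻¹ * ∫⁻ x, f x := by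
  rw [← lintegral_map hf (measurable_const_mul c), Real.map_volume_mul_left hc.ne',
    lintegral_smul_measure, abs_of_pos (by positivity), smul_eq_mul]

lemma gag_scale (p q : ℝ) (z : ℝ → ℝ) (hz : Measurable z) (c M : ℝ) (hc : 0 < c) (hM : 0 ≤ M) :
    gag p q (fun x => M * z (c * x)) = ENNReal.ofReal (M ^ p * c ^ (q - 2)) * gag p q z := by
  unfold gag
  set f : ℝ → ℝ → ℝ≥0∞ := fun x y => ENNReal.ofReal (|z x - z y| ^ p / |x - y| ^ q) with hf
  have hfm : Measurable fun w : ℝ × ℝ => f w.1 w.2 := by simp only [hf]; fun_prop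
  have h1 : ∀ x y, ENNReal.ofReal (|M * z (c * x) - M * z (c * y)| ^ p / |x - y| ^ q) =
      ENNReal.ofReal (M ^ p * c ^ q) * f (c * x) (c * y) := by
    intro x y
    simp only [hf]
    rw [← ENNReal.ofReal_mul (by positivity), ← mul_sub, ← mul_sub, abs_mul, abs_mul,
      abs_of_nonneg hM, abs_of_pos hc, Real.mul_rpow hM (abs_nonneg _),
      Real.mul_rpow hc.le (abs_nonneg _)]
    congr 1
    have : c ^ q ≠ 0 := by positivity
    by_cases h0 : |x - y| ^ q = 0
    · simp [h0]
    · field_simp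
  clear_value f
  simp_rw [h1]
  have h2 : ∀ x, ∫⁻ y, ENNReal.ofReal (M ^ p * c ^ q) * f (c * x) (c * y) =
      ENNReal.ofReal (M ^ p * c ^ q) * (ENNReal.ofReal c⁻¹ * ∫⁻ y, f (c * x) y) := by
    intro x
    have hm1 : Measurable (f (c * x)) := hfm.comp (measurable_const.prodMk measurable_id)
    have hm1c : Measurable fun y => f (c * x) (c * y) := hm1.comp (measurable_const_mul c)
    rw [lintegral_const_mul _ hm1c, lint_scale _ hm1 c hc]
  simp_rw [h2]
  have hm2 : Measurable fun x => ∫⁻ y, f x y := hfm.lintegral_prod_right'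
  rw [lintegral_const_mul, lintegral_const_mul, lint_scale _ hm2 c hc, ← mul_assoc, ← mul_assoc,
    ← ENNReal.ofReal_mul (by positivity), ← ENNReal.ofReal_mul (by positivity)]
  · rw [hf]
    congr 2
    rw [Real.rpow_sub hc, Real.rpow_two]
    field_simp
  · exact hm2.comp (measurable_const_mul c)
  · exact (hm2.comp (measurable_const_mul c)).const_mul _

lemma kernel_fin (p q : ℝ) (hq : 1 < q) (hpq : q < p + 1) :
    ∫⁻ t : ℝ, ENNReal.ofReal (min (|t| ^ p) 1 / |t| ^ q) < ∞ := by
  set f : ℝ → ℝ≥0∞ := fun t => ENNReal.ofReal (min (|t| ^ p) 1 / |t| ^ q) with hf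
  have hfm : Measurable f := by simp only [hf]; fun_prop
  have hpos : ∫⁻ t in Ioi 0, f t < ∞ := by
    have : Ioi (0 : ℝ) = Ioc 0 1 ∪ Ioi 1 := (Ioc_union_Ioi_eq_Ioi zero_le_one).symm
    rw [this]
    refine lt_of_le_of_lt (lintegral_union_le _ _ _) (ENNReal.add_lt_top.2 ⟨?_, ?_⟩)
    · have hi : IntegrableOn (fun t : ℝ => t ^ (p - q)) (Ioc 0 1) :=
        (intervalIntegrable_iff_integrableOn_Ioc_of_le zero_le_one).1
          (intervalIntegral.intervalIntegrable_rpow' (by linarith))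
      refine lt_of_le_of_lt (setLIntegral_mono' measurableSet_Ioc ?_) hi.lintegral_lt_top
      intro t ht
      refine ENNReal.ofReal_le_ofReal ?_
      rw [abs_of_pos ht.1, Real.rpow_sub ht.1]
      have := ht.1
      gcongr
      exact min_le_left _ _
    · have hi : IntegrableOn (fun t : ℝ => t ^ (-q)) (Ioi 1) :=
        integrableOn_Ioi_rpow_of_lt (by linarith) one_pos
      refine lt_of_le_of_lt (setLIntegral_mono' measurableSet_Ioi ?_) hi.lintegral_lt_top
      intro t (ht : 1 < t)
      have ht0 : 0 < t := by linarith
      refine ENNReal.ofReal_le_ofReal ?_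
      rw [abs_of_pos ht0, Real.rpow_neg ht0.le, ← one_div]
      gcongr
      exact min_le_right _ _
  have hneg : ∫⁻ t in Iio 0, f t < ∞ := by
    have h1 : ∫⁻ t in Iio 0, f t = ∫⁻ t, (Ioi (0:ℝ)).indicator f (-t) := by
      rw [← lintegral_indicator measurableSet_Iio]
      refine lintegral_congr fun t => ?_
      by_cases h : t < 0 <;> simp [indicator, h, hf]
    rw [h1, lintegral_neg_eq_self, lintegral_indicator measurableSet_Ioi]
    exact hpos
  rw [← lintegral_add_compl f (measurableSet_Ioi (a := (0 : ℝ)))]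
  refine ENNReal.add_lt_top.2 ⟨hpos, ?_⟩
  rw [compl_Ioi, ← setLIntegral_congr Iio_ae_eq_Iic]
  exact hneg

lemma gag_fin (p q : ℝ) (hp : 1 ≤ p) (hq : 1 < q) (hpq : q < p + 1) (z : ℝ → ℝ)
    (hz : LipschitzWith 1 z) (z0 : ∀ x, 0 ≤ z x) (z1 : ∀ x, z x ≤ 1) (z2 : ∀ x, 2 ≤ |x| → z x = 0) :
    gag p q z < ∞ := by
  set k : ℝ → ℝ≥0∞ := fun t => ENNReal.ofReal (min (|t| ^ p) 1 / |t| ^ q) with hk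
  have hkm : Measurable k := by simp only [hk]; fun_prop
  have hkfin : ∫⁻ t, k t < ∞ := kernel_fin p q hq hpq
  have hb : ∀ x y, ENNReal.ofReal (|z x - z y| ^ p / |x - y| ^ q) ≤
      (Icc (-2 : ℝ) 2).indicator 1 x * k (x - y) + (Icc (-2 : ℝ) 2).indicator 1 y * k (x - y) := by
    intro x y
    have hle : ENNReal.ofReal (|z x - z y| ^ p / |x - y| ^ q) ≤ k (x - y) := by
      refine ENNReal.ofReal_le_ofReal ?_
      gcongr
      refine le_min ?_ ?_
      · exact Real.rpow_le_rpow (abs_nonneg _) (by simpa [Real.dist_eq] using hz.dist_le_mul x y)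
          (by linarith)
      · refine Real.rpow_le_one (abs_nonneg _) ?_ (by linarith)
        rw [abs_le]; constructor <;> linarith [z0 x, z0 y, z1 x, z1 y]
    by_cases hx : x ∈ Icc (-2 : ℝ) 2
    · rw [indicator_of_mem hx]; simp only [Pi.one_apply, one_mul]
      exact hle.trans le_self_add
    by_cases hy : y ∈ Icc (-2 : ℝ) 2
    · rw [indicator_of_mem hy]; simp only [Pi.one_apply, one_mul]
      exact hle.trans le_add_self
    · rw [z2 x (not_lt.1 fun h => hx ⟨(abs_lt.1 h).1.le, (abs_lt.1 h).2.le⟩),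
        z2 y (not_lt.1 fun h => hy ⟨(abs_lt.1 h).1.le, (abs_lt.1 h).2.le⟩)]
      simp [Real.zero_rpow (show p ≠ 0 by linarith)]
  have hI : Measurable ((Icc (-2 : ℝ) 2).indicator (1 : ℝ → ℝ≥0∞)) := meas_ind _ measurableSet_Icc
  have m1 : Measurable fun w : ℝ × ℝ => (Icc (-2 : ℝ) 2).indicator 1 w.1 * k (w.1 - w.2) :=
    (hI.comp measurable_fst).mul (hkm.comp (by fun_prop))
  have m2 : Measurable fun w : ℝ × ℝ => (Icc (-2 : ℝ) 2).indicator 1 w.2 * k (w.1 - w.2) :=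
    (hI.comp measurable_snd).mul (hkm.comp (by fun_prop))
  unfold gag
  refine lt_of_le_of_lt (lintegral_mono fun x => lintegral_mono fun y => hb x y) ?_
  have e : ∀ x, ∫⁻ y, ((Icc (-2 : ℝ) 2).indicator 1 x * k (x - y) +
      (Icc (-2 : ℝ) 2).indicator 1 y * k (x - y)) =
      (∫⁻ y, (Icc (-2 : ℝ) 2).indicator 1 x * k (x - y)) +
      ∫⁻ y, (Icc (-2 : ℝ) 2).indicator 1 y * k (x - y) := by
    intro x
    exact lintegral_add_left (m1.comp (measurable_const.prodMk measurable_id)) _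
  simp_rw [e]
  rw [lintegral_add_left m1.lintegral_prod_right', lintegral_lintegral_swap
    (f := fun x y => (Icc (-2 : ℝ) 2).indicator 1 y * k (x - y)) m2.aemeasurable]
  have i1 : ∀ x, ∫⁻ y, (Icc (-2 : ℝ) 2).indicator 1 x * k (x - y) =
      (Icc (-2 : ℝ) 2).indicator 1 x * ∫⁻ t, k t := by
    intro x
    have hm : Measurable fun y => k (x - y) := hkm.comp (measurable_const.sub measurable_id)
    rw [lintegral_const_mul _ hm, lintegral_sub_left_eq_self k]
  have i2 : ∀ y, ∫⁻ x, (Icc (-2 : ℝ) 2).indicator 1 y * k (x - y) =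
      (Icc (-2 : ℝ) 2).indicator 1 y * ∫⁻ t, k t := by
    intro y
    have hm : Measurable fun x => k (x - y) := hkm.comp (measurable_id.sub measurable_const)
    rw [lintegral_const_mul _ hm, lintegral_sub_right_eq_self k]
  simp_rw [i1, i2]
  rw [lintegral_mul_const _ hI, lintegral_indicator_one measurableSet_Icc, Real.volume_Icc]
  have := ENNReal.mul_lt_top (ENNReal.ofReal_lt_top (r := 2 - -2)) hkfin
  exact ENNReal.add_lt_top.2 ⟨this, this⟩

lemma fatou_h (p a : ℝ) (hp : 1 ≤ p) (h G : ℝ≥0∞) (u : ℝ → ℝ) (un : ℕ → ℝ → ℝ)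
    (hm : ∀ n, Measurable (un n))
    (lim : ∀ x, x ≠ 0 → Tendsto (fun n => un n x) atTop (𝓝 (u x))) (g : ℕ → ℝ≥0∞)
    (hg : Tendsto g atTop (𝓝 G)) (hle : ∀ᶠ n in atTop, h * wgt p a (un n) ≤ g n) :
    h * wgt p a u ≤ G := by
  by_cases h0 : h = 0
  · simp [h0]
  by_cases hG : G = ∞
  · simp [hG]
  rw [mul_comm, ← ENNReal.le_div_iff_mul_le (Or.inl h0) (Or.inr hG)]
  have h1 : wgt p a u ≤ liminf (fun n => wgt p a (un n)) atTop := by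
    unfold wgt
    refine le_trans ?_ (lintegral_liminf_le ?_)
    · refine lintegral_mono_ae ?_
      have : ∀ᵐ x : ℝ, x ≠ 0 := by simp [ae_iff]
      filter_upwards [this] with x hx
      refine le_of_eq (Tendsto.liminf_eq ?_).symm
      refine ENNReal.tendsto_ofReal ?_
      refine Tendsto.div_const ?_ _
      exact (lim x hx).abs.rpow_const (Or.inr (by linarith))
    · intro n
      have := hm n
      fun_prop
  refine h1.trans ?_
  have h2 : Tendsto (fun n => g n / h) atTop (𝓝 (G / h)) :=
    ENNReal.Tendsto.div_const hg (Or.inr h0)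
  rw [← h2.liminf_eq]
  refine liminf_le_liminf ?_
  filter_upwards [hle, hg.eventually_lt_const (lt_top_iff_ne_top.2 hG)] with n hn hn2
  rw [ENNReal.le_div_iff_mul_le (Or.inl h0) (Or.inr hn2.ne), mul_comm]
  exact hn

lemma gag_univ (s p : ℝ) (u : ℝ → ℝ) : gagliardo1 s p Set.univ u = gag p (1 + s * p) u := by
  unfold gagliardo1 gag
  simp only [Measure.restrict_univ]

lemma hardy_smooth (s p : ℝ) (hs : 0 < s) (hp : 1 ≤ p) (u : ℝ → ℝ) (hu : ContDiff ℝ (⊤ : ℕ∞) u)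
    (hc : HasCompactSupport u) (h0 : tsupport u ⊆ {(0 : ℝ)}ᶜ) :
    hardyConst1 s p ({(0 : ℝ)}ᶜ) * wgt p (s * p) u ≤ gag p (1 + s * p) u := by
  have hp0 : 0 < p := by linarith
  set f : ℝ → ℝ := fun x => |u x| ^ p / |x| ^ (s * p) with hf
  have hev : u =ᶠ[𝓝 0] 0 := notMem_tsupport_iff_eventuallyEq.1 fun h => h0 h rfl
  have hfc : Continuous f := by
    rw [continuous_iff_continuousAt]
    intro x
    by_cases hx : x = 0
    · subst hx
      have : f =ᶠ[𝓝 0] fun _ => 0 := by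
        filter_upwards [hev] with y hy
        simp [hf, hy, Real.zero_rpow hp0.ne']
      exact continuousAt_const.congr this.symm
    · refine ContinuousAt.div ?_ ?_ ?_
      · exact (hu.continuous.abs.continuousAt).rpow_const (Or.inr hp0.le)
      · exact (continuous_abs.continuousAt).rpow_const (Or.inr (by positivity))
      · have := abs_pos.2 hx
        positivity
  have hfs : HasCompactSupport f := by
    refine hc.mono fun x hx => ?_
    rw [Function.mem_support] at hx ⊢
    intro h
    exact hx (by simp [hf, h, Real.zero_rpow hp0.ne'])
  have hfi : Integrable f := hfc.integrable_of_hasCompactSupport hfs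
  have hf0 : ∀ x, 0 ≤ f x := fun x => by simp only [hf]; positivity
  have hw : wgt p (s * p) u = ENNReal.ofReal (∫ x, f x) :=
    (ofReal_integral_eq_lintegral_ofReal hfi (Eventually.of_forall hf0)).symm
  rw [hw]
  set I := ∫ x, f x with hI
  rcases (integral_nonneg hf0 : 0 ≤ ∫ x, f x).eq_or_lt with h | h
  · rw [← hI] at h
    rw [← h]; simp
  rw [← hI] at h
  set l : ℝ := I ^ (-1 / p) with hl
  have hl0 : 0 < l := by positivity
  have hlp : l ^ p = I⁻¹ := by
    rw [hl, ← Real.rpow_mul h.le, div_mul_cancel₀ _ hp0.ne', Real.rpow_neg_one]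
  have hle : hardyConst1 s p ({(0 : ℝ)}ᶜ) ≤ gag p (1 + s * p) (fun x => l * u (1 * x)) := by
    refine sInf_le ⟨fun x => l * u (1 * x), ?_, ?_, ?_, ?_, (gag_univ _ _ _).symm⟩
    · simp only [one_mul]
      exact contDiff_const.mul hu
    · simp only [one_mul]
      exact hc.mul_left
    · simp only [one_mul]
      exact (tsupport_mul_subset_right (f := fun _ => l) (g := u)).trans h0
    · have hfr : frontier ({(0 : ℝ)}ᶜ) = {0} := by
        rw [frontier_compl]; simp [frontier]
      rw [hfr, restrict_compl_singleton]
      have : ∀ x, |l * u (1 * x)| ^ p / infDist x {0} ^ (s * p) = I⁻¹ * f x := by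
        intro x
        rw [infDist_singleton, Real.dist_eq, sub_zero, one_mul, abs_mul, abs_of_pos hl0,
          Real.mul_rpow hl0.le (abs_nonneg _), hlp, mul_div_assoc]
      simp_rw [this]
      rw [integral_const_mul, ← hI, inv_mul_cancel₀ h.ne']
  rw [gag_scale p _ u hu.continuous.measurable 1 l one_pos hl0.le, Real.one_rpow, mul_one, hlp] at hle
  calc _ ≤ ENNReal.ofReal I⁻¹ * gag p (1 + s * p) u * ENNReal.ofReal I := by gcongr
    _ = ENNReal.ofReal (I⁻¹ * I) * gag p (1 + s * p) u := by
      rw [ENNReal.ofReal_mul (by positivity)]; ring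
    _ = _ := by rw [inv_mul_cancel₀ h.ne']; simp

lemma swap3n (ν : Measure ℝ) [SFinite ν] (h : ℝ → ℝ → ℝ → ℝ≥0∞)
    (hm : Measurable fun q : ℝ × ℝ × ℝ => h q.1 q.2.1 q.2.2) :
    ∫⁻ x, ∫⁻ y, ∫⁻ t, h x y t ∂ν = ∫⁻ t, (∫⁻ x, ∫⁻ y, h x y t) ∂ν := by
  have h1 : ∀ x, ∫⁻ y, ∫⁻ t, h x y t ∂ν = ∫⁻ t, (∫⁻ y, h x y t) ∂ν := by
    intro x
    refine lintegral_lintegral_swap ?_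
    refine Measurable.aemeasurable ?_
    exact hm.comp (measurable_const.prodMk measurable_id)
  simp_rw [h1]
  refine lintegral_lintegral_swap ?_
  refine Measurable.aemeasurable ?_
  refine Measurable.lintegral_prod_right' (f := fun q : (ℝ × ℝ) × ℝ => h q.1.1 q.2 q.1.2) ?_
  exact hm.comp (f := fun q : (ℝ × ℝ) × ℝ => (q.1.1, q.2, q.1.2)) (by fun_prop)

lemma gag_avg (p q : ℝ) (hp : 1 ≤ p) (v : ℝ → ℝ) (hv : Continuous v) (C : ℝ)
    (hC : ∀ x, |v x| ≤ C) (ν : Measure ℝ) [IsProbabilityMeasure ν] :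
    gag p q (fun x => ∫ t, v (x - t) ∂ν) ≤ gag p q v := by
  have hp0 : 0 < p := by linarith
  have hvi : ∀ x, Integrable (fun t => v (x - t)) ν := fun x =>
    Integrable.of_bound (by fun_prop) C (Eventually.of_forall fun t => by
      simpa using hC (x - t))
  have hb : ∀ x y, |v x - v y| ≤ 2 * C := fun x y => by
    have := abs_sub (v x) (v y)
    linarith [hC x, hC y]
  have hC0 : 0 ≤ C := (abs_nonneg _).trans (hC 0)
  have hpt : ∀ x y, ENNReal.ofReal (|(∫ t, v (x - t) ∂ν) - ∫ t, v (y - t) ∂ν| ^ p / |x - y| ^ q) ≤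
      ∫⁻ t, ENNReal.ofReal (|v (x - t) - v (y - t)| ^ p / |x - y| ^ q) ∂ν := by
    intro x y
    have hcont : Continuous fun t => |v (x - t) - v (y - t)| := by fun_prop
    have i1 : Integrable (fun t => |v (x - t) - v (y - t)|) ν :=
      ((hvi x).sub (hvi y)).abs
    have i2 : Integrable (fun t => |v (x - t) - v (y - t)| ^ p) ν := by
      refine Integrable.of_bound ?_ ((2 * C) ^ p) (Eventually.of_forall fun t => ?_)
      · exact (hcont.rpow_const fun _ => Or.inr hp0.le).aestronglyMeasurable
      · rw [Real.norm_of_nonneg (by positivity)]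
        exact Real.rpow_le_rpow (abs_nonneg _) (hb _ _) hp0.le
    have j : (∫ t, |v (x - t) - v (y - t)| ∂ν) ^ p ≤ ∫ t, |v (x - t) - v (y - t)| ^ p ∂ν :=
      (convexOn_rpow hp).map_integral_le
        (continuousOn_id.rpow_const fun _ _ => Or.inr hp0.le) isClosed_Ici
        (Eventually.of_forall fun t => mem_Ici.2 (abs_nonneg _)) i1 i2
    rw [← ofReal_integral_eq_lintegral_ofReal (i2.div_const _)
      (Eventually.of_forall fun t => by positivity), integral_div]
    refine ENNReal.ofReal_le_ofReal ?_
    refine div_le_div_of_nonneg_right (le_trans ?_ j) (by positivity)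
    refine Real.rpow_le_rpow (abs_nonneg _) ?_ hp0.le
    rw [← integral_sub (hvi x) (hvi y)]
    exact abs_integral_le_integral_abs
  calc gag p q (fun x => ∫ t, v (x - t) ∂ν)
      ≤ ∫⁻ x, ∫⁻ y, ∫⁻ t, ENNReal.ofReal (|v (x - t) - v (y - t)| ^ p / |x - y| ^ q) ∂ν :=
        lintegral_mono fun x => lintegral_mono fun y => hpt x y
    _ = ∫⁻ t, (∫⁻ x, ∫⁻ y, ENNReal.ofReal (|v (x - t) - v (y - t)| ^ p / |x - y| ^ q)) ∂ν := by
        refine swap3n ν (fun x y t => ENNReal.ofReal (|v (x - t) - v (y - t)| ^ p / |x - y| ^ q)) ?_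
        have := hv.measurable
        fun_prop
    _ = ∫⁻ t, gag p q v ∂ν := by
        refine lintegral_congr fun t => ?_
        unfold gag
        symm
        rw [← lintegral_sub_right_eq_self _ t]
        refine lintegral_congr fun x => ?_
        rw [← lintegral_sub_right_eq_self _ t]
        refine lintegral_congr fun y => ?_
        rw [sub_sub_sub_cancel_right]
    _ = gag p q v := by simp

lemma hardy_cont (s p : ℝ) (hs : 0 < s) (hp : 1 ≤ p) (v : ℝ → ℝ) (hv : Continuous v)
    (hc : HasCompactSupport v) (h0 : tsupport v ⊆ {(0 : ℝ)}ᶜ) :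
    hardyConst1 s p ({(0 : ℝ)}ᶜ) * wgt p (s * p) v ≤ gag p (1 + s * p) v := by
  obtain ⟨C, hC⟩ := hc.exists_bound_of_continuous hv
  have hev : v =ᶠ[𝓝 0] 0 := notMem_tsupport_iff_eventuallyEq.1 fun h => h0 h rfl
  obtain ⟨ε, hε, hball⟩ := Metric.eventually_nhds_iff_ball.1 hev
  have hr : ∀ n : ℕ, (0 : ℝ) < 1 / ((n : ℝ) + 1) := fun n => by positivity
  let φ : ℕ → ContDiffBump (0 : ℝ) := fun n =>
    ⟨1 / ((n : ℝ) + 1) / 2, 1 / ((n : ℝ) + 1), half_pos (hr n), half_lt_self (hr n)⟩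
  have hrout : Tendsto (fun n => (φ n).rOut) atTop (𝓝 0) := tendsto_one_div_add_atTop_nhds_zero_nat
  let V : ℕ → ℝ → ℝ := fun n =>
    convolution ((φ n).normed volume) v (ContinuousLinearMap.lsmul ℝ ℝ) volume
  have hVd : ∀ n, ContDiff ℝ (⊤ : ℕ∞) (V n) := fun n =>
    (φ n).hasCompactSupport_normed.contDiff_convolution_left _ (φ n).contDiff_normed
      hv.locallyIntegrable
  have hVc : ∀ n, HasCompactSupport (V n) := fun n =>
    HasCompactSupport.convolution _ (φ n).hasCompactSupport_normed hc
  have hVg : ∀ n, gag p (1 + s * p) (V n) ≤ gag p (1 + s * p) v := by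
    intro n
    set ρ : ℝ → ℝ := (φ n).normed volume with hρ
    have ρ0 : ∀ t, 0 ≤ ρ t := (φ n).nonneg_normed
    have ρi : Integrable ρ := (φ n).integrable_normed
    have ρ1 : ∫ t, ρ t = 1 := (φ n).integral_normed
    have ρm : Measurable ρ := (φ n).continuous_normed.measurable
    let ν : Measure ℝ := volume.withDensity fun t => ((ρ t).toNNReal : ℝ≥0∞)
    have : IsProbabilityMeasure ν := by
      refine ⟨?_⟩
      rw [withDensity_apply _ MeasurableSet.univ, Measure.restrict_univ]
      have := ofReal_integral_eq_lintegral_ofReal ρi (Eventually.of_forall ρ0)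
      rw [ρ1] at this
      simpa [ENNReal.ofReal] using this.symm
    have hV : V n = fun x => ∫ t, v (x - t) ∂ν := by
      funext x
      rw [integral_withDensity_eq_integral_smul ρm.real_toNNReal]
      simp only [V]
      rw [convolution_def]
      refine integral_congr_ae (Eventually.of_forall fun t => ?_)
      simp [NNReal.smul_def, Real.coe_toNNReal _ (ρ0 t), ← hρ]
    rw [hV]
    exact gag_avg p _ hp v hv C hC ν
  refine fatou_h p (s * p) hp _ _ v V (fun n => (hVd n).continuous.measurable) ?_
    (fun _ => gag p (1 + s * p) v) tendsto_const_nhds ?_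
  · intro x _
    exact ContDiffBump.convolution_tendsto_right_of_continuous hrout hv x
  · filter_upwards [hrout.eventually_lt_const (half_pos hε)] with n hn
    refine le_trans ?_ (hVg n)
    refine hardy_smooth s p hs hp (V n) (hVd n) (hVc n) ?_
    rw [subset_compl_singleton_iff, notMem_tsupport_iff_eventuallyEq]
    filter_upwards [ball_mem_nhds (0 : ℝ) (half_pos hε)] with x hx
    have hx' : |x| < ε / 2 := by simpa using hx
    have hvx : ∀ y ∈ ball x (φ n).rOut, v y = v x := by
      intro y hy
      have hy' : |y - x| < ε / 2 := by
        have := mem_ball.1 hy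
        rw [Real.dist_eq] at this
        linarith
      rw [hball y, hball x]
      · rfl
      · rw [mem_ball, dist_zero_right, Real.norm_eq_abs]; linarith
      · rw [mem_ball, dist_zero_right, Real.norm_eq_abs]
        have := abs_add_le (y - x) x
        rw [sub_add_cancel] at this
        linarith
    have := (φ n).normed_convolution_eq_right (μ := volume) hvx
    simp only [V]
    rw [this, hball x]
    rw [mem_ball, dist_zero_right, Real.norm_eq_abs]; linarith

lemma hardy_nonneg (s p : ℝ) (hs : s ∈ Ioo (0 : ℝ) 1) (hp : 1 ≤ p) (hsp : s * p < 1) (v : ℝ → ℝ)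
    (hv : Continuous v) (hc : HasCompactSupport v) (v0 : ∀ x, 0 ≤ v x) :
    hardyConst1 s p ({(0 : ℝ)}ᶜ) * wgt p (s * p) v ≤ gag p (1 + s * p) v := by
  have hp0 : 0 < p := by linarith
  obtain ⟨M, hM⟩ := hc.exists_bound_of_continuous hv
  have hM0 : 0 ≤ M := (norm_nonneg _).trans (hM 0)
  have hvM : ∀ x, v x ≤ M := fun x => (le_abs_self _).trans (hM x)
  set z : ℝ → ℝ := fun x => max 0 (min 1 (2 - |x|)) with hz
  have hzc : Continuous z := by simp only [hz]; fun_prop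
  have hz0 : ∀ x, 0 ≤ z x := fun x => le_max_left _ _
  have hz1 : ∀ x, z x ≤ 1 := fun x => max_le zero_le_one (min_le_left _ _)
  have hz2 : ∀ x, 2 ≤ |x| → z x = 0 := fun x hx =>
    max_eq_left ((min_le_right _ _).trans (by linarith))
  have hz3 : ∀ x, |x| ≤ 1 → z x = 1 := fun x hx => by
    simp only [hz]
    rw [min_eq_left (by linarith), max_eq_right zero_le_one]
  have hzl : LipschitzWith 1 z := by
    refine LipschitzWith.of_dist_le_mul fun x y => ?_
    rw [Real.dist_eq, Real.dist_eq, NNReal.coe_one, one_mul]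
    have h1 : |z x - z y| ≤ |min 1 (2 - |x|) - min 1 (2 - |y|)| := by
      have := abs_max_sub_max_le_max 0 (min 1 (2 - |x|)) 0 (min 1 (2 - |y|))
      simpa using this
    have h2 : |min 1 (2 - |x|) - min 1 (2 - |y|)| ≤ |(2 - |x|) - (2 - |y|)| := by
      have := abs_min_sub_min_le_max 1 (2 - |x|) 1 (2 - |y|)
      simpa using this
    have h3 : |(2 - |x|) - (2 - |y|)| ≤ |x - y| := by
      rw [sub_sub_sub_cancel_left, abs_sub_comm x y]
      exact abs_abs_sub_abs_le _ _
    linarith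
  have hspp : 0 < s * p := mul_pos hs.1 hp0
  have hfin : gag p (1 + s * p) z < ∞ :=
    gag_fin p _ hp (by linarith) (by nlinarith [hs.2]) z hzl hz0 hz1 hz2
  let zn : ℕ → ℝ → ℝ := fun n x => M * z (((n : ℝ) + 1) * x)
  let V : ℕ → ℝ → ℝ := fun n x => max (v x - zn n x) 0
  have hznc : ∀ n, Continuous (zn n) := fun n => by simp only [zn]; fun_prop
  have hVc : ∀ n, Continuous (V n) := fun n => (hv.sub (hznc n)).max continuous_const
  have hzn0 : ∀ n x, 0 ≤ zn n x := fun n x => mul_nonneg hM0 (hz0 _)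
  have hVs : ∀ n, HasCompactSupport (V n) := fun n => by
    refine hc.mono fun x hx => ?_
    rw [Function.mem_support] at hx ⊢
    intro h
    refine hx (max_eq_right ?_)
    rw [h]; linarith [hzn0 n x]
  have hV0 : ∀ n, tsupport (V n) ⊆ {(0 : ℝ)}ᶜ := fun n => by
    rw [subset_compl_singleton_iff, notMem_tsupport_iff_eventuallyEq]
    have hr : (0 : ℝ) < 1 / ((n : ℝ) + 1) := by positivity
    filter_upwards [ball_mem_nhds (0 : ℝ) hr] with x hx
    have hx' : |x| < 1 / ((n : ℝ) + 1) := by simpa using hx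
    have hn1 : (0 : ℝ) < (n : ℝ) + 1 := by positivity
    have : |((n : ℝ) + 1) * x| ≤ 1 := by
      rw [abs_mul, abs_of_pos hn1]
      rw [lt_div_iff₀ hn1] at hx'
      linarith
    refine max_eq_right ?_
    simp only [zn]
    rw [hz3 _ this]
    linarith [hvM x]
  have hVg : ∀ n, gag p (1 + s * p) (V n) ≤
      (gag p (1 + s * p) v ^ (1 / p) + gag p (1 + s * p) (zn n) ^ (1 / p)) ^ p := by
    intro n
    refine gag_mink p _ hp _ _ _ (hVc n).measurable hv.measurable (hznc n).measurable ?_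
    intro x y
    have h1 : |V n x - V n y| ≤ |(v x - zn n x) - (v y - zn n y)| :=
      abs_max_sub_max_le_abs _ _ _
    have h2 : (v x - zn n x) - (v y - zn n y) = (v x - v y) - (zn n x - zn n y) := by ring
    rw [h2] at h1
    exact h1.trans (abs_sub _ _)
  have hgz : Tendsto (fun n => gag p (1 + s * p) (zn n)) atTop (𝓝 0) := by
    have e : ∀ n, gag p (1 + s * p) (zn n) =
        ENNReal.ofReal (M ^ p * ((n : ℝ) + 1) ^ (1 + s * p - 2)) * gag p (1 + s * p) z := fun n =>
      gag_scale p _ z hzc.measurable _ M (by positivity) hM0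
    simp_rw [e]
    have t1 : Tendsto (fun n : ℕ => ((n : ℝ) + 1) ^ (1 + s * p - 2)) atTop (𝓝 0) := by
      have h1 : Tendsto (fun n : ℕ => (n : ℝ) + 1) atTop atTop :=
        tendsto_natCast_atTop_atTop.atTop_add tendsto_const_nhds
      have h2 := (tendsto_rpow_neg_atTop (y := 1 - s * p) (by linarith)).comp h1
      refine h2.congr fun n => ?_
      simp only [Function.comp]
      congr 1; ring
    have t2 := ENNReal.tendsto_ofReal (t1.const_mul (M ^ p))
    have t3 := ENNReal.Tendsto.mul_const t2 (Or.inr hfin.ne)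
    simpa using t3
  refine fatou_h p (s * p) hp _ _ v V (fun n => (hVc n).measurable) ?_
    (fun n => (gag p (1 + s * p) v ^ (1 / p) + gag p (1 + s * p) (zn n) ^ (1 / p)) ^ p) ?_
    (Eventually.of_forall fun n => (hardy_cont s p hs.1 hp (V n) (hVc n) (hVs n) (hV0 n)).trans
      (hVg n))
  · intro x hx
    have h1 : Tendsto (fun n : ℕ => ((n : ℝ) + 1) * |x|) atTop atTop :=
      (tendsto_natCast_atTop_atTop.atTop_add tendsto_const_nhds).atTop_mul_const (abs_pos.2 hx)
    refine tendsto_const_nhds.congr' ?_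
    filter_upwards [h1.eventually_ge_atTop 2] with n hn
    have : 2 ≤ |((n : ℝ) + 1) * x| := by
      rw [abs_mul, abs_of_pos (by positivity : (0 : ℝ) < (n : ℝ) + 1)]; exact hn
    simp only [V, zn]
    rw [hz2 _ this, mul_zero, sub_zero, max_eq_left (v0 x)]
  · have c1 : Tendsto (fun n => gag p (1 + s * p) (zn n) ^ (1 / p)) atTop (𝓝 (0 ^ (1 / p))) :=
      (ENNReal.continuous_rpow_const.tendsto 0).comp hgz
    rw [ENNReal.zero_rpow_of_pos (by positivity)] at c1
    have c2 := (tendsto_const_nhds (x := gag p (1 + s * p) v ^ (1 / p))).add c1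
    have c3 := ((ENNReal.continuous_rpow_const (y := p)).tendsto _).comp c2
    rw [add_zero, ← ENNReal.rpow_mul, one_div, inv_mul_cancel₀ hp0.ne', ENNReal.rpow_one] at c3
    simpa [Function.comp_def] using c3

/-- if `Ω ⊊ ℝ` is the union of `n` nonempty pairwise disjoint bounded open
intervals of equal length, then `𝔥_{s,p}(Ω) ≥ 𝔥_{s,p}(ℝ∖{0})/n^{sp}` whenever `sp < 1`. -/
theorem hardy_equal_intervals (n : ℕ) (hn : 0 < n) (a b : Fin n → ℝ) (hab : ∀ i, a i < b i)
    (hdisj : Pairwise fun i j => Disjoint (Set.Ioo (a i) (b i)) (Set.Ioo (a j) (b j)))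
    (hlen : ∀ i j, b i - a i = b j - a j)
    (s p : ℝ) (hs : s ∈ Set.Ioo (0 : ℝ) 1) (hp : 1 ≤ p) (hsp : s * p < 1) :
    hardyConst1 s p ({(0 : ℝ)}ᶜ) / ENNReal.ofReal ((n : ℝ) ^ (s * p)) ≤
      hardyConst1 s p (⋃ i, Set.Ioo (a i) (b i)) := by
  have hp0 : 0 < p := by linarith
  have hspp : 0 < s * p := mul_pos hs.1 hp0
  have hn0 : (0 : ℝ) < n := by exact_mod_cast hn
  set Ω : Set ℝ := ⋃ i, Set.Ioo (a i) (b i) with hΩ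
  have hΩo : IsOpen Ω := isOpen_iUnion fun i => isOpen_Ioo
  have hsub : ∀ i, Ioo (a i) (b i) ⊆ Ω := fun i => subset_iUnion (fun i => Ioo (a i) (b i)) i
  have hfne : (frontier Ω).Nonempty := by
    rw [nonempty_frontier_iff]
    constructor
    · refine ⟨(a ⟨0, hn⟩ + b ⟨0, hn⟩) / 2, hsub ⟨0, hn⟩ ⟨?_, ?_⟩⟩ <;> linarith [hab ⟨0, hn⟩]
    · intro h
      have hbd : Bornology.IsBounded Ω := by
        rw [hΩ, Bornology.isBounded_iUnion]
        exact fun i => isBounded_Ioo _ _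
      rw [h] at hbd
      exact NormedSpace.unbounded_univ ℝ ℝ hbd
  set d : ℝ → ℝ := fun x => infDist x (frontier Ω) with hd
  have hdle : ∀ i, ∀ x ∈ Ioo (a i) (b i), min (x - a i) (b i - x) ≤ d x := by
    intro i x hx
    refine (le_infDist hfne).2 fun y hy => ?_
    have hyΩ : y ∉ Ioo (a i) (b i) := fun h => by
      have := hΩo.inter_frontier_eq
      exact (this ▸ (⟨hsub i h, hy⟩ : y ∈ Ω ∩ frontier Ω) : y ∈ (∅ : Set ℝ))
    rw [Real.dist_eq]
    by_cases h : a i < y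
    · have h2 : b i ≤ y := not_lt.1 fun h' => hyΩ ⟨h, h'⟩
      refine (min_le_right _ _).trans ?_
      rw [abs_sub_comm]
      exact le_trans (by linarith) (le_abs_self _)
    · refine (min_le_left _ _).trans ?_
      exact le_trans (by linarith) (le_abs_self _)
  have hd0 : ∀ x ∈ Ω, 0 < d x := by
    intro x hx
    obtain ⟨i, hi⟩ := mem_iUnion.1 hx
    exact lt_of_lt_of_le (lt_min (by linarith [hi.1]) (by linarith [hi.2])) (hdle i x hi)
  have hvol : ∀ ρ : ℝ, 0 < ρ → volume (Ω ∩ {x | d x < ρ}) ≤ ENNReal.ofReal (2 * (n * ρ)) := by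
    intro ρ hρ
    have hs1 : Ω ∩ {x | d x < ρ} ⊆ ⋃ i, (Ioo (a i) (a i + ρ) ∪ Ioo (b i - ρ) (b i)) := by
      rintro x ⟨hx, hx2⟩
      obtain ⟨i, hi⟩ := mem_iUnion.1 hx
      refine mem_iUnion.2 ⟨i, ?_⟩
      rcases min_lt_iff.1 (lt_of_le_of_lt (hdle i x hi) hx2) with h | h
      · exact Or.inl ⟨hi.1, by linarith⟩
      · exact Or.inr ⟨by linarith, hi.2⟩
    calc volume (Ω ∩ {x | d x < ρ}) ≤ _ := measure_mono hs1
      _ ≤ ∑ i : Fin n, volume (Ioo (a i) (a i + ρ) ∪ Ioo (b i - ρ) (b i)) :=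
        measure_iUnion_fintype_le _ _
      _ ≤ ∑ i : Fin n, ENNReal.ofReal (2 * ρ) := by
        refine Finset.sum_le_sum fun i _ => (measure_union_le _ _).trans ?_
        rw [Real.volume_Ioo, Real.volume_Ioo, ← ENNReal.ofReal_add (by linarith) (by linarith)]
        exact ENNReal.ofReal_le_ofReal (by linarith)
      _ = ENNReal.ofReal (2 * (n * ρ)) := by
        rw [Finset.sum_const, Finset.card_univ, Fintype.card_fin, nsmul_eq_mul,
          ← ENNReal.ofReal_natCast, ← ENNReal.ofReal_mul hn0.le]
        congr 1; ring
  refine le_sInf ?_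
  rintro c ⟨u, hu, hc, hsupp, hint, rfl⟩
  rw [gag_univ]
  obtain ⟨K, hK⟩ := ContDiff.lipschitzWith_of_hasCompactSupport hc hu (by simp)
  set w : ℝ → ℝ := fun x => |u x| with hw
  have hwl : LipschitzWith (K + 1) w := by
    refine LipschitzWith.of_dist_le_mul fun x y => ?_
    have h1 := hK.dist_le_mul x y
    rw [Real.dist_eq] at h1 ⊢
    refine (abs_abs_sub_abs_le _ _).trans (h1.trans ?_)
    gcongr
    simp
  obtain ⟨N, hN⟩ : ∃ N : ℝ, ∀ x, N ≤ |x| → w x = 0 := by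
    obtain ⟨R, hR⟩ := hc.isCompact.isBounded.subset_closedBall (0 : ℝ)
    refine ⟨R + 1, fun x hx => ?_⟩
    have : x ∉ tsupport u := fun h => by
      have := hR h
      rw [mem_closedBall, dist_zero_right, Real.norm_eq_abs] at this
      linarith
    simp [hw, image_eq_zero_of_notMem_tsupport this]
  obtain ⟨ws, H, hwsl, hwsc⟩ := rearr_exists w (K + 1) (by positivity) hwl
    (fun x => abs_nonneg _) N hN
  have hone : ∫⁻ x in Ω, ENNReal.ofReal (w x ^ p / d x ^ (s * p)) = 1 := by
    have hi : Integrable (fun x => w x ^ p / d x ^ (s * p)) (volume.restrict Ω) :=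
      not_imp_comm.1 integral_undef (by rw [hint]; exact one_ne_zero)
    rw [← ofReal_integral_eq_lintegral_ofReal hi (Eventually.of_forall fun x => ?_)]
    · rw [hint, ENNReal.ofReal_one]
    · have : 0 ≤ d x := infDist_nonneg
      have : 0 ≤ w x := abs_nonneg _
      simp only [Pi.zero_apply]
      positivity
  have hwt := weight w ws H p (s * p) n hp hspp hn0 Ω hΩo.measurableSet d
    (measurable_infDist) hd0 hvol
  rw [hone] at hwt
  have hwt' : ∫⁻ x, ENNReal.ofReal (ws x ^ p / |x| ^ (s * p)) = wgt p (s * p) ws := by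
    unfold wgt
    refine lintegral_congr fun x => ?_
    rw [abs_of_nonneg (H.ws0 x)]
  rw [hwt'] at hwt
  have hh := hardy_nonneg s p hs hp hsp ws hwsl.continuous hwsc H.ws0
  have hpol : gag p (1 + s * p) ws ≤ gag p (1 + s * p) w := polya w ws H p _ hp (by linarith)
  have habs : gag p (1 + s * p) w ≤ gag p (1 + s * p) u := by
    refine lintegral_mono fun x => lintegral_mono fun y => ENNReal.ofReal_le_ofReal ?_
    refine div_le_div_of_nonneg_right ?_ (by positivity)
    exact Real.rpow_le_rpow (abs_nonneg _) (abs_abs_sub_abs_le _ _) hp0.le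
  refine le_trans ?_ (hh.trans (hpol.trans habs))
  have hn1 : ENNReal.ofReal ((n : ℝ) ^ (s * p)) ≠ 0 := by
    rw [ne_eq, ENNReal.ofReal_eq_zero, not_le]; positivity
  rw [ENNReal.div_le_iff hn1 ENNReal.ofReal_ne_top]
  calc hardyConst1 s p ({(0 : ℝ)}ᶜ) = hardyConst1 s p ({(0 : ℝ)}ᶜ) * 1 := (mul_one _).symm
    _ ≤ hardyConst1 s p ({(0 : ℝ)}ᶜ) *
        (ENNReal.ofReal ((n : ℝ) ^ (s * p)) * wgt p (s * p) ws) := by gcongr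
    _ = _ := by ring
end

section
/- For every R ≥ 1, every s ∈ (0,1) and p ∈ [1,∞) with sp < 1, the sharp fractional Hardy constant of Ω = (−R,R)∖ℤ satisfies 𝔥_{s,p}((−R,R)∖ℤ) ≤ (R^{1−sp}/⌊R⌋)·4^{1−sp}/(sp), where ⌊R⌋ denotes the integer part of R. -/
open MeasureTheory Metric Set Filter
open scoped ENNReal NNReal

lemma hz_step (g : ℝ → ℝ) (hg : Monotone g) (hc : Continuous g) (A B : ℝ) (hAB : A ≤ B)
    (h0 : ∀ x ≤ A, g x = 0) (h1 : ∀ x, B ≤ x → g x = 1) (h : ℝ) (hh : 0 ≤ h) :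
    ∫⁻ x, ENNReal.ofReal |g (x + h) - g x| ≤ ENNReal.ofReal h := by
  have hpos : ∀ x, 0 ≤ g (x + h) - g x := fun x => sub_nonneg.2 (hg (by linarith))
  have e1 : ∫⁻ x, ENNReal.ofReal |g (x + h) - g x| =
      ∫⁻ x in Ioc (A - h) B, ENNReal.ofReal (g (x + h) - g x) := by
    rw [← lintegral_indicator measurableSet_Ioc]
    congr 1; ext x
    by_cases hx : x ∈ Ioc (A - h) B
    · rw [indicator_of_mem hx, abs_of_nonneg (hpos x)]
    · rw [indicator_of_notMem hx]
      rw [mem_Ioc, not_and_or, not_lt, not_le] at hx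
      rcases hx with hx | hx
      · rw [h0 x (by linarith), h0 (x + h) (by linarith)]; simp
      · rw [h1 x (by linarith), h1 (x + h) (by linarith)]; simp
  have hcont : Continuous fun x => g (x + h) - g x := by fun_prop
  rw [e1, ← ofReal_integral_eq_lintegral_ofReal]
  · apply ENNReal.ofReal_le_ofReal
    rw [← intervalIntegral.integral_of_le (by linarith),
      intervalIntegral.integral_sub, intervalIntegral.integral_comp_add_right]
    · have i : ∀ a b, IntervalIntegrable g volume a b := fun a b => hc.intervalIntegrable a b
      have a1 := intervalIntegral.integral_add_adjacent_intervals (i A B) (i B (B + h))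
      have a2 := intervalIntegral.integral_add_adjacent_intervals (i (A - h) A) (i A B)
      have a3 : ∫ x in B..(B + h), g x = ∫ x in B..(B + h), (1:ℝ) := by
        apply intervalIntegral.integral_congr
        intro x hx
        rw [uIcc_of_le (by linarith)] at hx
        exact h1 x hx.1
      have a4 : ∫ x in (A - h)..A, g x = ∫ x in (A - h)..A, (0:ℝ) := by
        apply intervalIntegral.integral_congr
        intro x hx
        rw [uIcc_of_le (by linarith)] at hx
        exact h0 x hx.2
      simp at a3 a4
      rw [sub_add_cancel]
      linarith
    · exact (by fun_prop : Continuous fun x => g (x + h)).intervalIntegrable _ _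
    · exact hc.intervalIntegrable _ _
  · exact (hcont.integrableOn_Icc).mono_set Ioc_subset_Icc_self
  · exact Eventually.of_forall hpos

lemma hz_step' (g : ℝ → ℝ) (hg : Monotone g) (hc : Continuous g) (A B : ℝ) (hAB : A ≤ B)
    (h0 : ∀ x ≤ A, g x = 0) (h1 : ∀ x, B ≤ x → g x = 1) (h : ℝ) :
    ∫⁻ x, ENNReal.ofReal |g (x + h) - g x| ≤ ENNReal.ofReal |h| := by
  rcases le_total 0 h with hh | hh
  · rw [abs_of_nonneg hh]; exact hz_step g hg hc A B hAB h0 h1 h hh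
  · rw [abs_of_nonpos hh]
    refine le_trans (le_of_eq ?_) (hz_step g hg hc A B hAB h0 h1 (-h) (by linarith))
    rw [← lintegral_add_right_eq_self _ (-h)]
    congr 1; ext x
    rw [abs_sub_comm]; simp

lemma hz_kernel1 (a ℓ : ℝ) (ha : 0 < a) (ha1 : a < 1) (hl : 0 < ℓ) :
    ∫⁻ h in Ioi (0:ℝ), ENNReal.ofReal (min (2 * |h|) (2 * ℓ) / |h| ^ (1 + a)) ≤
      ENNReal.ofReal (2 * ℓ ^ (1 - a) / (a * (1 - a))) := by
  rw [← Ioc_union_Ioi_eq_Ioi hl.le, lintegral_union measurableSet_Ioi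
    (Set.Ioc_disjoint_Ioi le_rfl)]
  have b1 : ∫⁻ h in Ioc 0 ℓ, ENNReal.ofReal (min (2 * |h|) (2 * ℓ) / |h| ^ (1 + a)) ≤
      ENNReal.ofReal (2 * (ℓ ^ (1 - a) / (1 - a))) := by
    have : ∫⁻ h in Ioc 0 ℓ, ENNReal.ofReal (min (2 * |h|) (2 * ℓ) / |h| ^ (1 + a)) ≤
        ∫⁻ h in Ioc 0 ℓ, ENNReal.ofReal (2 * h ^ (-a)) := by
      apply setLIntegral_mono' measurableSet_Ioc
      intro x hx
      apply ENNReal.ofReal_le_ofReal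
      rw [abs_of_pos hx.1, div_le_iff₀ (Real.rpow_pos_of_pos hx.1 _), mul_assoc,
        ← Real.rpow_add hx.1]
      simp
    refine this.trans ?_
    have hi : IntervalIntegrable (fun x : ℝ => 2 * x ^ (-a)) volume 0 ℓ :=
      (intervalIntegral.intervalIntegrable_rpow' (by linarith)).const_mul 2
    rw [← ofReal_integral_eq_lintegral_ofReal]
    · rw [← intervalIntegral.integral_of_le hl.le, intervalIntegral.integral_const_mul,
        integral_rpow (Or.inl (by linarith)), Real.zero_rpow (by linarith)]
      apply le_of_eq; congr 3
      · rw [sub_zero]; congr 1; ring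
      · ring
    · exact (intervalIntegrable_iff_integrableOn_Ioc_of_le hl.le).1 hi
    · rw [EventuallyLE, ae_restrict_iff' measurableSet_Ioc]
      refine Eventually.of_forall fun x hx => ?_
      have := Real.rpow_nonneg hx.1.le (-a)
      simp only [Pi.zero_apply]; positivity
  have b2 : ∫⁻ h in Ioi ℓ, ENNReal.ofReal (min (2 * |h|) (2 * ℓ) / |h| ^ (1 + a)) ≤
      ENNReal.ofReal (2 * (ℓ ^ (1 - a) / a)) := by
    have : ∫⁻ h in Ioi ℓ, ENNReal.ofReal (min (2 * |h|) (2 * ℓ) / |h| ^ (1 + a)) ≤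
        ∫⁻ h in Ioi ℓ, ENNReal.ofReal (2 * ℓ * h ^ (-1 - a)) := by
      apply setLIntegral_mono' measurableSet_Ioi
      intro x hx
      have hx0 : 0 < x := hl.trans hx
      apply ENNReal.ofReal_le_ofReal
      rw [abs_of_pos hx0, div_le_iff₀ (Real.rpow_pos_of_pos hx0 _), mul_assoc,
        ← Real.rpow_add hx0]
      simp
    refine this.trans ?_
    rw [← ofReal_integral_eq_lintegral_ofReal]
    · rw [integral_const_mul, integral_Ioi_rpow_of_lt (by linarith) hl]
      apply le_of_eq; congr 1
      have : ℓ ^ (1 - a) = ℓ * ℓ ^ (-1 - a + 1) := by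
        rw [← Real.rpow_one_add' hl.le (by linarith)]; congr 1; ring
      rw [this]
      have : -1 - a + 1 = - a := by ring
      rw [this]; field_simp
    · exact (integrableOn_Ioi_rpow_of_lt (by linarith) hl).const_mul _
    · rw [EventuallyLE, ae_restrict_iff' measurableSet_Ioi]
      refine Eventually.of_forall fun x hx => ?_
      have := Real.rpow_nonneg (hl.trans hx).le (-1 - a)
      simp only [Pi.zero_apply]; positivity
  refine (add_le_add b1 b2).trans ?_
  have h1a : 0 < 1 - a := by linarith
  rw [← ENNReal.ofReal_add (by positivity) (by positivity)]
  apply le_of_eq; congr 1; field_simp; ring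

lemma hz_kernel2 (a ℓ : ℝ) (ha : 0 < a) (ha1 : a < 1) (hl : 0 < ℓ) :
    ∫⁻ h, ENNReal.ofReal (min (2 * |h|) (2 * ℓ) / |h| ^ (1 + a)) ≤
      ENNReal.ofReal (4 * ℓ ^ (1 - a) / (a * (1 - a))) := by
  have h1 := hz_kernel1 a ℓ ha ha1 hl
  have h2 : ∫⁻ h in Iio (0:ℝ), ENNReal.ofReal (min (2 * |h|) (2 * ℓ) / |h| ^ (1 + a)) =
      ∫⁻ h in Ioi (0:ℝ), ENNReal.ofReal (min (2 * |h|) (2 * ℓ) / |h| ^ (1 + a)) := by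
    rw [← lintegral_indicator measurableSet_Iio, ← lintegral_indicator measurableSet_Ioi,
      ← lintegral_neg_eq_self]
    congr 1; ext x
    simp [indicator]
  rw [← setLIntegral_univ, ← Iic_union_Ioi (a := (0:ℝ)), lintegral_union measurableSet_Ioi
    (Set.Iic_disjoint_Ioi le_rfl), setLIntegral_congr Iio_ae_eq_Iic.symm, h2]
  refine (add_le_add h1 h1).trans ?_
  have h1a : 0 < 1 - a := by linarith
  rw [← ENNReal.ofReal_add (by positivity) (by positivity)]
  apply le_of_eq; congr 1; ring

lemma hz_kernel (a ℓ : ℝ) (ha : 0 < a) (ha1 : a < 1) (hl : 0 < ℓ) (f : ℝ → ℝ)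
    (hf : Continuous f) (H1 : ∀ h, ∫⁻ x, ENNReal.ofReal |f (x + h) - f x| ≤ ENNReal.ofReal (2 * |h|))
    (H2 : ∀ h, ∫⁻ x, ENNReal.ofReal |f (x + h) - f x| ≤ ENNReal.ofReal (2 * ℓ)) :
    ∫⁻ x, ∫⁻ y, ENNReal.ofReal (|f x - f y| / |x - y| ^ (1 + a)) ≤
      ENNReal.ofReal (4 * ℓ ^ (1 - a) / (a * (1 - a))) := by
  have e : ∫⁻ x, ∫⁻ y, ENNReal.ofReal (|f x - f y| / |x - y| ^ (1 + a)) =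
      ∫⁻ x, ∫⁻ h, ENNReal.ofReal (|f (x + h) - f x| / |h| ^ (1 + a)) := by
    congr 1; ext x
    rw [← lintegral_add_left_eq_self _ x]
    congr 1; ext h
    rw [abs_sub_comm (f x)]; simp
  rw [e, lintegral_lintegral_swap]
  · refine le_trans (lintegral_mono fun h => ?_) (hz_kernel2 a ℓ ha ha1 hl)
    have : ∀ x, ENNReal.ofReal (|f (x + h) - f x| / |h| ^ (1 + a)) =
        ENNReal.ofReal |f (x + h) - f x| * ENNReal.ofReal ((|h| ^ (1 + a))⁻¹) := by
      intro x
      rw [← ENNReal.ofReal_mul (abs_nonneg _)]; rfl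
    simp_rw [this]
    rw [lintegral_mul_const _ (by fun_prop), div_eq_mul_inv, ENNReal.ofReal_mul (by positivity)]
    gcongr
    rcases min_choice (2 * |h|) (2 * ℓ) with h' | h' <;> rw [h']
    · exact H1 h
    · exact H2 h
  · apply Measurable.aemeasurable
    simp only [Function.uncurry_def]
    fun_prop

noncomputable def hzb (c L δ x : ℝ) : ℝ :=
  Real.smoothTransition ((x - c + L) / δ) - (1 - Real.smoothTransition ((L - (x - c)) / δ))

section bump
variable {c L δ : ℝ}

lemma hzb_contDiff (c L δ : ℝ) : ContDiff ℝ (⊤ : ℕ∞) (hzb c L δ) := by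
  unfold hzb
  have := Real.smoothTransition.contDiff (n := ⊤)
  have h1 : ContDiff ℝ (⊤ : ℕ∞) fun x : ℝ => (x - c + L) / δ := by fun_prop
  have h2 : ContDiff ℝ (⊤ : ℕ∞) fun x : ℝ => (L - (x - c)) / δ := by fun_prop
  exact (this.comp h1).sub (contDiff_const.sub (this.comp h2))

lemma hzb_le_one (c L δ x : ℝ) : hzb c L δ x ≤ 1 := by
  unfold hzb
  linarith [Real.smoothTransition.le_one ((x - c + L) / δ),
    Real.smoothTransition.le_one ((L - (x - c)) / δ)]

lemma hzb_nonneg (hδ : 0 < δ) (hL : δ ≤ L) (x : ℝ) : 0 ≤ hzb c L δ x := by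
  unfold hzb
  rcases le_total c x with h | h
  · rw [Real.smoothTransition.one_of_one_le (x := (x - c + L) / δ)]
    · linarith [Real.smoothTransition.nonneg ((L - (x - c)) / δ)]
    · rw [le_div_iff₀ hδ]; linarith
  · rw [Real.smoothTransition.one_of_one_le (x := (L - (x - c)) / δ)]
    · linarith [Real.smoothTransition.nonneg ((x - c + L) / δ)]
    · rw [le_div_iff₀ hδ]; linarith

lemma hzb_zero (hδ : 0 < δ) (hL : δ ≤ L) {x : ℝ} (hx : L ≤ |x - c|) : hzb c L δ x = 0 := by
  unfold hzb
  rcases le_abs.1 hx with h | h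
  · rw [Real.smoothTransition.one_of_one_le (x := (x - c + L) / δ),
      Real.smoothTransition.zero_of_nonpos]
    · ring
    · exact div_nonpos_of_nonpos_of_nonneg (by linarith) hδ.le
    · rw [le_div_iff₀ hδ]; linarith
  · rw [Real.smoothTransition.one_of_one_le (x := (L - (x - c)) / δ),
      Real.smoothTransition.zero_of_nonpos]
    · ring
    · exact div_nonpos_of_nonpos_of_nonneg (by linarith) hδ.le
    · rw [le_div_iff₀ hδ]; linarith

lemma hzb_one (hδ : 0 < δ) {x : ℝ} (hx : |x - c| ≤ L - δ) : hzb c L δ x = 1 := by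
  unfold hzb
  have := abs_le.1 hx
  rw [Real.smoothTransition.one_of_one_le, Real.smoothTransition.one_of_one_le]
  · ring
  · rw [le_div_iff₀ hδ]; linarith
  · rw [le_div_iff₀ hδ]; linarith

lemma hzb_H1 (hδ : 0 < δ) (h : ℝ) :
    ∫⁻ x, ENNReal.ofReal |hzb c L δ (x + h) - hzb c L δ x| ≤ ENNReal.ofReal (2 * |h|) := by
  have hc := Real.smoothTransition.continuous
  have k1 := hz_step' (fun x => Real.smoothTransition ((x - c + L) / δ))
    (fun x y hxy => Real.smoothTransition.monotone (by gcongr)) (by fun_prop) (c - L) (c - L + δ)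
    (by linarith)
    (fun x hx => Real.smoothTransition.zero_of_nonpos
      (div_nonpos_of_nonpos_of_nonneg (by linarith) hδ.le))
    (fun x hx => Real.smoothTransition.one_of_one_le (by rw [le_div_iff₀ hδ]; linarith)) h
  have k2 := hz_step' (fun x => 1 - Real.smoothTransition ((L - (x - c)) / δ))
    (fun x y hxy => sub_le_sub_left (Real.smoothTransition.monotone (by gcongr)) _) (by fun_prop)
    (c + L - δ) (c + L) (by linarith)
    (fun x hx => by
      rw [Real.smoothTransition.one_of_one_le (by rw [le_div_iff₀ hδ]; linarith)]; simp)
    (fun x hx => by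
      rw [Real.smoothTransition.zero_of_nonpos
        (div_nonpos_of_nonpos_of_nonneg (by linarith) hδ.le)]; simp) h
  have : ENNReal.ofReal (2 * |h|) = ENNReal.ofReal |h| + ENNReal.ofReal |h| := by
    rw [← ENNReal.ofReal_add (abs_nonneg _) (abs_nonneg _)]; congr 1; ring
  rw [this]
  refine le_trans ?_ (add_le_add k1 k2)
  rw [← lintegral_add_left (by fun_prop)]
  refine lintegral_mono fun x => ?_
  rw [← ENNReal.ofReal_add (abs_nonneg _) (abs_nonneg _)]
  apply ENNReal.ofReal_le_ofReal
  unfold hzb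
  rw [sub_sub_sub_comm]
  exact abs_sub _ _

lemma hzb_int (hδ : 0 < δ) (hL : δ ≤ L) :
    ∫⁻ x, ENNReal.ofReal (hzb c L δ x) ≤ ENNReal.ofReal (2 * L) := by
  calc ∫⁻ x, ENNReal.ofReal (hzb c L δ x) ≤ ∫⁻ x, (Icc (c - L) (c + L)).indicator 1 x := by
        refine lintegral_mono fun x => ?_
        by_cases hx : x ∈ Icc (c - L) (c + L)
        · rw [indicator_of_mem hx]
          simpa using hzb_le_one c L δ x
        · rw [indicator_of_notMem hx, hzb_zero hδ hL]
          · simp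
          · by_contra hlt
            have := abs_lt.1 (not_le.1 hlt)
            exact hx ⟨by linarith, by linarith⟩
    _ = ENNReal.ofReal (2 * L) := by
        rw [lintegral_indicator_one measurableSet_Icc, Real.volume_Icc]; congr 1; ring

lemma hzb_H2 (hδ : 0 < δ) (hL : δ ≤ L) (h : ℝ) :
    ∫⁻ x, ENNReal.ofReal |hzb c L δ (x + h) - hzb c L δ x| ≤ ENNReal.ofReal (2 * (2 * L)) := by
  have hc := (hzb_contDiff c L δ).continuous
  have : ENNReal.ofReal (2 * (2 * L)) = ENNReal.ofReal (2 * L) + ENNReal.ofReal (2 * L) := by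
    rw [← ENNReal.ofReal_add (by linarith) (by linarith)]; congr 1; ring
  rw [this]
  have k := hzb_int (c := c) hδ hL
  have k' := k
  rw [← lintegral_add_right_eq_self _ h] at k
  refine le_trans ?_ (add_le_add k k')
  rw [← lintegral_add_left (by fun_prop)]
  refine lintegral_mono fun x => ?_
  rw [← ENNReal.ofReal_add (hzb_nonneg hδ hL _) (hzb_nonneg hδ hL _)]
  apply ENNReal.ofReal_le_ofReal
  refine (abs_sub _ _).trans ?_
  rw [abs_of_nonneg (hzb_nonneg hδ hL _), abs_of_nonneg (hzb_nonneg hδ hL _)]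

lemma hzb_G {a : ℝ} (ha : 0 < a) (ha1 : a < 1) (hδ : 0 < δ) (hL : δ ≤ L) :
    ∫⁻ x, ∫⁻ y, ENNReal.ofReal (|hzb c L δ x - hzb c L δ y| / |x - y| ^ (1 + a)) ≤
      ENNReal.ofReal (4 * (2 * L) ^ (1 - a) / (a * (1 - a))) :=
  hz_kernel a (2 * L) ha ha1 (by linarith) _ (hzb_contDiff c L δ).continuous
    (hzb_H1 hδ) (hzb_H2 hδ hL)

end bump

lemma hz_prod {ι : Type*} (S : Finset ι) (b c : ι → ℝ) (hb : ∀ i, b i ∈ Icc (0:ℝ) 1)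
    (hc : ∀ i, c i ∈ Icc (0:ℝ) 1) :
    |∏ i ∈ S, (1 - b i) - ∏ i ∈ S, (1 - c i)| ≤ ∑ i ∈ S, |b i - c i| := by
  classical
  induction S using Finset.induction_on with
  | empty => simp
  | insert i S hi ih =>
    rw [Finset.prod_insert hi, Finset.prod_insert hi, Finset.sum_insert hi]
    have e : (1 - b i) * ∏ i ∈ S, (1 - b i) - (1 - c i) * ∏ i ∈ S, (1 - c i) =
      (c i - b i) * ∏ i ∈ S, (1 - b i) + (1 - c i) *
        (∏ i ∈ S, (1 - b i) - ∏ i ∈ S, (1 - c i)) := by ring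
    rw [e]
    refine (abs_add_le _ _).trans (add_le_add ?_ ?_)
    · rw [abs_mul, abs_sub_comm]
      refine mul_le_of_le_one_right (abs_nonneg _) ?_
      rw [Finset.abs_prod]
      refine Finset.prod_le_one (fun _ _ => abs_nonneg _) fun j _ => ?_
      rw [abs_le]; constructor <;> linarith [(hb j).1, (hb j).2]
    · rw [abs_mul]
      refine le_trans (mul_le_of_le_one_left (abs_nonneg _) ?_) ih
      rw [abs_le]; constructor <;> linarith [(hc i).1, (hc i).2]

noncomputable def hzu (R ε x : ℝ) : ℝ :=
  hzb 0 (R - ε) ε x * ∏ k ∈ Finset.Icc (-⌊R⌋) ⌊R⌋, (1 - hzb (k : ℝ) (2 * ε) ε x)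

section u
variable {R ε : ℝ}

lemma hzp_mem (hε : 0 < ε) (x : ℝ) :
    ∏ k ∈ Finset.Icc (-⌊R⌋) ⌊R⌋, (1 - hzb (k : ℝ) (2 * ε) ε x) ∈ Icc (0:ℝ) 1 := by
  have h : ∀ k : ℤ, 0 ≤ 1 - hzb (k : ℝ) (2 * ε) ε x := fun k => by
    linarith [hzb_le_one (k : ℝ) (2 * ε) ε x]
  exact ⟨Finset.prod_nonneg fun k _ => h k, Finset.prod_le_one (fun k _ => h k) fun k _ => by
    linarith [hzb_nonneg (c := k) hε (by linarith : ε ≤ 2 * ε) x]⟩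

lemma hzu_mem (hε : 0 < ε) (hR : ε ≤ R - ε) (x : ℝ) : hzu R ε x ∈ Icc (0:ℝ) 1 := by
  have h1 := hzp_mem (R := R) hε x
  have h2 := hzb_nonneg (c := 0) hε hR x
  have h3 := hzb_le_one 0 (R - ε) ε x
  exact ⟨mul_nonneg h2 h1.1, mul_le_one₀ h3 h1.1 h1.2⟩

lemma hzu_contDiff (R ε : ℝ) : ContDiff ℝ (⊤ : ℕ∞) (hzu R ε) := by
  unfold hzu
  exact (hzb_contDiff _ _ _).mul (contDiff_prod fun k _ => contDiff_const.sub (hzb_contDiff _ _ _))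

lemma hzu_diff (hε : 0 < ε) (hR : ε ≤ R - ε) (x y : ℝ) :
    |hzu R ε x - hzu R ε y| ≤ |hzb 0 (R - ε) ε x - hzb 0 (R - ε) ε y| +
      ∑ k ∈ Finset.Icc (-⌊R⌋) ⌊R⌋, |hzb (k : ℝ) (2 * ε) ε x - hzb (k : ℝ) (2 * ε) ε y| := by
  have hm : ∀ (z : ℝ) (k : ℤ), hzb (k : ℝ) (2 * ε) ε z ∈ Icc (0:ℝ) 1 := fun z k =>
    ⟨hzb_nonneg hε (by linarith) z, hzb_le_one _ _ _ _⟩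
  have h := hz_prod (Finset.Icc (-⌊R⌋) ⌊R⌋) _ _ (hm x) (hm y)
  unfold hzu
  set P := ∏ k ∈ Finset.Icc (-⌊R⌋) ⌊R⌋, (1 - hzb (k : ℝ) (2 * ε) ε x) with hP
  set Q := ∏ k ∈ Finset.Icc (-⌊R⌋) ⌊R⌋, (1 - hzb (k : ℝ) (2 * ε) ε y) with hQ
  have e : hzb 0 (R - ε) ε x * P - hzb 0 (R - ε) ε y * Q =
    (hzb 0 (R - ε) ε x - hzb 0 (R - ε) ε y) * P + hzb 0 (R - ε) ε y * (P - Q) := by ring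
  rw [e]
  refine (abs_add_le _ _).trans (add_le_add ?_ ?_)
  · rw [abs_mul]
    refine mul_le_of_le_one_right (abs_nonneg _) ?_
    rw [abs_of_nonneg (hzp_mem hε x).1]; exact (hzp_mem hε x).2
  · rw [abs_mul]
    refine le_trans (mul_le_of_le_one_left (abs_nonneg _) ?_) h
    rw [abs_of_nonneg (hzb_nonneg hε hR _)]; exact hzb_le_one _ _ _ _

lemma hzu_G (hR1 : 1 ≤ R) {s p : ℝ} (hp : 1 ≤ p) (ha : 0 < s * p) (ha1 : s * p < 1)
    (hε : 0 < ε) (hR : ε ≤ R - ε) :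
    gagliardo1 s p univ (hzu R ε) ≤ ENNReal.ofReal (4 / (s * p * (1 - s * p)) *
      ((2 * R) ^ (1 - s * p) + (2 * ⌊R⌋ + 1) * (4 * ε) ^ (1 - s * p))) := by
  unfold gagliardo1
  simp only [Measure.restrict_univ]
  have hcu := (hzu_contDiff R ε).continuous
  have hcb := fun c L => (hzb_contDiff c L ε).continuous
  have hm : ∀ c L, Measurable (fun z : ℝ × ℝ =>
    ENNReal.ofReal (|hzb c L ε z.1 - hzb c L ε z.2| / |z.1 - z.2| ^ (1 + s * p))) := by
      intro c L
      have := (hcb c L).measurable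
      fun_prop
  have hm2 : ∀ c L x, Measurable (fun y : ℝ =>
    ENNReal.ofReal (|hzb c L ε x - hzb c L ε y| / |x - y| ^ (1 + s * p))) := by
      intro c L x
      have := (hcb c L).measurable
      fun_prop
  calc _ ≤ ∫⁻ x, ∫⁻ y, (ENNReal.ofReal (|hzb 0 (R - ε) ε x - hzb 0 (R - ε) ε y| /
          |x - y| ^ (1 + s * p)) + ∑ k ∈ Finset.Icc (-⌊R⌋) ⌊R⌋, ENNReal.ofReal
          (|hzb (k : ℝ) (2 * ε) ε x - hzb (k : ℝ) (2 * ε) ε y| / |x - y| ^ (1 + s * p))) := by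
        refine lintegral_mono fun x => lintegral_mono fun y => ?_
        rw [← ENNReal.ofReal_sum_of_nonneg (fun _ _ => by positivity),
          ← ENNReal.ofReal_add (by positivity) (Finset.sum_nonneg fun _ _ => by positivity)]
        apply ENNReal.ofReal_le_ofReal
        rw [← Finset.sum_div, ← add_div]
        gcongr
        refine le_trans (Real.rpow_le_self_of_le_one (abs_nonneg _) ?_ hp) (hzu_diff hε hR x y)
        have h1 := hzu_mem hε hR x
        have h2 := hzu_mem hε hR y
        rw [abs_le]; constructor <;> linarith [h1.1, h1.2, h2.1, h2.2]
    _ = (∫⁻ x, ∫⁻ y, ENNReal.ofReal (|hzb 0 (R - ε) ε x - hzb 0 (R - ε) ε y| /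
          |x - y| ^ (1 + s * p))) + ∑ k ∈ Finset.Icc (-⌊R⌋) ⌊R⌋, ∫⁻ x, ∫⁻ y, ENNReal.ofReal
          (|hzb (k : ℝ) (2 * ε) ε x - hzb (k : ℝ) (2 * ε) ε y| / |x - y| ^ (1 + s * p)) := by
        rw [← lintegral_finsetSum _ (fun k _ => (hm _ _).lintegral_prod_right'),
          ← lintegral_add_left ((hm _ _).lintegral_prod_right')]
        congr 1; ext x
        dsimp only
        rw [lintegral_add_left (hm2 _ _ _), lintegral_finsetSum _ (fun k _ => hm2 _ _ _)]
    _ ≤ ENNReal.ofReal (4 * (2 * (R - ε)) ^ (1 - s * p) / (s * p * (1 - s * p))) +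
        ∑ k ∈ Finset.Icc (-⌊R⌋) ⌊R⌋, ENNReal.ofReal
          (4 * (2 * (2 * ε)) ^ (1 - s * p) / (s * p * (1 - s * p))) := by
        refine add_le_add (hzb_G ha ha1 hε hR) (Finset.sum_le_sum fun k _ => ?_)
        exact hzb_G ha ha1 hε (by linarith)
    _ ≤ _ := by
        have h1a : 0 < 1 - s * p := by linarith
        have hRε : 0 ≤ R - ε := by linarith
        rw [← ENNReal.ofReal_sum_of_nonneg (fun _ _ => by positivity),
          ← ENNReal.ofReal_add (by positivity) (Finset.sum_nonneg fun _ _ => by positivity)]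
        apply ENNReal.ofReal_le_ofReal
        rw [Finset.sum_const, Int.card_Icc, nsmul_eq_mul]
        have hN : (1:ℤ) ≤ ⌊R⌋ := Int.le_floor.2 (by simpa using hR1)
        have e1 : (((⌊R⌋ + 1 - -⌊R⌋).toNat : ℕ) : ℝ) = 2 * ⌊R⌋ + 1 := by
          have : (((⌊R⌋ + 1 - -⌊R⌋).toNat : ℕ) : ℤ) = 2 * ⌊R⌋ + 1 := by omega
          exact_mod_cast this
        rw [e1]
        have e2 : (2 * (R - ε)) ^ (1 - s * p) ≤ (2 * R) ^ (1 - s * p) := by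
          apply Real.rpow_le_rpow <;> linarith
        have e3 : 2 * (2 * ε) = 4 * ε := by ring
        rw [e3]
        have : 0 ≤ 4 / (s * p * (1 - s * p)) := by positivity
        calc _ = 4 / (s * p * (1 - s * p)) * ((2 * (R - ε)) ^ (1 - s * p) +
              (2 * ⌊R⌋ + 1) * (4 * ε) ^ (1 - s * p)) := by ring
          _ ≤ _ := by gcongr

end u

lemma hz_scale (s p : ℝ) (hp : 1 ≤ p) (Ω : Set ℝ) (u : ℝ → ℝ) (h1 : ContDiff ℝ (⊤ : ℕ∞) u)
    (h2 : HasCompactSupport u) (h3 : tsupport u ⊆ Ω) (D : ℝ) (hD : 0 < D)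
    (hDe : ∫ x in Ω, |u x| ^ p / Metric.infDist x (frontier Ω) ^ (s * p) = D) :
    hardyConst1 s p Ω ≤ ENNReal.ofReal D⁻¹ * gagliardo1 s p univ u := by
  have hp0 : p ≠ 0 := by linarith
  set t : ℝ := D⁻¹ ^ (1 / p) with ht
  have ht0 : 0 ≤ t := by positivity
  have htp : t ^ p = D⁻¹ := by
    rw [ht, ← Real.rpow_mul (by positivity), one_div_mul_cancel hp0, Real.rpow_one]
  have hsub : tsupport (fun x => t * u x) ⊆ tsupport u :=
    closure_mono (fun x hx h0 => hx (by simp only [h0, mul_zero]))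
  apply sInf_le
  refine ⟨fun x => t * u x, contDiff_const.mul h1, ?_, hsub.trans h3, ?_, ?_⟩
  · exact h2.mul_left
  · have : ∀ x, |t * u x| ^ p / Metric.infDist x (frontier Ω) ^ (s * p) =
        D⁻¹ * (|u x| ^ p / Metric.infDist x (frontier Ω) ^ (s * p)) := by
      intro x
      rw [abs_mul, abs_of_nonneg ht0, Real.mul_rpow ht0 (abs_nonneg _), htp]; ring
    simp_rw [this]
    rw [integral_const_mul, hDe, inv_mul_cancel₀ hD.ne']
  · unfold gagliardo1
    rw [← lintegral_const_mul' _ _ ENNReal.ofReal_ne_top]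
    congr 1; ext x
    rw [← lintegral_const_mul' _ _ ENNReal.ofReal_ne_top]
    congr 1; ext y
    rw [← ENNReal.ofReal_mul (by positivity), ← mul_sub, abs_mul, abs_of_nonneg ht0,
      Real.mul_rpow ht0 (abs_nonneg _), htp]
    congr 1; ring

lemma hz_isOpen (R : ℝ) : IsOpen (Ioo (-R) R \ range ((↑) : ℤ → ℝ)) :=
  isOpen_Ioo.sdiff Int.isClosedEmbedding_coe_real.isClosed_range

lemma hz_frontier (R : ℝ) (hR : 1 ≤ R) (k : ℤ) (hk : |(k:ℝ)| ≤ R) :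
    (k : ℝ) ∈ frontier (Ioo (-R) R \ range ((↑) : ℤ → ℝ)) := by
  rw [(hz_isOpen R).frontier_eq]
  refine ⟨?_, fun h => h.2 ⟨k, rfl⟩⟩
  have hd : Dense (range ((↑) : ℤ → ℝ))ᶜ := (countable_range _).dense_compl ℝ
  have h := closure_mono (hd.open_subset_closure_inter (isOpen_Ioo (a := -R) (b := R)))
  rw [closure_closure, closure_Ioo (by linarith)] at h
  exact h (abs_le.1 hk)

lemma hz_pos (R : ℝ) (hR : 1 ≤ R) (x : ℝ) (hx : x ∈ Ioo (-R) R \ range ((↑) : ℤ → ℝ)) :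
    0 < infDist x (frontier (Ioo (-R) R \ range ((↑) : ℤ → ℝ))) := by
  rw [← isClosed_frontier.notMem_iff_infDist_pos
    ⟨((0:ℤ):ℝ), hz_frontier R hR 0 (by simp; linarith)⟩, (hz_isOpen R).frontier_eq]
  exact fun h => h.2 hx

lemma hzu_tsupport {R ε : ℝ} (hε : 0 < ε) (hR : ε ≤ R - ε) :
    tsupport (hzu R ε) ⊆ Icc (-(R - ε)) (R - ε) ∩ (Ioo (-R) R \ range ((↑) : ℤ → ℝ)) := by
  have h1 : tsupport (hzu R ε) ⊆ Icc (-(R - ε)) (R - ε) := by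
    refine closure_minimal (fun x hx => ?_) isClosed_Icc
    by_contra hn
    apply hx
    unfold hzu
    rw [hzb_zero hε hR, zero_mul]
    by_contra hlt
    have := abs_lt.1 (not_le.1 hlt)
    exact hn ⟨by linarith, by linarith⟩
  refine fun x hx => ⟨h1 hx, ⟨by linarith [(h1 hx).1], by linarith [(h1 hx).2]⟩, ?_⟩
  rintro ⟨k, rfl⟩
  have hk : k ∈ Finset.Icc (-⌊R⌋) ⌊R⌋ := by
    have := h1 hx
    rw [Finset.mem_Icc]
    constructor
    · rw [neg_le]; apply Int.le_floor.2; push_cast; linarith [this.1]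
    · apply Int.le_floor.2; linarith [this.2]
  have h2 : tsupport (hzu R ε) ⊆ {x | ε ≤ |x - k|} := by
    refine closure_minimal (fun x hx => ?_) (isClosed_le continuous_const (by fun_prop))
    by_contra hn
    apply hx
    unfold hzu
    rw [Finset.prod_eq_zero hk, mul_zero]
    rw [hzb_one hε, sub_self]
    rw [mem_ofPred_eq, not_le] at hn
    linarith
  have := h2 hx
  simp at this
  linarith

lemma hzu_one {R ε : ℝ} (hε : 0 < ε) {x : ℝ} (hx : |x| ≤ ⌊R⌋)
    (h : 2 * ε ≤ |x - round x|) : hzu R ε x = 1 := by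
  have hr : ∀ k : ℤ, 2 * ε ≤ |x - k| := fun k => h.trans (round_le x k)
  unfold hzu
  rw [hzb_one hε, one_mul]
  · apply Finset.prod_eq_one
    intro k _
    rw [hzb_zero hε (by linarith) (hr k), sub_zero]
  · have hx' := abs_le.1 hx
    have hf := Int.floor_le R
    have e1 := hr ⌊R⌋
    have e2 := hr (-⌊R⌋)
    push_cast at e2
    rw [abs_of_nonpos (by linarith)] at e1
    rw [abs_of_nonneg (by linarith)] at e2
    rw [abs_le]; constructor <;> linarith

noncomputable def hzq (a ε t : ℝ) : ℝ := if 2 * ε ≤ t then t ^ (-a) else 0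

lemma hzq_nonneg {a ε : ℝ} (hε : 0 < ε) (t : ℝ) : 0 ≤ hzq a ε t := by
  unfold hzq; split_ifs with h
  · exact Real.rpow_nonneg (by linarith) _
  · exact le_rfl

lemma hzq_le {a ε : ℝ} (ha : 0 < a) (hε : 0 < ε) (t : ℝ) : hzq a ε t ≤ (2 * ε) ^ (-a) := by
  unfold hzq; split_ifs with h
  · exact Real.rpow_le_rpow_of_nonpos (by linarith) h (by linarith)
  · positivity

lemma hzq_meas (a ε : ℝ) : Measurable (hzq a ε) :=
  Measurable.ite measurableSet_Ici (by fun_prop) measurable_const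

lemma hzq_int {a ε : ℝ} (ha : 0 < a) (hε : 0 < ε) (f : ℝ → ℝ) (hf : Measurable f) (b c : ℝ) :
    IntervalIntegrable (fun x => hzq a ε (f x)) volume b c := by
  apply (intervalIntegrable_const (c := (2 * ε) ^ (-a))).mono_fun
  · exact ((hzq_meas a ε).comp hf).aestronglyMeasurable
  · refine Eventually.of_forall fun x => ?_
    dsimp only
    rw [Real.norm_of_nonneg (hzq_nonneg hε _), Real.norm_of_nonneg (by positivity)]
    exact hzq_le ha hε _

lemma hz_round_meas : Measurable fun x : ℝ => |x - round x| := by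
  simp_rw [round_eq]
  fun_prop

lemma hzq_half {a ε : ℝ} (ha : 0 < a) (ha1 : a < 1) (hε : 0 < ε) (hε1 : ε < 1 / 4) :
    ∫ t in (0:ℝ)..(1/2), hzq a ε t =
      ((1 / 2) ^ (1 - a) - (2 * ε) ^ (1 - a)) / (1 - a) := by
  change ∫ t in (0:ℝ)..(1/2), hzq a ε (id t) = _
  rw [← intervalIntegral.integral_add_adjacent_intervals (hzq_int ha hε _ measurable_id 0 (2 * ε))
    (hzq_int ha hε _ measurable_id (2 * ε) (1 / 2))]
  have e1 : ∫ t in (0:ℝ)..(2 * ε), hzq a ε (id t) = 0 := by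
    rw [intervalIntegral.integral_of_le (by linarith), integral_Ioc_eq_integral_Ioo]
    rw [setIntegral_congr_fun measurableSet_Ioo (g := fun _ => 0)]
    · simp
    · intro x hx
      simp only [hzq, id]
      rw [if_neg (not_le.2 hx.2)]
  have e2 : ∫ t in (2 * ε)..(1 / 2), hzq a ε (id t) = ∫ t in (2 * ε)..(1 / 2), t ^ (-a) := by
    apply intervalIntegral.integral_congr
    intro x hx
    rw [uIcc_of_le (by linarith)] at hx
    simp only [hzq, id]
    rw [if_pos hx.1]
  rw [e1, e2, integral_rpow (Or.inl (by linarith)), zero_add, show -a + 1 = 1 - a by ring]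

lemma hzq_per {a ε : ℝ} (ha : 0 < a) (ha1 : a < 1) (hε : 0 < ε) (hε1 : ε < 1 / 4) (N : ℤ) :
    ∫ x in (-N:ℝ)..N, hzq a ε |x - round x| =
      4 * N * (((1 / 2) ^ (1 - a) - (2 * ε) ^ (1 - a)) / (1 - a)) := by
  have hper : Function.Periodic (fun x : ℝ => hzq a ε |x - round x|) 1 := by
    intro x
    simp only [round_add_one]; push_cast; simp
  have hi := hzq_int (a := a) ha hε _ hz_round_meas
  have h := hper.intervalIntegral_add_zsmul_eq (2 * N) (-N : ℝ) hi
  have e : (-N : ℝ) + (2 * N : ℤ) • (1:ℝ) = N := by simp; ring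
  rw [e, hper.intervalIntegral_add_eq _ (-(1/2))] at h
  rw [h, show (-(1/2) + 1 : ℝ) = 1/2 by norm_num]
  have k : ∫ x in (-(1/2):ℝ)..(1/2), hzq a ε |x - round x| =
      ∫ x in (-(1/2):ℝ)..(1/2), hzq a ε |x| := by
    rw [intervalIntegral.integral_of_le (by norm_num), intervalIntegral.integral_of_le (by norm_num),
      integral_Ioc_eq_integral_Ioo, integral_Ioc_eq_integral_Ioo]
    apply setIntegral_congr_fun measurableSet_Ioo
    intro x hx
    simp only
    rw [round_eq_zero_iff.2 ⟨hx.1.le, hx.2⟩]; simp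
  have hi2 := hzq_int (a := a) ha hε (fun x => |x|) (by fun_prop)
  have k2 : ∫ x in (0:ℝ)..(1/2), hzq a ε |x| = ∫ x in (0:ℝ)..(1/2), hzq a ε x := by
    apply intervalIntegral.integral_congr
    intro x hx
    rw [uIcc_of_le (by norm_num)] at hx
    simp only
    rw [abs_of_nonneg hx.1]
  have k3 : ∫ x in (-(1/2):ℝ)..0, hzq a ε |x| = ∫ x in (0:ℝ)..(1/2), hzq a ε x := by
    rw [← k2]
    have := intervalIntegral.integral_comp_neg (a := 0) (b := 1/2) (fun x : ℝ => hzq a ε |x|)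
    simp only [abs_neg, neg_zero] at this
    exact this.symm
  rw [k, ← intervalIntegral.integral_add_adjacent_intervals (hi2 (-(1/2)) 0) (hi2 0 (1/2)), k2, k3,
    hzq_half ha ha1 hε hε1, zsmul_eq_mul]
  push_cast; ring

lemma hzu_D {R : ℝ} (hR1 : 1 ≤ R) {s p : ℝ} (hp : 1 ≤ p) (ha : 0 < s * p) (ha1 : s * p < 1)
    {ε : ℝ} (hε : 0 < ε) (hε1 : ε < 1 / 4) :
    4 * ⌊R⌋ * (((1 / 2) ^ (1 - s * p) - (2 * ε) ^ (1 - s * p)) / (1 - s * p)) ≤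
    ∫ x in Ioo (-R) R \ range ((↑) : ℤ → ℝ), |hzu R ε x| ^ p /
      infDist x (frontier (Ioo (-R) R \ range ((↑) : ℤ → ℝ))) ^ (s * p) := by
  have hN : (1:ℤ) ≤ ⌊R⌋ := Int.le_floor.2 (by simpa using hR1)
  have hN' : (1:ℝ) ≤ ⌊R⌋ := by exact_mod_cast hN
  have hNR := Int.floor_le R
  have hts := hzu_tsupport (R := R) hε (by linarith)
  have hpos := hz_pos R hR1
  have hfr := hz_frontier R hR1
  have hop := hz_isOpen R
  set Ω := Ioo (-R) R \ range ((↑) : ℤ → ℝ) with hΩ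
  set F : ℝ → ℝ := fun x => |hzu R ε x| ^ p / infDist x (frontier Ω) ^ (s * p) with hF
  have hF0 : ∀ x, 0 ≤ F x := fun x =>
    div_nonneg (by positivity) (Real.rpow_nonneg infDist_nonneg _)
  have hc := (hzu_contDiff R ε).continuous
  have hFi : Integrable F := by
    rw [← integrableOn_iff_integrable_of_support_subset (s := tsupport (hzu R ε))]
    · apply ContinuousOn.integrableOn_compact
      · exact isCompact_Icc.of_isClosed_subset (isClosed_tsupport _) (hts.trans inter_subset_left)
      · apply ContinuousOn.div
        · exact (hc.abs.rpow_const fun x => Or.inr (by linarith)).continuousOn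
        · exact ((continuous_infDist_pt _).rpow_const fun x => Or.inr ha.le).continuousOn
        · intro x hx
          exact (Real.rpow_pos_of_pos (hpos x (hts hx).2) _).ne'
    · intro x hx
      apply subset_tsupport
      intro h0
      apply hx
      simp only [hF]
      rw [h0, abs_zero, Real.zero_rpow (by linarith), zero_div]
  rw [← hzq_per ha ha1 hε hε1, intervalIntegral.integral_of_le (by linarith),
    ← integral_indicator measurableSet_Ioc, ← integral_indicator hop.measurableSet]
  apply integral_mono_of_nonneg
  · exact Eventually.of_forall fun x => indicator_nonneg (fun _ _ => hzq_nonneg hε _) x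
  · exact hFi.indicator hop.measurableSet
  · refine Eventually.of_forall fun x => ?_
    by_cases hx : x ∈ Ioc (-⌊R⌋ : ℝ) ⌊R⌋
    · rw [indicator_of_mem hx]
      have hxa : |x| ≤ ⌊R⌋ := abs_le.2 ⟨hx.1.le, hx.2⟩
      unfold hzq
      split_ifs with h
      · have hxΩ : x ∈ Ω := by
          refine ⟨⟨by linarith [hx.1], ?_⟩, ?_⟩
          · refine lt_of_lt_of_le (lt_of_le_of_ne hx.2 ?_) hNR
            intro h'
            rw [h'] at h; simp at h; linarith
          · rintro ⟨k, rfl⟩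
            simp at h; linarith
        rw [indicator_of_mem hxΩ]
        change _ ≤ |hzu R ε x| ^ p / infDist x (frontier Ω) ^ (s * p)
        rw [hzu_one hε hxa h, abs_one, Real.one_rpow, one_div, ← Real.rpow_neg infDist_nonneg]
        have hd : infDist x (frontier Ω) ≤ |x - round x| := by
          rw [← Real.dist_eq]
          apply infDist_le_dist_of_mem
          apply hfr
          refine le_trans ?_ hNR
          rw [abs_le]
          have h1 : round x ≤ ⌊R⌋ := by
            rw [round_eq, ← Int.lt_add_one_iff, Int.floor_lt]; push_cast; linarith [hx.2]
          have h2 : -⌊R⌋ ≤ round x := by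
            rw [round_eq]; apply Int.le_floor.2; push_cast; linarith [hx.1]
          exact ⟨by exact_mod_cast h2, by exact_mod_cast h1⟩
        exact Real.rpow_le_rpow_of_nonpos (hpos x hxΩ) hd (by linarith)
      · exact indicator_nonneg (fun _ _ => hF0 _) x
    · rw [indicator_of_notMem hx]
      exact indicator_nonneg (fun _ _ => hF0 _) x

lemma hz_bound (R : ℝ) (hR : 1 ≤ R)
    (s p : ℝ) (hp : 1 ≤ p) (ha : 0 < s * p) (hsp : s * p < 1) (ε : ℝ) (hε : 0 < ε)
    (hε1 : ε < 1 / 4) :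
    hardyConst1 s p (Set.Ioo (-R) R \ Set.range ((↑) : ℤ → ℝ)) ≤
      ENNReal.ofReal ((4 * ⌊R⌋ * (((1 / 2) ^ (1 - s * p) - (2 * ε) ^ (1 - s * p)) / (1 - s * p)))⁻¹ *
        (4 / (s * p * (1 - s * p)) *
      ((2 * R) ^ (1 - s * p) + (2 * ⌊R⌋ + 1) * (4 * ε) ^ (1 - s * p)))) := by
  have hN : (1:ℤ) ≤ ⌊R⌋ := Int.le_floor.2 (by simpa using hR)
  have hN' : (1:ℝ) ≤ ⌊R⌋ := by exact_mod_cast hN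
  have hts := hzu_tsupport (R := R) hε (by linarith)
  have hD := hzu_D hR hp ha hsp hε hε1
  have h1a : 0 < 1 - s * p := by linarith
  have hlt : (2 * ε) ^ (1 - s * p) < (1 / 2) ^ (1 - s * p) :=
    Real.rpow_lt_rpow (by linarith) (by linarith) h1a
  have hpos : 0 < 4 * ⌊R⌋ * (((1 / 2) ^ (1 - s * p) - (2 * ε) ^ (1 - s * p)) / (1 - s * p)) := by
    have : 0 < (1 / 2) ^ (1 - s * p) - (2 * ε) ^ (1 - s * p) := by linarith
    positivity
  refine (hz_scale s p hp _ (hzu R ε) (hzu_contDiff R ε)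
    (isCompact_Icc.of_isClosed_subset (isClosed_tsupport _) (hts.trans inter_subset_left))
    (hts.trans inter_subset_right) _ (hpos.trans_le hD) rfl).trans ?_
  rw [ENNReal.ofReal_mul (by positivity)]
  refine mul_le_mul' (ENNReal.ofReal_le_ofReal (inv_anti₀ hpos hD)) ?_
  exact hzu_G hR hp ha hsp hε (by linarith)

/-- for `R ≥ 1` and `sp < 1`,
`𝔥_{s,p}((-R,R)∖ℤ) ≤ (R^{1-sp}/⌊R⌋)·4^{1-sp}/(sp)`. -/
theorem hardy_interval_minus_integers (R : ℝ) (hR : 1 ≤ R)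
    (s p : ℝ) (hs : s ∈ Set.Ioo (0 : ℝ) 1) (hp : 1 ≤ p) (hsp : s * p < 1) :
    hardyConst1 s p (Set.Ioo (-R) R \ Set.range ((↑) : ℤ → ℝ)) ≤
      ENNReal.ofReal (R ^ (1 - s * p) / (⌊R⌋ : ℝ) * (4 ^ (1 - s * p) / (s * p))) := by
  have ha : 0 < s * p := mul_pos hs.1 (by linarith)
  have h1a : 0 < 1 - s * p := by linarith
  have hN : (1:ℤ) ≤ ⌊R⌋ := Int.le_floor.2 (by simpa using hR)
  have hN' : (1:ℝ) ≤ ⌊R⌋ := by exact_mod_cast hN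
  have hev : ∀ᶠ ε : ℝ in nhdsWithin 0 (Ioi 0), 0 < ε ∧ ε < 1 / 4 :=
    Ioo_mem_nhdsGT (by norm_num)
  refine ge_of_tendsto (f := fun ε : ℝ => ENNReal.ofReal
    ((4 * ⌊R⌋ * (((1 / 2) ^ (1 - s * p) - (2 * ε) ^ (1 - s * p)) / (1 - s * p)))⁻¹ *
        (4 / (s * p * (1 - s * p)) *
      ((2 * R) ^ (1 - s * p) + (2 * ⌊R⌋ + 1) * (4 * ε) ^ (1 - s * p))))) ?_
    (hev.mono fun ε h => hz_bound R hR s p hp ha hsp ε h.1 h.2)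
  apply ENNReal.tendsto_ofReal
  have hh : (0:ℝ) < (1 / 2) ^ (1 - s * p) := by positivity
  have hca : ContinuousAt (fun ε : ℝ =>
    ((4 * ⌊R⌋ * (((1 / 2) ^ (1 - s * p) - (2 * ε) ^ (1 - s * p)) / (1 - s * p)))⁻¹ *
        (4 / (s * p * (1 - s * p)) *
      ((2 * R) ^ (1 - s * p) + (2 * ⌊R⌋ + 1) * (4 * ε) ^ (1 - s * p))))) 0 := by
    have c1 : ∀ c : ℝ, ContinuousAt (fun ε : ℝ => (c * ε) ^ (1 - s * p)) 0 := fun c =>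
      ((continuous_const.mul continuous_id).rpow_const fun _ => Or.inr h1a.le).continuousAt
    refine ContinuousAt.mul (ContinuousAt.inv₀ ?_ ?_) ?_
    · exact continuousAt_const.mul ((continuousAt_const.sub (c1 2)).div_const _)
    · simp only [mul_zero, Real.zero_rpow h1a.ne', sub_zero]
      positivity
    · exact continuousAt_const.mul (continuousAt_const.add (continuousAt_const.mul (c1 4)))
  have ht := hca.tendsto.mono_left (nhdsWithin_le_nhds (s := Ioi (0:ℝ)))
  convert ht using 2
  simp only [mul_zero, Real.zero_rpow h1a.ne', sub_zero, add_zero]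
  have e : (4:ℝ) ^ (1 - s * p) * (1 / 2) ^ (1 - s * p) = 2 ^ (1 - s * p) := by
    rw [← Real.mul_rpow (by norm_num) (by norm_num)]; norm_num
  rw [Real.mul_rpow (by norm_num) (by linarith), ← e]
  field_simp
end
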